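/- Let f(Z), g(Z) ∈ ℤ[Z] satisfy the nondegeneracy condition. Then there is a constant C (depending only on f, g) such that for every positive integer T, all non-empty sets of integers U, V ⊆ I(T), every real x ≥ 2 and every sequence of integers 𝔄 = (a_p) indexed by the primes, one has Σ_{u ∈ U, v ∈ V, Δ(u+v) ≠ 0} π_{E(u+v)}(𝔄; x) ≤ C (T·#U·#V + (#U·#V)^{3/4} x^{5/4}). -/

import Mathlib

open Polynomial Finset

attribute [local instance 10] Classical.propDecidable

noncomputable section

/-- The discriminant polynomial `Δ = -16(4f³+27g²)`. -/
def Dpoly (f g : Polynomial ℤ) : Polynomial ℤ := -16 * (4 * f ^ 3 + 27 * g ^ 2)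

/-- Nondegeneracy: `Δ ≠ 0` as a polynomial and the `j`-invariant
`j = -1728(4f)³/Δ` is not a constant rational function, i.e. `-1728(4f)³`
is not a rational multiple of `Δ`. -/
def Nondeg (f g : Polynomial ℤ) : Prop :=
  Dpoly f g ≠ 0 ∧
    ¬∃ c : ℚ, (-1728 : Polynomial ℚ) * (4 * f.map (Int.castRingHom ℚ)) ^ 3 =
      Polynomial.C c * (Dpoly f g).map (Int.castRingHom ℚ)

/-- The set `F(T) = {u/v ∈ ℚ : gcd(u,v) = 1, 1 ≤ u, v ≤ T}`. -/
def FT (T : ℝ) : Finset ℚ :=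
  ((Finset.Icc (1 : ℤ) ⌊T⌋ ×ˢ Finset.Icc (1 : ℤ) ⌊T⌋).filter
      fun w => Int.gcd w.1 w.2 = 1).image fun w => (w.1 : ℚ) / (w.2 : ℚ)

/-- Reduction of a rational number `t` modulo `p`, as `num·den⁻¹` in `ZMod p`. -/
def redQ (p : ℕ) (t : ℚ) : ZMod p := (t.num : ZMod p) * (t.den : ZMod p)⁻¹

/-- The number of `𝔽_p`-points of the curve `Y² = X³ + AX + B`
(affine points together with the point at infinity). -/
def numPoints (p : ℕ) (A B : ZMod p) : ℕ :=
  1 + Nat.card {P : ZMod p × ZMod p // P.2 ^ 2 = P.1 ^ 3 + A * P.1 + B}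

/-- The Frobenius trace `p + 1 - #E(𝔽_p)` of `Y² = X³ + AX + B` over `𝔽_p`. -/
def frobTrace (p : ℕ) (A B : ZMod p) : ℤ := (p : ℤ) + 1 - numPoints p A B

/-- `a_p(E(t))`: the Frobenius trace of the reduction modulo `p` of the curve
`E(t) : Y² = X³ + f(t)X + g(t)`. -/
def apE (f g : Polynomial ℤ) (p : ℕ) (t : ℚ) : ℤ :=
  frobTrace p ((f.map (Int.castRingHom (ZMod p))).eval (redQ p t))
    ((g.map (Int.castRingHom (ZMod p))).eval (redQ p t))

/-- Good reduction of `E(t)` at `p`: the denominator of `t` is coprime to `p`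
and `Δ(t) ≢ 0 (mod p)`. -/
def goodRed (f g : Polynomial ℤ) (p : ℕ) (t : ℚ) : Prop :=
  ¬(p ∣ t.den) ∧ ((Dpoly f g).map (Int.castRingHom (ZMod p))).eval (redQ p t) ≠ 0

/-- `π_{E(t)}(𝔄; x)`: the number of primes `p ≤ x` of good reduction for `E(t)`
with `a_p(E(t)) = a_p`. -/
def piSeq (f g : Polynomial ℤ) (a : ℕ → ℤ) (t : ℚ) (x : ℝ) : ℕ :=
  ((Finset.Icc 1 ⌊x⌋₊).filter fun p =>
      p.Prime ∧ goodRed f g p t ∧ apE f g p t = a p).card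

/-- `π_{E(t)}(K; x)` for `K = ℚ(√d)`: the number of primes `p ≤ x` of good
reduction for `E(t)` with `a_p(E(t)) ≠ 0` and `a_p(E(t))² - 4p = d·m²`. -/
def piK (f g : Polynomial ℤ) (d : ℤ) (t : ℚ) (x : ℝ) : ℕ :=
  ((Finset.Icc 1 ⌊x⌋₊).filter fun p =>
      p.Prime ∧ goodRed f g p t ∧ apE f g p t ≠ 0 ∧
        ∃ m : ℤ, 0 < m ∧ (apE f g p t) ^ 2 - 4 * (p : ℤ) = d * m ^ 2).card

/-- The Frobenius angle `ψ_p(E(t)) ∈ [0, π]`, with `cos ψ_p = a_p/(2√p)`. -/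
def psiE (f g : Polynomial ℤ) (p : ℕ) (t : ℚ) : ℝ :=
  Real.arccos ((apE f g p t : ℝ) / (2 * Real.sqrt p))

/-- `π_{E(t)}(α, β; x)`: the number of primes `p ≤ x` of good reduction for
`E(t)` with `ψ_p(E(t)) ∈ [α, β]`. -/
def piAngle (f g : Polynomial ℤ) (α β : ℝ) (t : ℚ) (x : ℝ) : ℕ :=
  ((Finset.Icc 1 ⌊x⌋₊).filter fun p =>
      p.Prime ∧ goodRed f g p t ∧ psiE f g p t ∈ Set.Icc α β).card

/-- The Sato–Tate density `μ_ST(α, β) = (2/π) ∫_α^β sin²θ dθ`. -/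
def muST (α β : ℝ) : ℝ := (2 / Real.pi) * ∫ θ in α..β, Real.sin θ ^ 2

/-- `π(x)`: the number of primes `p ≤ x`. -/
def primePi (x : ℝ) : ℕ := ((Finset.Icc 1 ⌊x⌋₊).filter Nat.Prime).card

/-- `e_p(w) = exp(2πi w/p)`. -/
def ep (p : ℕ) (w : ZMod p) : ℂ :=
  Complex.exp (2 * (Real.pi : ℂ) * Complex.I * (w.val : ℂ) / (p : ℂ))

/-- The residues `t` modulo `p` at which the curve `E(t)` has good reduction with trace `a`. -/
def traceSet (f g : Polynomial ℤ) (p : ℕ) (a : ℤ) : Set (ZMod p) :=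
  {t | ((Dpoly f g).map (Int.castRingHom (ZMod p))).eval t ≠ 0 ∧
    frobTrace p ((f.map (Int.castRingHom (ZMod p))).eval t)
      ((g.map (Int.castRingHom (ZMod p))).eval t) = a}

/-- A uniform square-root bound (up to logarithms) on the number of parameters with given trace. -/
def TraceBound (f g : Polynomial ℤ) : Prop :=
  ∃ p₀ : ℕ, ∃ C : ℝ, 0 < C ∧ ∀ p : ℕ, p.Prime → p₀ < p → ∀ a : ℤ,
    ((traceSet f g p a).ncard : ℝ) ≤ C * √p * (1 + Real.log p) ^ 2

lemma one_add_log_le_two_mul_sqrt {x : ℝ} (hx : 0 < x) : 1 + Real.log x ≤ 2 * √x := by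
  have h1 : Real.log (√x) ≤ √x - 1 := Real.log_le_sub_one_of_pos (Real.sqrt_pos.mpr hx)
  rw [Real.log_sqrt hx.le] at h1
  linarith

lemma primeCounting_mul_one_add_log_le {x : ℝ} (hx : 2 ≤ x) :
    (Nat.primeCounting ⌊x⌋₊ : ℝ) * (1 + Real.log x) ≤ 12 * x := by
  have hx0 : 0 < x := by linarith
  have h := Chebyshev.pi_le_log4_mul_div (x := x) (by linarith)
  have hlog : Real.log 2 ≤ Real.log x := Real.log_le_log (by norm_num) hx
  have hl2 := Real.log_two_gt_d9
  have hl2' := Real.log_two_lt_d9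
  have hl4 : Real.log 4 = 2 * Real.log 2 := by
    rw [show (4 : ℝ) = 2 ^ 2 by norm_num, Real.log_pow]; norm_num
  have hlx : 0 < Real.log x := by linarith
  rw [Real.log_sqrt hx0.le] at h
  have hs := one_add_log_le_two_mul_sqrt hx0
  have hss : √x * √x = x := Real.mul_self_sqrt hx0.le
  have hs0 := Real.sqrt_nonneg x
  have h1 : √x * (1 + Real.log x) ≤ 2 * x := by nlinarith
  have h2 : Real.log 4 * x / (Real.log x / 2) * (1 + Real.log x) ≤ 10 * x := by
    have e : Real.log 4 * x / (Real.log x / 2) * (1 + Real.log x) =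
        (4 * Real.log 2 + 4 * (Real.log 2 / Real.log x)) * x := by
      rw [hl4]; field_simp; ring
    have : Real.log 2 / Real.log x ≤ 1 := by rw [div_le_one hlx]; exact hlog
    rw [e]; gcongr; linarith
  calc _ ≤ (Real.log 4 * x / (Real.log x / 2) + √x) * (1 + Real.log x) := by gcongr
    _ ≤ 12 * x := by nlinarith

lemma card_pairs_le_mul_ncard {T p : ℕ} (hTp : T < p) [NeZero p] {U V : Finset ℕ}
    (hU : U ⊆ Finset.Icc 1 T) (S : Set (ZMod p)) :
    ((U ×ˢ V).filter fun uv => ((uv.1 + uv.2 : ℕ) : ZMod p) ∈ S).card ≤ V.card * S.ncard := by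
  have hS : S.Finite := S.toFinite
  rw [Set.ncard_eq_toFinset_card S hS, ← Finset.card_product]
  refine Finset.card_le_card_of_injOn (fun uv => (uv.2, ((uv.1 + uv.2 : ℕ) : ZMod p))) ?_ ?_
  · intro uv h
    simp only [Finset.coe_filter, Finset.mem_product, Set.mem_ofPred_eq] at h
    simp only [Finset.coe_product, Set.mem_prod, Finset.mem_coe, Set.Finite.mem_toFinset]
    exact ⟨h.1.2, h.2⟩
  · rintro ⟨u, v⟩ h ⟨u', v'⟩ h' heq
    simp only [Finset.coe_filter, Finset.mem_product, Set.mem_ofPred_eq] at h h'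
    simp only [Prod.mk.injEq] at heq
    obtain ⟨rfl, h2⟩ := heq
    have h3 : (u : ZMod p) = (u' : ZMod p) := by
      push_cast at h2; exact add_right_cancel h2
    have a1 := (Finset.mem_Icc.mp (hU h.1.1)).2
    have a2 := (Finset.mem_Icc.mp (hU h'.1.1)).2
    rw [ZMod.natCast_eq_natCast_iff', Nat.mod_eq_of_lt (by omega), Nat.mod_eq_of_lt (by omega)]
      at h3
    rw [h3]

lemma redQ_natCast (p n : ℕ) : redQ p (n : ℚ) = (n : ZMod p) := by
  simp [redQ]

lemma sum_piSeq_eq (f g : Polynomial ℤ) (a : ℕ → ℤ) (W : Finset (ℕ × ℕ)) (x : ℝ) :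
    (∑ uv ∈ W, (piSeq f g a ((uv.1 + uv.2 : ℕ) : ℚ) x : ℝ)) =
      ∑ p ∈ (Finset.Icc 1 ⌊x⌋₊).filter Nat.Prime,
        ((W.filter fun uv => goodRed f g p ((uv.1 + uv.2 : ℕ) : ℚ) ∧
          apE f g p ((uv.1 + uv.2 : ℕ) : ℚ) = a p).card : ℝ) := by
  have h (t : ℚ) : (piSeq f g a t x : ℝ) = ∑ p ∈ (Finset.Icc 1 ⌊x⌋₊).filter Nat.Prime,
      if goodRed f g p t ∧ apE f g p t = a p then (1 : ℝ) else 0 := by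
    rw [piSeq, ← Finset.filter_filter, Finset.card_filter]
    push_cast
    rfl
  simp only [h]
  rw [Finset.sum_comm]
  refine Finset.sum_congr rfl fun p _ => ?_
  rw [Finset.card_filter]
  push_cast
  rfl

lemma card_good_le_min (f g : Polynomial ℤ) {T p : ℕ} (hp : p.Prime) (hTp : T < p)
    {U V : Finset ℕ} (hU : U ⊆ Finset.Icc 1 T) (hV : V ⊆ Finset.Icc 1 T) (a : ℤ) :
    ((U ×ˢ V).filter fun uv => goodRed f g p ((uv.1 + uv.2 : ℕ) : ℚ) ∧
          apE f g p ((uv.1 + uv.2 : ℕ) : ℚ) = a).card ≤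
      min U.card V.card * (traceSet f g p a).ncard := by
  have : NeZero p := ⟨hp.ne_zero⟩
  have key : ∀ uv : ℕ × ℕ, (goodRed f g p ((uv.1 + uv.2 : ℕ) : ℚ) ∧
      apE f g p ((uv.1 + uv.2 : ℕ) : ℚ) = a) →
      ((uv.1 + uv.2 : ℕ) : ZMod p) ∈ traceSet f g p a := by
    intro uv h
    obtain ⟨⟨-, h1⟩, h2⟩ := h
    rw [redQ_natCast] at h1
    rw [apE, redQ_natCast] at h2
    exact ⟨h1, h2⟩
  rw [← Nat.mul_min_mul_right, le_min_iff]
  constructor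
  · refine le_trans ?_ (card_pairs_le_mul_ncard hTp (V := U) hV (traceSet f g p a))
    refine Finset.card_le_card_of_injOn Prod.swap ?_ (Prod.swap_injective.injOn)
    rintro ⟨u, v⟩ h
    rw [Finset.mem_coe, Finset.mem_filter, Finset.mem_product] at h ⊢
    refine ⟨⟨h.1.2, h.1.1⟩, ?_⟩
    rw [Prod.fst_swap, Prod.snd_swap, add_comm]
    exact key _ h.2
  · refine le_trans (Finset.card_le_card ?_)
      (card_pairs_le_mul_ncard hTp (V := V) hU (traceSet f g p a))
    intro uv h
    simp only [Finset.mem_filter] at h ⊢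
    exact ⟨h.1, key _ h.2⟩

lemma average_of_traceBound (f g : Polynomial ℤ) (H : TraceBound f g) :
    ∃ C : ℝ, 0 < C ∧ ∀ T : ℕ, 0 < T → ∀ U V : Finset ℕ,
      U.Nonempty → V.Nonempty → U ⊆ Finset.Icc 1 T → V ⊆ Finset.Icc 1 T →
      ∀ x : ℝ, 2 ≤ x → ∀ a : ℕ → ℤ,
        (∑ uv ∈ (U ×ˢ V).filter fun uv => aeval ((uv.1 + uv.2 : ℕ) : ℚ) (Dpoly f g) ≠ 0,
            (piSeq f g a ((uv.1 + uv.2 : ℕ) : ℚ) x : ℝ)) ≤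
          C * ((T : ℝ) * U.card * V.card +
            ((U.card * V.card : ℕ) : ℝ) ^ ((3 : ℝ) / 4) * x ^ ((5 : ℝ) / 4)) := by
  obtain ⟨p₀, C₁, hC₁, HB⟩ := H
  refine ⟨(1 + p₀) + 12 * √C₁, by positivity, ?_⟩
  intro T hT U V hU0 hV0 hU hV x hx a
  have hx0 : 0 < x := by linarith
  set W : ℝ := ((U.card * V.card : ℕ) : ℝ) with hW
  have hW1 : 1 ≤ W := by
    rw [hW]; exact_mod_cast Nat.mul_pos (Finset.card_pos.mpr hU0) (Finset.card_pos.mpr hV0)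
  have hW0 : 0 < W := by linarith
  set L : ℝ := 1 + Real.log x with hL
  have hL0 : 0 < L := by have := Real.log_nonneg (by linarith : (1 : ℝ) ≤ x); linarith
  set M : ℝ := C₁ * √x * L ^ 2 with hM
  have hmin : (min U.card V.card : ℝ) ≤ √W := by
    apply Real.le_sqrt_of_sq_le
    rw [hW, sq]; push_cast
    exact mul_le_mul (min_le_left _ _) (min_le_right _ _) (by positivity) (by positivity)
  rw [sum_piSeq_eq]
  have hsplit : ∀ p ∈ (Finset.Icc 1 ⌊x⌋₊).filter Nat.Prime,
      ((((U ×ˢ V).filter fun uv => aeval ((uv.1 + uv.2 : ℕ) : ℚ) (Dpoly f g) ≠ 0).filter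
        fun uv => goodRed f g p ((uv.1 + uv.2 : ℕ) : ℚ) ∧
          apE f g p ((uv.1 + uv.2 : ℕ) : ℚ) = a p).card : ℝ) ≤
        (if p ≤ T + p₀ then W else 0) + √(W * (√W * M)) := by
    intro p hp
    rw [Finset.mem_filter, Finset.mem_Icc] at hp
    set A := (((U ×ˢ V).filter fun uv => aeval ((uv.1 + uv.2 : ℕ) : ℚ) (Dpoly f g) ≠ 0).filter
        fun uv => goodRed f g p ((uv.1 + uv.2 : ℕ) : ℚ) ∧
          apE f g p ((uv.1 + uv.2 : ℕ) : ℚ) = a p)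
    have hA1 : (A.card : ℝ) ≤ W := by
      rw [hW, ← Finset.card_product]
      exact_mod_cast Finset.card_le_card ((Finset.filter_subset _ _).trans
        (Finset.filter_subset _ _))
    split_ifs with h
    · have := Real.sqrt_nonneg (W * (√W * M)); linarith
    · have hA2 : (A.card : ℝ) ≤ √W * M := by
        have h1 : A.card ≤ min U.card V.card * (traceSet f g p (a p)).ncard := by
          refine le_trans (Finset.card_le_card ?_)
            (card_good_le_min f g hp.2 (by omega : T < p) hU hV (a p))
          exact Finset.filter_subset_filter _ (Finset.filter_subset _ _)
        have h2 := HB p hp.2 (by omega) (a p)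
        have hpx : (p : ℝ) ≤ x := (Nat.le_floor_iff hx0.le).mp hp.1.2
        have hp1 : (1 : ℝ) ≤ p := by exact_mod_cast hp.1.1
        have h3 : C₁ * √p * (1 + Real.log p) ^ 2 ≤ M := by
          rw [hM, hL]
          have := Real.log_nonneg hp1
          gcongr
        calc (A.card : ℝ) ≤ ((min U.card V.card * (traceSet f g p (a p)).ncard : ℕ) : ℝ) := by
              exact_mod_cast h1
          _ = (min U.card V.card : ℝ) * ((traceSet f g p (a p)).ncard : ℝ) := by push_cast; rfl
          _ ≤ √W * M := by
              exact mul_le_mul hmin (h2.trans h3) (by positivity) (by positivity)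
      rw [zero_add]
      apply Real.le_sqrt_of_sq_le
      rw [sq]
      exact mul_le_mul hA1 hA2 (by positivity) (by positivity)
  refine (Finset.sum_le_sum hsplit).trans ?_
  rw [Finset.sum_add_distrib]
  have hsum1 : (∑ p ∈ (Finset.Icc 1 ⌊x⌋₊).filter Nat.Prime, if p ≤ T + p₀ then W else 0) ≤
      (1 + p₀) * (T * W) := by
    rw [← Finset.sum_filter, Finset.sum_const, nsmul_eq_mul]
    have : (((Finset.Icc 1 ⌊x⌋₊).filter Nat.Prime).filter fun p => p ≤ T + p₀).card ≤ T + p₀ := by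
      apply le_of_le_of_eq (b := (Finset.Icc 1 (T + p₀)).card) _ (by simp)
      apply Finset.card_le_card
      intro p hp
      simp only [Finset.mem_filter, Finset.mem_Icc] at hp ⊢
      exact ⟨hp.1.1.1, hp.2⟩
    have h2 : (((((Finset.Icc 1 ⌊x⌋₊).filter Nat.Prime).filter fun p => p ≤
        T + p₀).card : ℕ) : ℝ) ≤ T + p₀ := by
      exact_mod_cast this
    have hT1 : (1 : ℝ) ≤ T := by exact_mod_cast hT
    calc _ ≤ (T + p₀ : ℝ) * W := by gcongr
      _ ≤ (1 + p₀) * (T * W) := by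
        have : (T + p₀ : ℝ) ≤ (1 + p₀) * T := by
          have : (0 : ℝ) ≤ p₀ := by positivity
          nlinarith
        nlinarith
  have hsum2 : (∑ p ∈ (Finset.Icc 1 ⌊x⌋₊).filter Nat.Prime, √(W * (√W * M))) ≤
      12 * √C₁ * (W ^ ((3 : ℝ) / 4) * x ^ ((5 : ℝ) / 4)) := by
    rw [Finset.sum_const, nsmul_eq_mul]
    have hc : ((Finset.Icc 1 ⌊x⌋₊).filter Nat.Prime).card = Nat.primeCounting ⌊x⌋₊ := by
      rw [Nat.primeCounting, Nat.primeCounting', Nat.count_eq_card_filter_range]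
      congr 1
      ext p
      simp only [Finset.mem_filter, Finset.mem_Icc, Finset.mem_range]
      constructor
      · rintro ⟨h1, h2⟩; exact ⟨by omega, h2⟩
      · rintro ⟨h1, h2⟩; exact ⟨⟨h2.one_lt.le, by omega⟩, h2⟩
    rw [hc]
    have hsq : √(W * (√W * M)) = √C₁ * L * (W ^ ((3 : ℝ) / 4) * x ^ ((1 : ℝ) / 4)) := by
      rw [hM]
      have e1 : W * √W = W ^ ((3 : ℝ) / 2) := by
        rw [Real.sqrt_eq_rpow, ← Real.rpow_one_add' hW0.le (by norm_num)]; norm_num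
      rw [show W * (√W * (C₁ * √x * L ^ 2)) = C₁ * L ^ 2 * ((W * √W) * √x) by ring, e1,
        Real.sqrt_mul (by positivity), Real.sqrt_mul hC₁.le, Real.sqrt_sq hL0.le,
        Real.sqrt_mul (by positivity), Real.sqrt_eq_rpow x, Real.sqrt_eq_rpow (W ^ _),
        Real.sqrt_eq_rpow (x ^ _), ← Real.rpow_mul hW0.le, ← Real.rpow_mul hx0.le]
      norm_num
    rw [hsq]
    have e2 : x ^ ((5 : ℝ) / 4) = x * x ^ ((1 : ℝ) / 4) := by
      rw [← Real.rpow_one_add' hx0.le (by norm_num)]; norm_num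
    rw [e2]
    have := primeCounting_mul_one_add_log_le hx
    calc (Nat.primeCounting ⌊x⌋₊ : ℝ) * (√C₁ * L * (W ^ ((3 : ℝ) / 4) * x ^ ((1 : ℝ) / 4))) =
        ((Nat.primeCounting ⌊x⌋₊ : ℝ) * L) * (√C₁ * (W ^ ((3 : ℝ) / 4) * x ^ ((1 : ℝ) / 4))) := by
          ring
      _ ≤ (12 * x) * (√C₁ * (W ^ ((3 : ℝ) / 4) * x ^ ((1 : ℝ) / 4))) := by gcongr
      _ = _ := by ring
  have hTW : (T : ℝ) * U.card * V.card = T * W := by rw [hW]; push_cast; ring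
  rw [hTW]
  have : 0 ≤ (W ^ ((3 : ℝ) / 4) * x ^ ((5 : ℝ) / 4)) := by positivity
  have : 0 ≤ (T : ℝ) * W := by positivity
  have : 0 ≤ √C₁ := by positivity
  have : (0 : ℝ) ≤ p₀ := by positivity
  nlinarith [mul_nonneg ‹0 ≤ √C₁› ‹0 ≤ (T : ℝ) * W›,
    mul_nonneg ‹(0 : ℝ) ≤ p₀› ‹0 ≤ (W ^ ((3 : ℝ) / 4) * x ^ ((5 : ℝ) / 4))›]

/-- The `j`-invariants of the curves over `ZMod p` with Frobenius trace `a`. -/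
def jSet (p : ℕ) (a : ℤ) : Set (ZMod p) :=
  {j | ∃ A B : ZMod p, 4 * A ^ 3 + 27 * B ^ 2 ≠ 0 ∧ frobTrace p A B = a ∧
    j * (4 * A ^ 3 + 27 * B ^ 2) = 6912 * A ^ 3}

/-- A uniform square-root bound (up to logarithms) on the number of `j`-invariants with
given trace. -/
def JBound : Prop :=
  ∃ p₀ : ℕ, ∃ C : ℝ, 0 < C ∧ ∀ p : ℕ, p.Prime → p₀ < p → ∀ a : ℤ,
    ((jSet p a).ncard : ℝ) ≤ C * √p * (1 + Real.log p) ^ 2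

lemma exists_minor_ne_zero {f g : Polynomial ℤ} (hfg : Nondeg f g) :
    ∃ i k : ℕ, (6912 * f ^ 3).coeff i * (4 * f ^ 3 + 27 * g ^ 2).coeff k -
      (6912 * f ^ 3).coeff k * (4 * f ^ 3 + 27 * g ^ 2).coeff i ≠ 0 := by
  by_contra! h
  obtain ⟨hD, hj⟩ := hfg
  have hD' : 4 * f ^ 3 + 27 * g ^ 2 ≠ 0 := by
    intro h0; apply hD; rw [Dpoly, h0, mul_zero]
  set F := 6912 * f ^ 3 with hF
  set D := 4 * f ^ 3 + 27 * g ^ 2 with hDd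
  obtain ⟨k, hk⟩ : ∃ k, D.coeff k ≠ 0 := by
    by_contra! h0; exact hD' (Polynomial.ext (by simpa using h0))
  apply hj
  have key : F.map (Int.castRingHom ℚ) =
      Polynomial.C ((F.coeff k : ℚ) / D.coeff k) * D.map (Int.castRingHom ℚ) := by
    ext i
    rw [Polynomial.coeff_map, Polynomial.coeff_C_mul, Polynomial.coeff_map]
    have h1 := h i k
    have hk' : (D.coeff k : ℚ) ≠ 0 := by exact_mod_cast hk
    have h2 : (F.coeff i : ℚ) * D.coeff k = F.coeff k * D.coeff i := by
      exact_mod_cast sub_eq_zero.mp h1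
    simp only [eq_intCast]
    field_simp
    linarith
  refine ⟨(F.coeff k : ℚ) / D.coeff k, ?_⟩
  have e1 : (Dpoly f g).map (Int.castRingHom ℚ) = -16 * D.map (Int.castRingHom ℚ) := by
    rw [Dpoly, ← hDd]; simp
  have e2 : F.map (Int.castRingHom ℚ) = 6912 * (f.map (Int.castRingHom ℚ)) ^ 3 := by
    rw [hF]; simp
  rw [e1]
  rw [e2] at key
  linear_combination (-16 : Polynomial ℚ) * key

lemma traceBound_of_jBound {f g : Polynomial ℤ} (hfg : Nondeg f g) (H : JBound) :
    TraceBound f g := by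
  obtain ⟨p₀, C, hC, HB⟩ := H
  obtain ⟨i, k, hik⟩ := exists_minor_ne_zero hfg
  set F := 6912 * f ^ 3 with hF
  set D := 4 * f ^ 3 + 27 * g ^ 2 with hD
  set m := F.coeff i * D.coeff k - F.coeff k * D.coeff i with hm
  set d := max F.natDegree D.natDegree with hd
  refine ⟨max p₀ m.natAbs, (d + 1) * C, by positivity, ?_⟩
  intro p hp hpp a
  have : Fact p.Prime := ⟨hp⟩
  have hB := HB p hp (lt_of_le_of_lt (le_max_left _ _) hpp) a
  have hpm : (m : ZMod p) ≠ 0 := by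
    rw [Ne, ZMod.intCast_zmod_eq_zero_iff_dvd]
    intro h
    have := Nat.le_of_dvd (Int.natAbs_pos.mpr hik) (Int.natCast_dvd.mp h)
    have := (le_max_right p₀ m.natAbs)
    omega
  set φ := Int.castRingHom (ZMod p)
  have hpoly : ∀ j : ZMod p, F.map φ - Polynomial.C j * D.map φ ≠ 0 := by
    intro j h
    apply hpm
    have h' : ∀ n, (F.coeff n : ZMod p) = j * D.coeff n := by
      intro n
      have := congrArg (fun P => Polynomial.coeff P n) h
      simp only [Polynomial.coeff_sub, Polynomial.coeff_C_mul, Polynomial.coeff_map,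
        Polynomial.coeff_zero] at this
      exact sub_eq_zero.mp this
    rw [hm]; push_cast
    rw [h' i, h' k]; ring
  have hsub : traceSet f g p a ⊆
      ⋃ j ∈ jSet p a, ((F.map φ - Polynomial.C j * D.map φ).roots.toFinset : Set (ZMod p)) := by
    intro t ht
    obtain ⟨h1, h2⟩ := ht
    set A := (f.map φ).eval t with hA
    set B := (g.map φ).eval t with hB
    have hDt : (D.map φ).eval t = 4 * A ^ 3 + 27 * B ^ 2 := by
      rw [hD, hA, hB]; simp
    have hFt : (F.map φ).eval t = 6912 * A ^ 3 := by
      rw [hF, hA]; simp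
    have h3 : 4 * A ^ 3 + 27 * B ^ 2 ≠ 0 := by
      intro h0; apply h1
      rw [Dpoly, ← hD, Polynomial.map_mul, Polynomial.eval_mul, hDt, h0, mul_zero]
    rw [Set.mem_iUnion₂]
    refine ⟨6912 * A ^ 3 / (4 * A ^ 3 + 27 * B ^ 2), ⟨A, B, h3, h2, div_mul_cancel₀ _ h3⟩, ?_⟩
    rw [Finset.mem_coe, Multiset.mem_toFinset, Polynomial.mem_roots (hpoly _),
      Polynomial.IsRoot.def, Polynomial.eval_sub, Polynomial.eval_mul, Polynomial.eval_C, hDt, hFt,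
      div_mul_cancel₀ _ h3, sub_self]
  have hcard : (traceSet f g p a).ncard ≤ (jSet p a).ncard * d := by
    have hfin := (jSet p a).toFinite
    refine (Set.ncard_le_ncard hsub (Set.toFinite _)).trans ?_
    have e : (⋃ j ∈ jSet p a, ((F.map φ - Polynomial.C j * D.map φ).roots.toFinset :
        Set (ZMod p))) = ((hfin.toFinset.biUnion fun j =>
          (F.map φ - Polynomial.C j * D.map φ).roots.toFinset : Finset (ZMod p)) :
            Set (ZMod p)) := by
      simp
    rw [e, Set.ncard_coe_finset, Set.ncard_eq_toFinset_card _ hfin]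
    refine Finset.card_biUnion_le_card_mul _ _ _ fun j _ => ?_
    refine (Multiset.toFinset_card_le _).trans ((Polynomial.card_roots' _).trans ?_)
    refine (Polynomial.natDegree_sub_le _ _).trans (max_le_max Polynomial.natDegree_map_le ?_)
    exact (Polynomial.natDegree_C_mul_le _ _).trans Polynomial.natDegree_map_le
  calc ((traceSet f g p a).ncard : ℝ) ≤ (((jSet p a).ncard * d : ℕ) : ℝ) := by exact_mod_cast hcard
    _ = (jSet p a).ncard * d := by push_cast; rfl
    _ ≤ (C * √p * (1 + Real.log p) ^ 2) * (d + 1) := by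
      have : (0 : ℝ) ≤ d := by positivity
      gcongr
      linarith
    _ = _ := by ring

/-- Pairs `(c, b)` with `1 ≤ c ≤ N`, `|b| ≤ c` and `c ∣ b² - D`; they contain the first two
coefficients of the reduced forms of discriminant `D`. -/
def formPairs (N : ℕ) (D : ℤ) : Finset (ℕ × ℤ) :=
  (Finset.Icc 1 N).sigma (fun c => (Finset.Icc (-(c : ℤ)) c).filter fun b => (c : ℤ) ∣ b ^ 2 - D)
    |>.map (Equiv.sigmaEquivProd ℕ ℤ).toEmbedding

lemma mem_formPairs {N : ℕ} {D : ℤ} {c : ℕ} {b : ℤ} :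
    (c, b) ∈ formPairs N D ↔ (1 ≤ c ∧ c ≤ N) ∧ (-(c : ℤ) ≤ b ∧ b ≤ c) ∧ (c : ℤ) ∣ b ^ 2 - D := by
  simp [formPairs]

lemma card_modEq_Icc_le {c m : ℕ} (hc : 0 < c) (hm : 0 < m) (hmc : m ∣ c) (S : Finset ℤ)
    (hS : S ⊆ Finset.Icc (-(c : ℤ)) c) (h : ∀ b ∈ S, ∀ b' ∈ S, (m : ℤ) ∣ b - b') :
    S.card ≤ 3 * (c / m) := by
  obtain ⟨k, rfl⟩ := hmc
  rw [Nat.mul_div_cancel_left _ hm]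
  have hk : 0 < k := Nat.pos_of_mul_pos_left hc
  rcases S.eq_empty_or_nonempty with rfl | ⟨b₀, hb₀⟩
  · simp
  set b₁ := S.min' ⟨b₀, hb₀⟩ with hb₁
  have h1 : ∀ b ∈ S, (b - b₁) / m ∈ Finset.Icc (0 : ℤ) (2 * k) := by
    intro b hb
    have hle : b₁ ≤ b := Finset.min'_le _ _ hb
    have hb2 := Finset.mem_Icc.mp (hS hb)
    have hb3 := Finset.mem_Icc.mp (hS (Finset.min'_mem S ⟨b₀, hb₀⟩))
    rw [Finset.mem_Icc]
    have hm' : (0 : ℤ) < m := by exact_mod_cast hm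
    refine ⟨Int.ediv_nonneg (by omega) hm'.le, ?_⟩
    apply Int.ediv_le_of_le_mul hm'
    push_cast at hb2 hb3
    rw [← hb₁] at hb3
    nlinarith
  have h2 : S.card ≤ (Finset.Icc (0 : ℤ) (2 * k)).card := by
    refine Finset.card_le_card_of_injOn (fun b => (b - b₁) / m) h1 ?_
    intro b hb b' hb' heq
    have d1 := h b hb b₁ (Finset.min'_mem S ⟨b₀, hb₀⟩)
    have d2 := h b' hb' b₁ (Finset.min'_mem S ⟨b₀, hb₀⟩)
    have := (Int.ediv_left_inj d1 d2).mp heq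
    omega
  rw [Int.card_Icc] at h2
  omega

lemma card_sq_modEq_le (c : ℕ) (hc : 0 < c) (D : ℤ) :
    ((Finset.Icc (-(c : ℤ)) c).filter fun b => (c : ℤ) ∣ b ^ 2 - D).card ≤
      3 * ∑ w ∈ c.divisorsAntidiagonal, Nat.gcd w.1 w.2 := by
  set S := (Finset.Icc (-(c : ℤ)) c).filter fun b => (c : ℤ) ∣ b ^ 2 - D with hS
  rcases S.eq_empty_or_nonempty with h | ⟨b₀, hb₀⟩
  · rw [h]; simp
  have hb₀' := (Finset.mem_filter.mp hb₀).2
  have hmaps : ∀ b ∈ S, (Int.gcd (b - b₀) c, c / Int.gcd (b - b₀) c) ∈ c.divisorsAntidiagonal := by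
    intro b _
    rw [Nat.mem_divisorsAntidiagonal]
    exact ⟨Nat.mul_div_cancel' (by exact_mod_cast Int.gcd_dvd_right (b - b₀) c), hc.ne'⟩
  rw [Finset.card_eq_sum_card_fiberwise hmaps, Finset.mul_sum]
  refine Finset.sum_le_sum ?_
  rintro ⟨u, v⟩ huv
  rw [Nat.mem_divisorsAntidiagonal] at huv
  obtain ⟨huv, -⟩ := huv
  have hu : 0 < u := Nat.pos_of_mul_pos_right (huv ▸ hc)
  have hv : 0 < v := Nat.pos_of_mul_pos_left (huv ▸ hc)
  have hlcm : 0 < Nat.lcm u v := Nat.lcm_pos hu hv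
  have hdvd : Nat.lcm u v ∣ c := by
    rw [← huv]; exact Nat.lcm_dvd (dvd_mul_right _ _) (dvd_mul_left _ _)
  have hdiv : c / Nat.lcm u v = Nat.gcd u v := by
    apply Nat.div_eq_of_eq_mul_left hlcm
    rw [Nat.gcd_mul_lcm, huv]
  simp only
  rw [← hdiv]
  refine card_modEq_Icc_le hc hlcm hdvd _ ?_ ?_
  · exact (Finset.filter_subset _ _).trans (Finset.filter_subset _ _)
  · have key : ∀ b ∈ S.filter (fun b => (Int.gcd (b - b₀) c, c / Int.gcd (b - b₀) c) = (u, v)),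
        (u : ℤ) ∣ b - b₀ ∧ (v : ℤ) ∣ b + b₀ := by
      intro b hb
      rw [Finset.mem_filter, Prod.mk.injEq, hS, Finset.mem_filter] at hb
      obtain ⟨⟨-, h1⟩, h2, h3⟩ := hb
      refine ⟨h2 ▸ Int.gcd_dvd_left _ _, ?_⟩
      have h4 : (c : ℤ) ∣ (b - b₀) * (b + b₀) := by
        have := dvd_sub h1 hb₀'
        rwa [show b ^ 2 - D - (b₀ ^ 2 - D) = (b - b₀) * (b + b₀) by ring] at this
      obtain ⟨k, hk⟩ : (u : ℤ) ∣ b - b₀ := h2 ▸ Int.gcd_dvd_left _ _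
      have hcop : IsCoprime (v : ℤ) k := by
        rw [Int.isCoprime_iff_gcd_eq_one]
        have e : Int.gcd (b - b₀) c = u * Int.gcd k v := by
          rw [hk, ← huv]; push_cast
          rw [Int.gcd_mul_left]; simp
        rw [h2] at e
        rw [Int.gcd_comm]
        exact Nat.eq_of_mul_eq_mul_left hu (by rw [← e, mul_one])
      rw [hk, ← huv] at h4
      push_cast at h4
      rw [mul_assoc] at h4
      have h5 : (v : ℤ) ∣ k * (b + b₀) :=
        Int.dvd_of_mul_dvd_mul_left (by exact_mod_cast hu.ne') h4
      exact hcop.dvd_of_dvd_mul_left h5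
    intro b hb b' hb'
    obtain ⟨h1, h2⟩ := key b hb
    obtain ⟨h1', h2'⟩ := key b' hb'
    have e1 : (u : ℤ) ∣ b - b' := by
      have := dvd_sub h1 h1'
      rwa [show b - b₀ - (b' - b₀) = b - b' by ring] at this
    have e2 : (v : ℤ) ∣ b - b' := by
      have := dvd_sub h2 h2'
      rwa [show b + b₀ - (b' + b₀) = b - b' by ring] at this
    have : (((Int.lcm u v : ℕ)) : ℤ) ∣ b - b' := Int.coe_lcm_dvd e1 e2
    simpa [Int.lcm] using this

lemma sum_inv_dvd_le (N g : ℕ) (hg : 0 < g) :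
    (∑ u ∈ (Finset.Icc 1 N).filter (g ∣ ·), (u : ℝ)⁻¹) ≤
      (g : ℝ)⁻¹ * ∑ w ∈ Finset.Icc 1 N, (w : ℝ)⁻¹ := by
  rw [Finset.mul_sum]
  have : (Finset.Icc 1 N).filter (g ∣ ·) ⊆ (Finset.Icc 1 N).image (g * ·) := by
    intro u hu
    rw [Finset.mem_filter, Finset.mem_Icc] at hu
    obtain ⟨⟨h1, h2⟩, k, rfl⟩ := hu
    rw [Finset.mem_image]
    refine ⟨k, Finset.mem_Icc.mpr ⟨Nat.pos_of_mul_pos_left h1, ?_⟩, rfl⟩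
    exact (Nat.le_mul_of_pos_left k hg).trans h2
  refine (Finset.sum_le_sum_of_subset_of_nonneg this fun _ _ _ => by positivity).trans ?_
  rw [Finset.sum_image]
  · apply le_of_eq; apply Finset.sum_congr rfl; intro w _; push_cast; rw [mul_inv]
  · intro a _ b _ h; exact Nat.eq_of_mul_eq_mul_left hg h

lemma sum_gcd_le (N : ℕ) :
    ((∑ c ∈ Finset.Icc 1 N, ∑ w ∈ c.divisorsAntidiagonal, Nat.gcd w.1 w.2 : ℕ) : ℝ) ≤
      N * (∑ w ∈ Finset.Icc 1 N, (w : ℝ)⁻¹) ^ 2 := by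
  have h1 : (∑ c ∈ Finset.Icc 1 N, ∑ w ∈ c.divisorsAntidiagonal, Nat.gcd w.1 w.2) ≤
      ∑ g ∈ Finset.Icc 1 N, ∑ u ∈ (Finset.Icc 1 N).filter (g ∣ ·), g * (N / u / g) := by
    have e1 : (∑ c ∈ Finset.Icc 1 N, ∑ w ∈ c.divisorsAntidiagonal, Nat.gcd w.1 w.2) =
        ∑ w ∈ (Finset.Icc 1 N ×ˢ Finset.Icc 1 N).filter (fun w => w.1 * w.2 ≤ N),
          Nat.gcd w.1 w.2 := by
      rw [Finset.sum_sigma']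
      refine Finset.sum_bij' (fun x _ => x.2) (fun w _ => ⟨w.1 * w.2, w⟩) ?_ ?_ ?_ ?_ ?_
      · rintro ⟨c, u, v⟩ h
        simp only [Finset.mem_sigma, Finset.mem_Icc, Nat.mem_divisorsAntidiagonal] at h
        obtain ⟨⟨h1, h2⟩, h3, -⟩ := h
        have hu : 0 < u := Nat.pos_of_mul_pos_right (h3 ▸ h1)
        have hv : 0 < v := Nat.pos_of_mul_pos_left (h3 ▸ h1)
        simp only [Finset.mem_filter, Finset.mem_product, Finset.mem_Icc]
        refine ⟨⟨⟨hu, ?_⟩, ⟨hv, ?_⟩⟩, by omega⟩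
        · exact (Nat.le_mul_of_pos_right u hv).trans (by omega)
        · exact (Nat.le_mul_of_pos_left v hu).trans (by omega)
      · rintro ⟨u, v⟩ h
        simp only [Finset.mem_filter, Finset.mem_product, Finset.mem_Icc] at h
        simp only [Finset.mem_sigma, Finset.mem_Icc, Nat.mem_divisorsAntidiagonal]
        have := Nat.mul_pos h.1.1.1 h.1.2.1
        exact ⟨⟨this, h.2⟩, trivial, this.ne'⟩
      · rintro ⟨c, u, v⟩ h
        simp only [Finset.mem_sigma, Finset.mem_Icc, Nat.mem_divisorsAntidiagonal] at h
        simp [h.2.1]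
      · intros; rfl
      · intros; rfl
    rw [e1]
    have e2 : ∀ w ∈ (Finset.Icc 1 N ×ˢ Finset.Icc 1 N).filter (fun w => w.1 * w.2 ≤ N),
        Nat.gcd w.1 w.2 ≤ ∑ g ∈ Finset.Icc 1 N, if g ∣ w.1 ∧ g ∣ w.2 then g else 0 := by
      rintro ⟨u, v⟩ h
      simp only [Finset.mem_filter, Finset.mem_product, Finset.mem_Icc] at h
      have hg : Nat.gcd u v ∈ Finset.Icc 1 N := by
        rw [Finset.mem_Icc]
        exact ⟨Nat.gcd_pos_of_pos_left _ h.1.1.1, (Nat.gcd_le_left _ h.1.1.1).trans h.1.1.2⟩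
      refine le_trans ?_ (Finset.single_le_sum (f := fun g => if g ∣ u ∧ g ∣ v then g else 0)
        (fun _ _ => Nat.zero_le _) hg)
      simp [Nat.gcd_dvd_left, Nat.gcd_dvd_right]
    refine (Finset.sum_le_sum e2).trans ?_
    rw [Finset.sum_comm]
    refine Finset.sum_le_sum fun g hg => ?_
    have hg0 : 0 < g := (Finset.mem_Icc.mp hg).1
    rw [Finset.sum_filter, Finset.sum_product, Finset.sum_filter]
    refine Finset.sum_le_sum fun u hu => ?_
    have hu0 : 0 < u := (Finset.mem_Icc.mp hu).1
    split_ifs with hgu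
    · have : ∀ v, (if u * v ≤ N then if g ∣ u ∧ g ∣ v then g else 0 else 0) =
          if (u * v ≤ N ∧ g ∣ v) then g else 0 := by
        intro v; by_cases h1 : u * v ≤ N <;> by_cases h2 : g ∣ v <;> simp [h1, h2, hgu]
      simp only [this]
      rw [← Finset.sum_filter, Finset.sum_const, smul_eq_mul, mul_comm]
      refine Nat.mul_le_mul_left _ ?_
      have hsub : (Finset.Icc 1 N).filter (fun v => u * v ≤ N ∧ g ∣ v) ⊆
          (Finset.Icc 1 (N / u / g)).image (g * ·) := by
        intro v hv
        simp only [Finset.mem_filter, Finset.mem_Icc] at hv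
        obtain ⟨⟨h1, -⟩, h3, k, rfl⟩ := hv
        rw [Finset.mem_image]
        refine ⟨k, Finset.mem_Icc.mpr ⟨Nat.pos_of_mul_pos_left h1, ?_⟩, rfl⟩
        rw [Nat.le_div_iff_mul_le hg0, Nat.le_div_iff_mul_le hu0]
        calc k * g * u = u * (g * k) := by ring
          _ ≤ N := h3
      refine (Finset.card_le_card hsub).trans (Finset.card_image_le.trans ?_)
      simp
    · refine le_of_eq (Finset.sum_eq_zero fun v _ => ?_)
      simp [hgu]
  have h2 : ((∑ g ∈ Finset.Icc 1 N, ∑ u ∈ (Finset.Icc 1 N).filter (g ∣ ·), g * (N / u / g) : ℕ) : ℝ)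
      ≤ ∑ g ∈ Finset.Icc 1 N, ∑ u ∈ (Finset.Icc 1 N).filter (g ∣ ·), (N : ℝ) * (u : ℝ)⁻¹ := by
    push_cast
    refine Finset.sum_le_sum fun g hg => Finset.sum_le_sum fun u hu => ?_
    have hg0 : (0 : ℝ) < g := by exact_mod_cast (Finset.mem_Icc.mp hg).1
    calc (g : ℝ) * ((N / u / g : ℕ) : ℝ) ≤ g * (((N / u : ℕ) : ℝ) / g) := by
          gcongr; exact Nat.cast_div_le
      _ = ((N / u : ℕ) : ℝ) := by field_simp
      _ ≤ (N : ℝ) / u := Nat.cast_div_le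
      _ = _ := by rw [div_eq_mul_inv]
  refine (Nat.cast_le.mpr h1).trans (h2.trans ?_)
  calc (∑ g ∈ Finset.Icc 1 N, ∑ u ∈ (Finset.Icc 1 N).filter (g ∣ ·), (N : ℝ) * (u : ℝ)⁻¹) =
      ∑ g ∈ Finset.Icc 1 N, (N : ℝ) * ∑ u ∈ (Finset.Icc 1 N).filter (g ∣ ·), (u : ℝ)⁻¹ := by
        simp only [Finset.mul_sum]
    _ ≤ ∑ g ∈ Finset.Icc 1 N, (N : ℝ) * ((g : ℝ)⁻¹ * ∑ w ∈ Finset.Icc 1 N, (w : ℝ)⁻¹) := by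
        refine Finset.sum_le_sum fun g hg => ?_
        gcongr
        exact sum_inv_dvd_le N g (Finset.mem_Icc.mp hg).1
    _ = _ := by rw [← Finset.mul_sum, ← Finset.sum_mul]; ring

lemma card_formPairs_le (N : ℕ) (D : ℤ) :
    ((formPairs N D).card : ℝ) ≤ 3 * N * (1 + Real.log N) ^ 2 := by
  have h1 : (formPairs N D).card ≤
      3 * ∑ c ∈ Finset.Icc 1 N, ∑ w ∈ c.divisorsAntidiagonal, Nat.gcd w.1 w.2 := by
    rw [formPairs, Finset.card_map, Finset.card_sigma, Finset.mul_sum]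
    exact Finset.sum_le_sum fun c hc => card_sq_modEq_le c (Finset.mem_Icc.mp hc).1 D
  have h2 : (∑ w ∈ Finset.Icc 1 N, (w : ℝ)⁻¹) ≤ 1 + Real.log N := by
    have := harmonic_le_one_add_log N
    rw [harmonic_eq_sum_Icc] at this
    push_cast at this
    exact this
  calc ((formPairs N D).card : ℝ) ≤
      3 * ((∑ c ∈ Finset.Icc 1 N, ∑ w ∈ c.divisorsAntidiagonal, Nat.gcd w.1 w.2 : ℕ) : ℝ) := by
        exact_mod_cast h1
    _ ≤ 3 * (N * (∑ w ∈ Finset.Icc 1 N, (w : ℝ)⁻¹) ^ 2) := by gcongr; exact sum_gcd_le N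
    _ ≤ 3 * (N * (1 + Real.log N) ^ 2) := by gcongr
    _ = _ := by ring

open UpperHalfPlane in
/-- Every `j`-invariant over `ZMod p` lifts to a singular modulus whose complex multiplication
contains an element of norm `p`, the trace of which is controlled by the Frobenius trace. -/
def CMLift (p : ℕ) : Prop :=
  ∃ (J : ℍ → ℂ) (R : ℂ → ZMod p → Prop) (c : ℤ → ZMod p),
    (∀ z x y, R z x → R z y → x = y) ∧
    ∀ a : ℤ, ∀ j₀ ∈ jSet p a, ∃ τ : ℍ, τ ∈ ModularGroup.fd ∧ R (J τ) j₀ ∧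
      ∃ α β γ δ : ℤ, α * δ - β * γ = p ∧ 0 < γ ∧
        (γ : ℂ) * (τ : ℂ) ^ 2 + (δ - α) * (τ : ℂ) - β = 0 ∧
        (α + δ = 0 ∨ ((α + δ : ℤ) : ZMod p) ^ 12 = c a)

lemma cm_re_im {x y : ℝ} {α β γ δ : ℤ} {n : ℤ} (hdet : α * δ - β * γ = n) (hy : 0 < y)
    (h : (γ : ℂ) * (x + y * Complex.I) ^ 2 + (δ - α) * (x + y * Complex.I) - β = 0) :
    2 * γ * x = -(δ - α : ℤ) ∧ 4 * (γ : ℝ) ^ 2 * y ^ 2 = 4 * n - ((α + δ : ℤ) : ℝ) ^ 2 := by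
  have hre := congrArg Complex.re h
  have him := congrArg Complex.im h
  simp [sq] at hre him
  have h1 : 2 * (γ : ℝ) * x = -(δ - α) := by
    have : y * (2 * γ * x + (δ - α)) = 0 := by linarith
    rcases mul_eq_zero.mp this with h0 | h0
    · exact absurd h0 hy.ne'
    · linarith
  refine ⟨by push_cast; exact h1, ?_⟩
  have hdet' : (α : ℝ) * δ - β * γ = n := by exact_mod_cast hdet
  push_cast
  have h2 : (2 * (γ : ℝ) * x) ^ 2 = (δ - α) ^ 2 := by rw [h1]; ring
  have h3 : (γ : ℝ) * (γ * (x * x - y * y) + (δ - α) * x - β) = 0 := by rw [hre]; ring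
  have h4 : (γ : ℝ) * x * (δ - α) = -(δ - α) ^ 2 / 2 := by
    rw [show (γ : ℝ) * x = -(δ - α) / 2 by linarith]; ring
  nlinarith

lemma card_traces_le (p : ℕ) [Fact p.Prime] (c : ZMod p) :
    ((Finset.Icc (-(p : ℤ)) p).filter fun t : ℤ => t ^ 2 ≤ 4 * p ∧
      (t = 0 ∨ (t : ZMod p) ^ 12 = c)).card ≤ 37 := by
  set S := (Finset.Icc (-(p : ℤ)) p).filter fun t : ℤ => t ^ 2 ≤ 4 * p ∧
      (t = 0 ∨ (t : ZMod p) ^ 12 = c)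
  set P : Polynomial (ZMod p) := Polynomial.X ^ 12 - Polynomial.C c
  have hP : P ≠ 0 := Polynomial.X_pow_sub_C_ne_zero (by norm_num) c
  have hsub : S ⊆ {0} ∪ (P.roots.toFinset.biUnion fun r => (Finset.Icc (-(p : ℤ)) p).filter
      fun t : ℤ => (t : ZMod p) = r) := by
    intro t ht
    rw [Finset.mem_filter] at ht
    rw [Finset.mem_union, Finset.mem_singleton]
    rcases ht.2.2 with h | h
    · exact Or.inl h
    · right
      rw [Finset.mem_biUnion]
      refine ⟨(t : ZMod p), ?_, Finset.mem_filter.mpr ⟨ht.1, rfl⟩⟩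
      rw [Multiset.mem_toFinset, Polynomial.mem_roots hP]
      simp [P, h]
  have hp0 : 0 < p := (Fact.out : p.Prime).pos
  have hfib : ∀ r ∈ P.roots.toFinset, ((Finset.Icc (-(p : ℤ)) p).filter
      fun t : ℤ => (t : ZMod p) = r).card ≤ 3 := by
    intro r _
    refine (card_modEq_Icc_le hp0 hp0 dvd_rfl _ (Finset.filter_subset _ _) ?_).trans ?_
    · intro b hb b' hb'
      rw [← ZMod.intCast_zmod_eq_zero_iff_dvd]
      rw [Int.cast_sub, (Finset.mem_filter.mp hb).2, (Finset.mem_filter.mp hb').2, sub_self]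
    · rw [Nat.div_self hp0]
  refine (Finset.card_le_card hsub).trans ((Finset.card_union_le _ _).trans ?_)
  have := Finset.card_biUnion_le_card_mul _ _ _ hfib
  have h12 : P.roots.toFinset.card ≤ 12 := by
    refine (Multiset.toFinset_card_le _).trans ((Polynomial.card_roots' _).trans ?_)
    rw [Polynomial.natDegree_X_pow_sub_C]
  rw [Finset.card_singleton]
  omega

open UpperHalfPlane in
lemma jBound_of_cmLift {p₀ : ℕ} (H : ∀ p : ℕ, p.Prime → p₀ < p → CMLift p) : JBound := by
  refine ⟨p₀, 222, by norm_num, ?_⟩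
  intro p hp hpp a
  have : Fact p.Prime := ⟨hp⟩
  obtain ⟨J, R, c, hR, hlift⟩ := H p hp hpp
  set N := Nat.sqrt (2 * p) with hN
  set S := ((Finset.Icc (-(p : ℤ)) p).filter fun t : ℤ => t ^ 2 ≤ 4 * p ∧
      (t = 0 ∨ (t : ZMod p) ^ 12 = c a)) with hS
  set T := S.sigma fun t => formPairs N (t ^ 2 - 4 * p)
  choose! τ hτ hRτ α β γ δ hdet hγ heq htr using hlift a
  have hreim : ∀ j ∈ jSet p a, 2 * (γ j : ℝ) * (τ j).re = -(δ j - α j : ℤ) ∧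
      4 * (γ j : ℝ) ^ 2 * (τ j).im ^ 2 = 4 * p - ((α j + δ j : ℤ) : ℝ) ^ 2 := by
    intro j hj
    have := cm_re_im (hdet j hj) (τ j).im_pos (x := (τ j).re) (by
      have h := heq j hj
      have e : ((τ j).re : ℂ) + (τ j).im * Complex.I = (τ j : ℂ) := by
        rw [← UpperHalfPlane.coe_re, ← UpperHalfPlane.coe_im, Complex.re_add_im]
      rw [e]; exact h)
    simpa using this
  let F : ZMod p → Σ _ : ℤ, ℕ × ℤ := fun j => ⟨α j + δ j, ((γ j).toNat, δ j - α j)⟩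
  have hmaps : ∀ j ∈ jSet p a, F j ∈ (T : Set (Σ _ : ℤ, ℕ × ℤ)) := by
    intro j hj
    obtain ⟨h1, h2⟩ := hreim j hj
    have hγ0 := hγ j hj
    have hγc : ((γ j).toNat : ℤ) = γ j := Int.toNat_of_nonneg hγ0.le
    have hγR : (0 : ℝ) < γ j := by exact_mod_cast hγ0
    have him := ModularGroup.three_le_four_mul_im_sq_of_mem_fd (hτ j hj)
    have hre := (hτ j hj).2
    have htsqR : ((α j + δ j : ℤ) : ℝ) ^ 2 ≤ 4 * p := by
      have : 0 ≤ 4 * (γ j : ℝ) ^ 2 * (τ j).im ^ 2 := by positivity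
      linarith
    have htsq : (α j + δ j) ^ 2 ≤ 4 * (p : ℤ) := by exact_mod_cast htsqR
    have hγle : (γ j) ^ 2 ≤ 2 * (p : ℤ) := by
      have : (γ j : ℝ) ^ 2 * 3 ≤ 4 * p := by
        have := mul_le_mul_of_nonneg_left him (sq_nonneg (γ j : ℝ))
        have := sq_nonneg ((α j + δ j : ℤ) : ℝ)
        linarith
      have : (γ j) ^ 2 * 3 ≤ 4 * (p : ℤ) := by exact_mod_cast this
      have := sq_nonneg (γ j)
      omega
    rw [Finset.mem_coe, Finset.mem_sigma]
    constructor
    · rw [hS, Finset.mem_filter, Finset.mem_Icc]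
      refine ⟨?_, htsq, htr j hj⟩
      have hb : (α j + δ j) ^ 2 ≤ (p : ℤ) ^ 2 ∨ p < 4 := by
        rcases lt_or_ge p 4 with h | h
        · exact Or.inr h
        · left
          have : (4 : ℤ) ≤ p := by exact_mod_cast h
          nlinarith
      have hb' : |α j + δ j| ≤ p := by
        rcases hb with h | h
        · exact abs_le_of_sq_le_sq h (by positivity)
        · have hp2 := hp.two_le
          have h2 : (2 : ℤ) ≤ p := by exact_mod_cast hp2
          have h4 : (p : ℤ) < 4 := by exact_mod_cast h
          rw [abs_le]; constructor <;> nlinarith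
      rwa [abs_le] at hb'
    · rw [mem_formPairs, hγc]
      refine ⟨⟨by omega, ?_⟩, ?_, ?_⟩
      · rw [hN, Nat.le_sqrt']
        zify
        rw [hγc]
        exact hγle
      · have h3 : |((δ j - α j : ℤ) : ℝ)| ≤ γ j := by
          rw [show ((δ j - α j : ℤ) : ℝ) = -(2 * γ j * (τ j).re) by rw [h1]; ring, abs_neg, abs_mul,
            abs_of_pos (by positivity : 0 < 2 * (γ j : ℝ))]
          nlinarith
        have h4 : |δ j - α j| ≤ γ j := by exact_mod_cast h3
        exact abs_le.mp h4
      · refine ⟨-4 * β j, ?_⟩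
        have := hdet j hj
        linear_combination 4 * (-this)
  have hinj : Set.InjOn F (jSet p a) := by
    intro j hj j' hj' h
    simp only [F, Sigma.mk.injEq, heq_eq_eq, Prod.mk.injEq] at h
    obtain ⟨e1, e2, e3⟩ := h
    have eγ : γ j = γ j' := by
      have a1 := Int.toNat_of_nonneg (hγ j hj).le
      have a2 := Int.toNat_of_nonneg (hγ j' hj').le
      omega
    obtain ⟨h1, h2⟩ := hreim j hj
    obtain ⟨h1', h2'⟩ := hreim j' hj'
    have hγR : (0 : ℝ) < γ j' := by exact_mod_cast hγ j' hj'
    rw [e3, eγ, ← h1'] at h1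
    rw [e1, eγ, ← h2'] at h2
    have hre : (τ j).re = (τ j').re := mul_left_cancel₀ (by positivity) h1
    have him : (τ j).im = (τ j').im := by
      have : (τ j).im ^ 2 = (τ j').im ^ 2 := mul_left_cancel₀ (by positivity) h2
      exact (sq_eq_sq₀ (τ j).im_pos.le (τ j').im_pos.le).mp this
    have hττ : τ j = τ j' := UpperHalfPlane.ext_re_im hre him
    have r1 := hRτ j hj
    rw [hττ] at r1
    exact hR _ _ _ r1 (hRτ j' hj')
  have hcard : (jSet p a).ncard ≤ T.card := by
    rw [← Set.ncard_coe_finset]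
    exact Set.ncard_le_ncard_of_injOn F hmaps hinj (Finset.finite_toSet T)
  have hp1 : (1 : ℝ) < p := by exact_mod_cast hp.one_lt
  have hNp : (N : ℝ) ≤ 2 * √p := by
    have : (N : ℝ) ^ 2 ≤ (2 * √p) ^ 2 := by
      rw [mul_pow, Real.sq_sqrt (by positivity)]
      have : N ^ 2 ≤ 2 * p := Nat.sqrt_le' _
      have : (N : ℝ) ^ 2 ≤ 2 * p := by exact_mod_cast this
      linarith
    exact (le_abs_self _).trans (abs_le_of_sq_le_sq this (by positivity))
  have hNp' : (N : ℝ) ≤ p := by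
    have : N ^ 2 ≤ 2 * p := Nat.sqrt_le' _
    have h2 := hp.two_le
    have : N ≤ p := by nlinarith
    exact_mod_cast this
  have hN0 : (0 : ℝ) < N := by
    have : 0 < N := Nat.sqrt_pos.mpr (by have := hp.pos; omega)
    exact_mod_cast this
  have hN1 : 0 ≤ Real.log N := by
    apply Real.log_nonneg; exact_mod_cast (by exact_mod_cast hN0 : 0 < N)
  have hT : (T.card : ℝ) ≤ 37 * (3 * N * (1 + Real.log N) ^ 2) := by
    rw [Finset.card_sigma]
    push_cast
    calc (∑ t ∈ S, ((formPairs N (t ^ 2 - 4 * p)).card : ℝ)) ≤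
        ∑ t ∈ S, (3 * N * (1 + Real.log N) ^ 2) :=
          Finset.sum_le_sum fun t _ => card_formPairs_le N _
      _ = S.card * (3 * N * (1 + Real.log N) ^ 2) := by rw [Finset.sum_const, nsmul_eq_mul]
      _ ≤ _ := by
        have : (S.card : ℝ) ≤ (37 : ℕ) := Nat.cast_le.mpr (card_traces_le p (c a))
        gcongr
        exact_mod_cast this
  calc ((jSet p a).ncard : ℝ) ≤ T.card := by exact_mod_cast hcard
    _ ≤ 37 * (3 * N * (1 + Real.log N) ^ 2) := hT
    _ ≤ 37 * (3 * (2 * √p) * (1 + Real.log p) ^ 2) := by gcongr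
    _ = _ := by ring

/-- The coefficient of `X ^ (p - 1)` in `(X³ + aX + b) ^ ((p - 1) / 2)`: the Hasse invariant. -/
def hasseCoeff (p : ℕ) {R : Type} [CommRing R] (a b : R) : R :=
  ((X ^ 3 + C a * X + C b : R[X]) ^ ((p - 1) / 2)).coeff (p - 1)

lemma map_hasseCoeff (p : ℕ) {R S : Type} [CommRing R] [CommRing S] (φ : R →+* S) (a b : R) :
    φ (hasseCoeff p a b) = hasseCoeff p (φ a) (φ b) := by
  rw [hasseCoeff, hasseCoeff, ← Polynomial.coeff_map]
  simp

lemma ZMod.sum_pow_eq (p : ℕ) [Fact p.Prime] {n : ℕ} (hn : n < 2 * (p - 1)) :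
    (∑ x : ZMod p, x ^ n) = if n = p - 1 then -1 else 0 := by
  have hp := (Fact.out : p.Prime).two_le
  rcases lt_trichotomy n (p - 1) with h | h | h
  · rw [if_neg h.ne]
    exact FiniteField.sum_pow_lt_card_sub_one _ _ (by rwa [ZMod.card])
  · rw [if_pos h, h]
    have e : ∀ x : ZMod p, x ^ (p - 1) = 1 - (if x = 0 then 1 else 0) := by
      intro x
      split_ifs with hx
      · rw [hx, zero_pow (by omega)]; ring
      · rw [ZMod.pow_card_sub_one_eq_one hx]; ring
    simp [e]
  · rw [if_neg h.ne']
    have e : ∀ x : ZMod p, x ^ n = x ^ (n - (p - 1)) := by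
      intro x
      by_cases hx : x = 0
      · rw [hx, zero_pow (by omega), zero_pow (by omega)]
      · conv_lhs => rw [show n = (n - (p - 1)) + (p - 1) by omega, pow_add,
          ZMod.pow_card_sub_one_eq_one hx, mul_one]
    simp only [e]
    exact FiniteField.sum_pow_lt_card_sub_one _ _ (by rw [ZMod.card]; omega)

lemma sum_eval_eq_neg_coeff (p : ℕ) [Fact p.Prime] (P : (ZMod p)[X])
    (hP : P.natDegree < 2 * (p - 1)) : (∑ x : ZMod p, P.eval x) = -P.coeff (p - 1) := by
  simp only [Polynomial.eval_eq_sum_range' hP]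
  rw [Finset.sum_comm]
  have hp := (Fact.out : p.Prime).two_le
  have : ∀ n ∈ Finset.range (2 * (p - 1)), (∑ x : ZMod p, P.coeff n * x ^ n) =
      if n = p - 1 then -P.coeff n else 0 := by
    intro n hn
    rw [← Finset.mul_sum, ZMod.sum_pow_eq p (Finset.mem_range.mp hn)]
    split_ifs <;> simp
  rw [Finset.sum_congr rfl this, Finset.sum_ite_eq', if_pos]
  rw [Finset.mem_range]; omega

lemma sum_cubic_pow_eq (p : ℕ) [Fact p.Prime] (hp5 : 5 ≤ p) (a b : ZMod p) :
    (∑ x : ZMod p, (x ^ 3 + a * x + b) ^ ((p - 1) / 2)) = -hasseCoeff p a b := by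
  rw [hasseCoeff, ← sum_eval_eq_neg_coeff]
  · simp
  · have h1 : (X ^ 3 + C a * X + C b : (ZMod p)[X]).natDegree ≤ 3 := by compute_degree
    refine lt_of_le_of_lt (Polynomial.natDegree_pow_le_of_le _ h1) ?_
    omega

lemma frobTrace_eq_hasseCoeff (p : ℕ) [Fact p.Prime] (hp5 : 5 ≤ p) (a b : ZMod p) :
    (frobTrace p a b : ZMod p) = hasseCoeff p a b := by
  have hchar : ringChar (ZMod p) ≠ 2 := by rw [ZMod.ringChar_zmod_n]; omega
  have hodd : p / 2 = (p - 1) / 2 := by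
    have := (Fact.out : p.Prime).eq_two_or_odd; omega
  have hcount : (Nat.card {P : ZMod p × ZMod p // P.2 ^ 2 = P.1 ^ 3 + a * P.1 + b} : ZMod p) =
      -hasseCoeff p a b := by
    rw [← sum_cubic_pow_eq p hp5]
    have e : Nat.card {P : ZMod p × ZMod p // P.2 ^ 2 = P.1 ^ 3 + a * P.1 + b} =
        ∑ x : ZMod p, Fintype.card {y : ZMod p // y ^ 2 = x ^ 3 + a * x + b} := by
      rw [← Fintype.card_sigma, Nat.card_eq_fintype_card]
      refine Fintype.card_congr ⟨fun P => ⟨P.1.1, P.1.2, P.2⟩, fun s => ⟨(s.1, s.2.1), s.2.2⟩,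
        fun _ => rfl, fun _ => rfl⟩
    rw [e]
    push_cast
    have h2 : ∀ x : ZMod p, ((Fintype.card {y : ZMod p // y ^ 2 = x ^ 3 + a *
        x + b} : ℕ) : ZMod p) =
        1 + (x ^ 3 + a * x + b) ^ ((p - 1) / 2) := by
      intro x
      set c := x ^ 3 + a * x + b
      have h := quadraticChar_card_sqrts hchar c
      have h3 := quadraticChar_eq_pow_of_char_ne_two' hchar c
      rw [ZMod.card, hodd] at h3
      rw [← h3]
      have h4 : (({x : ZMod p | x ^ 2 = c}.toFinset.card : ℤ) : ZMod p) =
        ((quadraticChar (ZMod p) c + 1 : ℤ) : ZMod p) := by rw [h]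
      push_cast at h4
      rw [add_comm, ← h4]
      congr 1
      rw [Set.toFinset_card]
      exact Fintype.card_congr (Equiv.refl _)
    simp only [h2, Finset.sum_add_distrib]
    simp
  rw [frobTrace, numPoints]
  push_cast
  rw [hcount, CharP.cast_eq_zero]
  ring

lemma hasseCoeff_cusp (p : ℕ) [Fact p.Prime] (hp5 : 5 ≤ p) :
    hasseCoeff p (-(48 : ZMod p)⁻¹) ((864 : ZMod p)⁻¹) = 1 := by
  have hp := (Fact.out : p.Prime)
  have h2 : (2 : ZMod p) ≠ 0 := by
    have : ((2 : ℕ) : ZMod p) ≠ 0 := by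
      rw [Ne, ZMod.natCast_eq_zero_iff]; intro h; have := Nat.le_of_dvd (by norm_num) h; omega
    exact_mod_cast this
  have h3 : (3 : ZMod p) ≠ 0 := by
    have : ((3 : ℕ) : ZMod p) ≠ 0 := by
      rw [Ne, ZMod.natCast_eq_zero_iff]; intro h; have := Nat.le_of_dvd (by norm_num) h; omega
    exact_mod_cast this
  have h12 : (12 : ZMod p) ≠ 0 := by
    rw [show (12 : ZMod p) = 2 * 2 * 3 by norm_num]; simp [h2, h3]
  have hfac : ∀ x : ZMod p, x ^ 3 + -(48 : ZMod p)⁻¹ * x + (864 : ZMod p)⁻¹ =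
      (x - 12⁻¹) ^ 2 * (x + 2 * 12⁻¹) := by
    intro x
    have e1 : (48 : ZMod p)⁻¹ = 3 * 12⁻¹ ^ 2 := by
      have : (48 : ZMod p) ≠ 0 := by
        rw [show (48 : ZMod p) = 12 * 2 * 2 by norm_num]; simp [h2, h12]
      field_simp
      norm_num
    have e2 : (864 : ZMod p)⁻¹ = 2 * 12⁻¹ ^ 3 := by
      have : (864 : ZMod p) ≠ 0 := by
        rw [show (864 : ZMod p) = 12 * 12 * 2 * 3 by norm_num]; simp [h2, h12, h3]
      field_simp
      norm_num
    rw [e1, e2]; ring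
  have hodd := hp.eq_two_or_odd
  have hm : 2 * ((p - 1) / 2) = p - 1 := by omega
  have hpow : ∀ x : ZMod p, ((x - 12⁻¹) ^ 2 * (x + 2 * 12⁻¹)) ^ ((p - 1) / 2) =
      (x + 2 * 12⁻¹) ^ ((p - 1) / 2) - if x = 12⁻¹ then 1 else 0 := by
    intro x
    rw [mul_pow, ← pow_mul, hm]
    split_ifs with hx
    · rw [hx, sub_self, zero_pow (by omega), zero_mul,
        show (12 : ZMod p)⁻¹ + 2 * 12⁻¹ = 2⁻¹ ^ 2 by field_simp; norm_num, ← pow_mul, hm,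
        ZMod.pow_card_sub_one_eq_one (inv_ne_zero h2), sub_self]
    · rw [ZMod.pow_card_sub_one_eq_one (sub_ne_zero.mpr hx), one_mul, sub_zero]
  have h := sum_cubic_pow_eq p hp5 (-(48 : ZMod p)⁻¹) ((864 : ZMod p)⁻¹)
  simp only [hfac, hpow, Finset.sum_sub_distrib] at h
  have hshift : (∑ x : ZMod p, (x + 2 * 12⁻¹) ^ ((p - 1) / 2)) = 0 := by
    refine (Equiv.sum_comp (Equiv.addRight (2 * 12⁻¹ : ZMod p))
      (fun x => x ^ ((p - 1) / 2))).trans ?_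
    rw [ZMod.sum_pow_eq p (by omega), if_neg (by omega)]
  rw [hshift] at h
  simp at h
  exact h.symm

/-- Weights of the coefficients of a short Weierstrass equation. -/
def cubicWeight : Fin 2 → ℤ := ![4, 6]

open MvPolynomial in
lemma isWeightedHomogeneous_coeff_mul {S : Type} [CommRing S] {F G : (MvPolynomial (Fin 2) S)[X]}
    {d e : ℤ}
    (hF : ∀ n, IsWeightedHomogeneous cubicWeight (F.coeff n) (d - 2 * n))
    (hG : ∀ n, IsWeightedHomogeneous cubicWeight (G.coeff n) (e - 2 * n)) (n : ℕ) :
    IsWeightedHomogeneous cubicWeight ((F * G).coeff n) (d + e - 2 * n) := by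
  rw [Polynomial.coeff_mul]
  refine IsWeightedHomogeneous.sum _ _ _ fun x hx => ?_
  have h := (hF x.1).mul (hG x.2)
  rw [Finset.HasAntidiagonal.mem_antidiagonal] at hx
  have e1 : (d - 2 * x.1) + (e - 2 * x.2) = d + e - 2 * n := by rw [← hx]; push_cast; ring
  rwa [e1] at h

open MvPolynomial in
lemma isWeightedHomogeneous_coeff_pow {S : Type} [CommRing S] {F : (MvPolynomial (Fin 2) S)[X]}
    {d : ℤ} (hF : ∀ n, IsWeightedHomogeneous cubicWeight (F.coeff n) (d - 2 * n)) (m n : ℕ) :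
    IsWeightedHomogeneous cubicWeight ((F ^ m).coeff n) (m * d - 2 * n) := by
  induction m generalizing n with
  | zero =>
    rw [pow_zero, Polynomial.coeff_one]
    split_ifs with h
    · subst h; simpa using isWeightedHomogeneous_one S cubicWeight
    · exact isWeightedHomogeneous_zero _ _ _
  | succ m ih =>
    rw [pow_succ]
    have := isWeightedHomogeneous_coeff_mul (fun n => ih n) hF n
    rwa [show (m : ℤ) * d + d - 2 * n = ((m + 1 : ℕ) : ℤ) * d - 2 * n by push_cast; ring] at this

open MvPolynomial in
lemma isWeightedHomogeneous_hasseCoeff (p : ℕ) (hp : p % 2 = 1) {S : Type} [CommRing S] :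
    IsWeightedHomogeneous cubicWeight
      (hasseCoeff p (MvPolynomial.X 0 : MvPolynomial (Fin 2) S) (MvPolynomial.X 1)) (p - 1 : ℕ) :=
          by
  have hF : ∀ n : ℕ, IsWeightedHomogeneous cubicWeight
      ((Polynomial.X ^ 3 + Polynomial.C (MvPolynomial.X 0 : MvPolynomial (Fin 2) S) * Polynomial.X +
        Polynomial.C (MvPolynomial.X 1)).coeff n) (6 - 2 * (n : ℤ)) := by
    intro n
    have h0 : IsWeightedHomogeneous cubicWeight (MvPolynomial.X 0 : MvPolynomial (Fin 2) S) 4 :=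
      isWeightedHomogeneous_X S cubicWeight 0
    have h1 : IsWeightedHomogeneous cubicWeight (MvPolynomial.X 1 : MvPolynomial (Fin 2) S) 6 :=
      isWeightedHomogeneous_X S cubicWeight 1
    simp only [Polynomial.coeff_add, Polynomial.coeff_X_pow, Polynomial.coeff_C_mul,
      Polynomial.coeff_X, Polynomial.coeff_C]
    rcases n with _ | _ | _ | _ | n
    · simpa using h1
    · simpa using h0
    · simpa using isWeightedHomogeneous_zero S cubicWeight _
    · simpa using isWeightedHomogeneous_one S cubicWeight
    · simpa using isWeightedHomogeneous_zero S cubicWeight _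
  have := isWeightedHomogeneous_coeff_pow hF ((p - 1) / 2) (p - 1)
  rw [hasseCoeff]
  convert this using 1
  push_cast
  omega

open MvPolynomial in
/-- The twelfth power of the Hasse invariant is a polynomial in the `j`-invariant times a power of
the discriminant. -/
lemma exists_hasse_poly (p : ℕ) [Fact p.Prime] (hp5 : 5 ≤ p) :
    ∃ h : (ZMod p)[X], ∀ (K : Type) [Field K] [Algebra (ZMod p) K] (a b : K),
      4 * a ^ 3 + 27 * b ^ 2 ≠ 0 →
      hasseCoeff p a b ^ 12 = (4 * a ^ 3 + 27 * b ^ 2) ^ (p - 1) *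
        Polynomial.aeval (6912 * a ^ 3 / (4 * a ^ 3 + 27 * b ^ 2)) h := by
  have hodd := (Fact.out : p.Prime).eq_two_or_odd
  set A := hasseCoeff p (MvPolynomial.X 0 : MvPolynomial (Fin 2) (ZMod p)) (MvPolynomial.X 1) with
      hA
  have hw : IsWeightedHomogeneous cubicWeight (A ^ 12) (12 * (p - 1 : ℕ) : ℤ) := by
    have := (isWeightedHomogeneous_hasseCoeff p (by omega) (S := ZMod p)).pow 12
    simpa using this
  refine ⟨∑ s ∈ (A ^ 12).support, Polynomial.C ((A ^ 12).coeff s) *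
    (Polynomial.C (6912 : ZMod p)⁻¹ * Polynomial.X) ^ (s 0 / 3) *
    (Polynomial.C (27 : ZMod p)⁻¹ * (1 - Polynomial.C (1728 : ZMod p)⁻¹ *
        Polynomial.X)) ^ (s 1 / 2), ?_⟩
  intro K _ _ a b hδ
  have hinj := (algebraMap (ZMod p) K).injective
  have h2' : (2 : ZMod p) ≠ 0 := by
    have : ((2 : ℕ) : ZMod p) ≠ 0 := by
      rw [Ne, ZMod.natCast_eq_zero_iff]; intro h; have := Nat.le_of_dvd (by norm_num) h; omega
    exact_mod_cast this
  have h3' : (3 : ZMod p) ≠ 0 := by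
    have : ((3 : ℕ) : ZMod p) ≠ 0 := by
      rw [Ne, ZMod.natCast_eq_zero_iff]; intro h; have := Nat.le_of_dvd (by norm_num) h; omega
    exact_mod_cast this
  have h2 : (2 : K) ≠ 0 := by
    rw [← _root_.map_ofNat (algebraMap (ZMod p) K) 2]
    exact (_root_.map_ne_zero _).mpr h2'
  have h3 : (3 : K) ≠ 0 := by
    rw [← _root_.map_ofNat (algebraMap (ZMod p) K) 3]
    exact (_root_.map_ne_zero _).mpr h3'
  have h6912 : (6912 : K) ≠ 0 := by
    rw [show (6912 : K) = 2 ^ 8 * 3 ^ 3 by norm_num]; simp [h2, h3]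
  have h1728 : (1728 : K) ≠ 0 := by
    rw [show (1728 : K) = 2 ^ 6 * 3 ^ 3 by norm_num]; simp [h2, h3]
  have h27 : (27 : K) ≠ 0 := by
    rw [show (27 : K) = 3 ^ 3 by norm_num]; simp [h3]
  have hmap : hasseCoeff p a b ^ 12 = MvPolynomial.aeval ![a, b] (A ^ 12) := by
    have := map_hasseCoeff p (MvPolynomial.aeval ![a, b] :
      MvPolynomial (Fin 2) (ZMod p) →ₐ[ZMod p] K).toRingHom (MvPolynomial.X 0) (MvPolynomial.X 1)
    simp at this
    rw [map_pow, hA, this]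
  rw [hmap, MvPolynomial.aeval_def, MvPolynomial.eval₂_eq', map_sum, Finset.mul_sum]
  refine Finset.sum_congr rfl fun s hs => ?_
  have hs' := hw (MvPolynomial.mem_support_iff.mp hs)
  rw [Finsupp.weight_apply, Finsupp.sum_fintype _ _ (by simp), Fin.sum_univ_two] at hs'
  simp [cubicWeight] at hs'
  obtain ⟨i, hi⟩ : 3 ∣ s 0 := by omega
  obtain ⟨k, hk⟩ : 2 ∣ s 1 := by omega
  have hik : i + k = p - 1 := by omega
  rw [Fin.prod_univ_two]
  simp only [Matrix.cons_val_zero, Matrix.cons_val_one]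
  rw [hi, hk, Nat.mul_div_cancel_left _ (by norm_num), Nat.mul_div_cancel_left _ (by norm_num),
    ← hik]
  simp only [map_mul, map_pow, map_sub, map_one, Polynomial.aeval_C, Polynomial.aeval_X, map_inv₀,
    map_ofNat]
  set δ := 4 * a ^ 3 + 27 * b ^ 2 with hδd
  have ea : a ^ 3 = δ * (6912⁻¹ * (6912 * a ^ 3 / δ)) := by field_simp
  have eb : b ^ 2 = δ * (27⁻¹ * (1 - 1728⁻¹ * (6912 * a ^ 3 / δ))) := by
    field_simp
    rw [hδd]
    ring
  rw [pow_mul a, pow_mul b]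
  conv_lhs => rw [ea, eb]
  rw [mul_pow δ, mul_pow δ, pow_add]
  ring

open IsLocalRing in
lemma exists_valuationSubring_natCast_mem (p : ℕ) (hp : p.Prime) :
    ∃ O : ValuationSubring ℂ, (p : O) ∈ maximalIdeal O := by
  set A : Subring ℂ := (Int.castRingHom ℂ).range
  have hI : Ideal.span {(p : A)} ≠ ⊤ := by
    rw [Ne, Ideal.span_singleton_eq_top]
    intro h
    obtain ⟨⟨b, ⟨n, rfl⟩⟩, hb⟩ := isUnit_iff_exists_inv.mp h
    have h1 := congrArg Subtype.val hb
    have h2 : (p : ℤ) * n = 1 := by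
      have : ((p : ℤ) : ℂ) * (n : ℂ) = 1 := by simpa using h1
      exact_mod_cast this
    exact hp.one_lt.ne' (by exact_mod_cast Int.eq_one_of_mul_eq_one_right (by positivity) h2)
  obtain ⟨B, -, hB⟩ := Ideal.image_subset_nonunits_valuationSubring _ hI
  refine ⟨B, ?_⟩
  rw [← ValuationSubring.coe_mem_nonunits_iff]
  have : (p : ℂ) ∈ A.subtype '' (Ideal.span {(p : A)} : Ideal A) :=
    ⟨p, Ideal.mem_span_singleton_self _, by simp⟩
  simpa using hB this

open IsLocalRing in
lemma ValuationSubring.charP_residueField {O : ValuationSubring ℂ} {p : ℕ} (hp : p.Prime)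
    (h : (p : O) ∈ maximalIdeal O) : CharP (ResidueField O) p := by
  have h0 : (p : ResidueField O) = 0 := by
    rw [← map_natCast (residue O), residue_eq_zero_iff]; exact h
  exact (CharP.charP_iff_prime_eq_zero hp).mpr h0

/-- An element of `ℂ` that is integral over a valuation subring belongs to it. -/
lemma ValuationSubring.mem_of_eval_monic {O : ValuationSubring ℂ} {z : ℂ} {P : O[X]}
    (hP : P.Monic) (hz : P.eval₂ O.subtype z = 0) : z ∈ O := by
  have h1 : IsIntegral O z := ⟨P, hP, hz⟩
  obtain ⟨y, hy⟩ := IsIntegrallyClosed.isIntegral_iff.mp h1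
  rw [← hy]; exact y.2

open IsLocalRing in
lemma ValuationSubring.exists_root_lift {O : ValuationSubring ℂ} (x₀ : ResidueField O) (n : ℕ) :
    ∀ P : O[X], P.natDegree ≤ n → P.map (residue O) ≠ 0 → (P.map (residue O)).eval x₀ = 0 →
      ∃ y : O, residue O y = x₀ ∧ P.eval y = 0 := by
  induction n with
  | zero =>
    intro P hP h0 hx
    rw [Polynomial.eq_C_of_natDegree_le_zero hP] at h0 hx
    rw [Polynomial.map_C, Polynomial.eval_C] at hx
    rw [Polynomial.map_C, hx, Polynomial.C_0] at h0
    exact absurd rfl h0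
  | succ n ih =>
    intro P hP h0 hx
    by_cases hd : P.natDegree ≤ n
    · exact ih P hd h0 hx
    have hinj : Function.Injective O.subtype := O.subtype_injective
    have hdeg : (P.map O.subtype).degree ≠ 0 := by
      rw [Polynomial.degree_map_eq_of_injective hinj]
      intro h
      exact hd (by rw [Polynomial.natDegree_eq_zero_iff_degree_le_zero.mpr h.le]; exact n.zero_le)
    obtain ⟨z, hz⟩ := IsAlgClosed.exists_root _ hdeg
    by_cases hzO : z ∈ O
    · have hroot : P.eval ⟨z, hzO⟩ = 0 := by
        apply hinj
        rw [map_zero, ← hz.eq_zero, Polynomial.eval_map, ← Polynomial.eval₂_at_apply]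
        rfl
      obtain ⟨P1, hP1⟩ := Polynomial.dvd_iff_isRoot.mpr hroot
      by_cases hx0 : residue O ⟨z, hzO⟩ = x₀
      · exact ⟨_, hx0, hroot⟩
      have hne : P1 ≠ 0 := by rintro rfl; simp [hP1] at h0
      have hd1 : P1.natDegree ≤ n := by
        rw [hP1, Polynomial.natDegree_mul (Polynomial.X_sub_C_ne_zero _) hne,
          Polynomial.natDegree_X_sub_C] at hP
        omega
      rw [hP1] at h0 hx
      simp only [Polynomial.map_mul, Polynomial.map_sub, Polynomial.map_X, Polynomial.map_C,
        Polynomial.eval_mul, Polynomial.eval_sub, Polynomial.eval_X, Polynomial.eval_C] at h0 hx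
      obtain ⟨y, hy, hy0⟩ := ih P1 hd1 (right_ne_zero_of_mul h0)
        ((mul_eq_zero.mp hx).resolve_left (sub_ne_zero.mpr (Ne.symm hx0)))
      exact ⟨y, hy, by rw [hP1, Polynomial.eval_mul, hy0, mul_zero]⟩
    · have hz0 : z ≠ 0 := by rintro rfl; exact hzO O.zero_mem
      have hzi : z⁻¹ ∈ O := (O.mem_or_inv_mem z).resolve_left hzO
      have hzm : residue O ⟨z⁻¹, hzi⟩ = 0 := by
        rw [residue_eq_zero_iff, ← ValuationSubring.coe_mem_nonunits_iff,
          ValuationSubring.inv_mem_nonunits_iff]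
        exact Or.inr hzO
      obtain ⟨P1, hP1⟩ := Polynomial.dvd_iff_isRoot.mpr hz
      set P2 := Polynomial.C (-z) * P1 with hP2
      have e : P.map O.subtype = (1 - Polynomial.C z⁻¹ * Polynomial.X) * P2 := by
        rw [hP1, hP2, ← mul_assoc]
        congr 1
        rw [sub_mul, one_mul, Polynomial.C_neg, mul_neg, mul_right_comm, ← Polynomial.C_mul,
          inv_mul_cancel₀ hz0, Polynomial.C_1]
        ring
      have hlift : P2 ∈ Polynomial.lifts O.subtype := by
        rw [Polynomial.lifts_iff_coeff_lifts]
        intro i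
        induction i with
        | zero =>
          have := congrArg (fun q => Polynomial.coeff q 0) e
          simp only [Polynomial.coeff_map, Polynomial.mul_coeff_zero, Polynomial.coeff_sub,
            Polynomial.coeff_one_zero, Polynomial.coeff_X_zero, mul_zero, sub_zero, one_mul] at this
          exact ⟨_, this⟩
        | succ i hi =>
          obtain ⟨u, hu⟩ := hi
          have := congrArg (fun q => Polynomial.coeff q (i + 1)) e
          simp only [Polynomial.coeff_map, sub_mul, one_mul, Polynomial.coeff_sub, mul_assoc,
            Polynomial.coeff_C_mul, Polynomial.coeff_X_mul] at this
          refine ⟨P.coeff (i + 1) + ⟨z⁻¹, hzi⟩ * u, ?_⟩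
          rw [map_add, map_mul, this, hu]
          simp
      obtain ⟨P3, hP3⟩ := (Polynomial.mem_lifts _).mp hlift
      have e3 : P = (1 - Polynomial.C ⟨z⁻¹, hzi⟩ * Polynomial.X) * P3 := by
        apply Polynomial.map_injective _ hinj
        rw [e, Polynomial.map_mul, hP3]
        simp
      have e4 : P.map (residue O) = P3.map (residue O) := by
        rw [e3]
        simp [hzm]
      have hne : P3 ≠ 0 := by rintro rfl; simp [e4] at h0
      have hd1 : P3.natDegree ≤ n := by
        have h1 : P1 ≠ 0 := by
          rintro rfl
          apply hne
          apply Polynomial.map_injective _ hinj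
          rw [hP3, hP2]; simp
        have h2 := congrArg Polynomial.natDegree hP1
        rw [Polynomial.natDegree_map_eq_of_injective hinj,
          Polynomial.natDegree_mul (Polynomial.X_sub_C_ne_zero _) h1,
          Polynomial.natDegree_X_sub_C] at h2
        have h3 := congrArg Polynomial.natDegree hP3
        rw [Polynomial.natDegree_map_eq_of_injective hinj, hP2,
          Polynomial.natDegree_C_mul (neg_ne_zero.mpr hz0)] at h3
        omega
      rw [e4] at h0 hx
      obtain ⟨y, hy, hy0⟩ := ih P3 hd1 h0 hx
      exact ⟨y, hy, by rw [e3, Polynomial.eval_mul, hy0, mul_zero]⟩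

section QExp

open UpperHalfPlane hiding I
open Complex Filter Function
open scoped Topology Manifold MatrixGroups

/-- The function `f` on the upper half plane is the sum of the power series `P` in the variable
`exp (2πiτ/h)`. -/
def HasQExp (h : ℝ) (P : PowerSeries ℂ) (f : ℍ → ℂ) : Prop :=
  ∀ τ : ℍ, HasSum (fun n : ℕ ↦ PowerSeries.coeff n P * Periodic.qParam h τ ^ n) (f τ)

namespace HasQExp

variable {h : ℝ} {P Q : PowerSeries ℂ} {f g : ℍ → ℂ}

lemma const (c : ℂ) : HasQExp h (PowerSeries.C c) (fun _ ↦ c) := by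
  intro τ
  convert! hasSum_ite_eq 0 c using 2 with n
  rw [PowerSeries.coeff_C]
  split_ifs with hn <;> simp [hn]

lemma add (hf : HasQExp h P f) (hg : HasQExp h Q g) : HasQExp h (P + Q) (f + g) := by
  intro τ
  convert! (hf τ).add (hg τ) using 2 with n
  rw [map_add, add_mul]

lemma mul (hf : HasQExp h P f) (hg : HasQExp h Q g) : HasQExp h (P * Q) (f * g) := by
  intro τ
  have h1 := (hf τ).summable.norm
  have h2 := (hg τ).summable.norm
  have key := tsum_mul_tsum_eq_tsum_sum_antidiagonal_of_summable_norm h1 h2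
  rw [(hf τ).tsum_eq, (hg τ).tsum_eq] at key
  have h3 := (summable_norm_sum_mul_antidiagonal_of_summable_norm h1 h2).of_norm
  rw [Pi.mul_apply, key]
  convert! h3.hasSum using 2 with n
  rw [PowerSeries.coeff_mul, Finset.sum_mul]
  refine Finset.sum_congr rfl fun x hx ↦ ?_
  rw [← Finset.HasAntidiagonal.mem_antidiagonal.mp hx, pow_add]
  ring

lemma const_mul (hf : HasQExp h P f) (c : ℂ) :
    HasQExp h (PowerSeries.C c * P) (fun τ ↦ c * f τ) :=
  (const c).mul hf

lemma neg (hf : HasQExp h P f) : HasQExp h (-P) (-f) := by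
  intro τ
  convert! (hf τ).neg using 2 with n
  rw [map_neg, neg_mul]

lemma sub (hf : HasQExp h P f) (hg : HasQExp h Q g) : HasQExp h (P - Q) (f - g) := by
  rw [sub_eq_add_neg, sub_eq_add_neg]; exact hf.add hg.neg

lemma one : HasQExp h 1 1 := by simpa using! const (h := h) 1

lemma zero : HasQExp h 0 0 := by simpa using! const (h := h) 0

lemma pow (hf : HasQExp h P f) (n : ℕ) : HasQExp h (P ^ n) (f ^ n) := by
  induction n with
  | zero => simpa using one
  | succ n ih => rw [pow_succ, pow_succ]; exact ih.mul hf

lemma prod {ι : Type} {s : Finset ι} {P : ι → PowerSeries ℂ} {f : ι → ℍ → ℂ}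
    (H : ∀ i ∈ s, HasQExp h (P i) (f i)) :
    HasQExp h (∏ i ∈ s, P i) (fun τ ↦ ∏ i ∈ s, f i τ) := by
  have : (fun τ ↦ ∏ i ∈ s, f i τ) = ∏ i ∈ s, f i := by ext; simp
  rw [this]
  induction s using Finset.induction_on with
  | empty => simpa using one
  | insert a s ha ih =>
    rw [Finset.prod_insert ha, Finset.prod_insert ha]
    exact (H a (by simp)).mul
      (ih (fun i hi ↦ H i (by simp [hi])) (by ext; simp))

lemma sum {ι : Type} {s : Finset ι} {P : ι → PowerSeries ℂ} {f : ι → ℍ → ℂ}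
    (H : ∀ i ∈ s, HasQExp h (P i) (f i)) :
    HasQExp h (∑ i ∈ s, P i) (fun τ ↦ ∑ i ∈ s, f i τ) := by
  have : (fun τ ↦ ∑ i ∈ s, f i τ) = ∑ i ∈ s, f i := by ext; simp
  rw [this]
  induction s using Finset.induction_on with
  | empty => simpa using zero
  | insert a s ha ih =>
    rw [Finset.sum_insert ha, Finset.sum_insert ha]
    exact (H a (by simp)).add
      (ih (fun i hi ↦ H i (by simp [hi])) (by ext; simp))

lemma congr (hf : HasQExp h P f) (hfg : ∀ τ, f τ = g τ) : HasQExp h P g := by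
  intro τ; rw [← hfg]; exact hf τ

lemma smul_form (hf : HasQExp h P f) (τ : ℍ) :
    HasSum (fun n : ℕ ↦ PowerSeries.coeff n P • Periodic.qParam h τ ^ n) (f τ) := hf τ

lemma eq_zero (hh : 0 < h) (hf : HasQExp h P f) (h0 : ∀ τ, f τ = 0) : P = 0 := by
  have hf0 : f = 0 := funext h0
  have hc : UpperHalfPlane.cuspFunction h (0 : ℍ → ℂ) = 0 := by
    ext q
    rcases eq_or_ne q 0 with rfl | hq
    · exact IsZeroAtImInfty.cuspFunction_apply_zero (f := (0 : ℍ → ℂ))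
        (by simpa using! tendsto_const_nhds) hh
    · simp [UpperHalfPlane.cuspFunction, Periodic.cuspFunction_eq_of_nonzero _ _ hq]
  have h1 := hasFPowerSeriesOnBall_cuspFunction (f := f) hh
    (by rw [hf0, hc]; exact analyticAt_const) hf.smul_form
  rw [hf0, hc] at h1
  have h2 := h1.hasFPowerSeriesAt.eq_zero
  ext n
  have h3 := congrArg (fun F ↦ FormalMultilinearSeries.coeff F n) h2
  rw [FormalMultilinearSeries.coeff_ofScalars] at h3
  rw [h3]
  rfl

lemma unique (hh : 0 < h) (hf : HasQExp h P f) (hg : HasQExp h Q f) : P = Q :=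
  sub_eq_zero.mp ((hf.sub hg).eq_zero hh (by simp))

lemma unique' (hh : 0 < h) (hf : HasQExp h P f) (hg : HasQExp h Q g) (hfg : ∀ τ, f τ = g τ) :
    P = Q :=
  (hf.congr hfg).unique hh hg

lemma apply_eq (hf : HasQExp h P f) (hg : HasQExp h P g) (τ : ℍ) : f τ = g τ :=
  (hf τ).unique (hg τ)

lemma isBoundedAtImInfty (hh : 0 < h) (hf : HasQExp h P f) : IsBoundedAtImInfty f :=
  isBoundedAtImInfty_of_hasSum_qExpansion hh hf.smul_form

lemma hasFPowerSeriesOnBall (hh : 0 < h) (hf : HasQExp h P f) :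
    HasFPowerSeriesOnBall (fun q ↦ ∑' n : ℕ, PowerSeries.coeff n P * q ^ n)
      (.ofScalars ℂ fun n ↦ PowerSeries.coeff n P) 0 1 := by
  have hs : ∀ q : ℂ, ‖q‖ < 1 → Summable fun n ↦ PowerSeries.coeff n P * q ^ n := by
    intro q hq
    rcases eq_or_ne q 0 with rfl | hq1
    · refine summable_of_ne_finset_zero (s := {0}) fun n hn ↦ ?_
      rw [zero_pow (by simpa using hn), mul_zero]
    · have h1 := Periodic.im_invQParam_pos_of_norm_lt_one hh hq hq1
      have h2 := (hf ⟨Periodic.invQParam h q, h1⟩).summable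
      simpa [Periodic.qParam_right_inv hh.ne' hq1] using h2
  constructor
  · refine le_of_forall_lt_imp_le_of_dense fun r hr ↦ ?_
    lift r to NNReal using hr.ne_top
    apply FormalMultilinearSeries.le_radius_of_summable
    have := (hs (r : ℂ) (by simpa using hr)).norm
    simpa [norm_mul] using this
  · simp
  · intro y hy
    rw [← ENNReal.coe_one, Metric.eball_coe, NNReal.coe_one, mem_ball_zero_iff] at hy
    simpa [mul_comm] using (hs y hy).hasSum

lemma mdifferentiable (hh : 0 < h) (hf : HasQExp h P f) : MDiff f := by
  rw [UpperHalfPlane.mdifferentiable_iff]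
  have h1 : ∀ z ∈ {z : ℂ | 0 < z.im}, (f ∘ ofComplex) z =
      (fun q ↦ ∑' n : ℕ, PowerSeries.coeff n P * q ^ n) (Periodic.qParam h z) := by
    intro z hz
    have := (hf ⟨z, hz⟩).tsum_eq
    simp only [comp_apply, ofComplex_apply_of_im_pos hz]
    exact this.symm
  refine DifferentiableOn.congr ?_ h1
  intro z hz
  have h2 : ‖Periodic.qParam h z‖ < 1 := Periodic.norm_qParam_lt_one hh hz
  have h3 := (hf.hasFPowerSeriesOnBall hh).differentiableOn.differentiableAt
    (x := Periodic.qParam h z) (Metric.isOpen_eball.mem_nhds (by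
      rw [← ENNReal.coe_one, Metric.eball_coe, NNReal.coe_one, mem_ball_zero_iff]; exact h2))
  exact (DifferentiableAt.comp (f := Periodic.qParam h) z h3
    (Periodic.differentiable_qParam.differentiableAt)).differentiableWithinAt

lemma tendsto (hh : 0 < h) (hf : HasQExp h P f) :
    Tendsto f atImInfty (𝓝 (PowerSeries.coeff 0 P)) := by
  have h1 := (hf.hasFPowerSeriesOnBall hh).hasFPowerSeriesAt.continuousAt.tendsto.comp
    (qParam_tendsto_atImInfty hh)
  have h0 : (∑' n : ℕ, PowerSeries.coeff n P * (0 : ℂ) ^ n) = PowerSeries.coeff 0 P := by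
    rw [tsum_eq_single 0 (fun n hn ↦ by simp [hn])]; simp
  simp only [h0] at h1
  refine h1.congr fun τ ↦ ?_
  exact (hf τ).tsum_eq

end HasQExp

end QExp

section LevelOne

open UpperHalfPlane hiding I
open Complex Filter Function ModularForm
open scoped Topology Manifold MatrixGroups CongruenceSubgroup

lemma UpperHalfPlane.coe_S_smul (τ : ℍ) : ((ModularGroup.S • τ : ℍ) : ℂ) = -(τ : ℂ)⁻¹ := by
  rw [modular_S_smul, ← inv_neg]

lemma UpperHalfPlane.coe_T_smul (τ : ℍ) : ((ModularGroup.T • τ : ℍ) : ℂ) = (τ : ℂ) + 1 := by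
  rw [modular_T_smul, UpperHalfPlane.coe_vadd]; push_cast; ring

/-- The function `F` is a modular form of weight `k` and level one, with `q`-expansion `P`. -/
structure IsLevelOne (k : ℤ) (P : PowerSeries ℂ) (F : ℍ → ℂ) : Prop where
  hasQExp : HasQExp 1 P F
  S_smul : ∀ τ : ℍ, F (ModularGroup.S • τ) = (τ : ℂ) ^ k * F τ

lemma HasQExp.T_smul {P : PowerSeries ℂ} {F : ℍ → ℂ} (hF : HasQExp 1 P F) (τ : ℍ) :
    F (ModularGroup.T • τ) = F τ := by
  have h1 : Periodic.qParam 1 (ModularGroup.T • τ : ℍ) = Periodic.qParam 1 τ := by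
    rw [UpperHalfPlane.coe_T_smul, Periodic.qParam, Periodic.qParam]
    rw [Complex.exp_eq_exp_iff_exists_int]
    exact ⟨1, by push_cast; ring⟩
  have h2 := hF (ModularGroup.T • τ)
  rw [h1] at h2
  exact h2.unique (hF τ)

namespace IsLevelOne

variable {k l : ℤ} {P Q : PowerSeries ℂ} {F G : ℍ → ℂ}

lemma mul (hF : IsLevelOne k P F) (hG : IsLevelOne l Q G) : IsLevelOne (k + l) (P * Q) (F * G) :=
  ⟨hF.hasQExp.mul hG.hasQExp, fun τ ↦ by
    rw [Pi.mul_apply, Pi.mul_apply, hF.S_smul, hG.S_smul, zpow_add₀ (UpperHalfPlane.ne_zero τ)]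
    ring⟩

lemma add (hF : IsLevelOne k P F) (hG : IsLevelOne k Q G) : IsLevelOne k (P + Q) (F + G) :=
  ⟨hF.hasQExp.add hG.hasQExp, fun τ ↦ by
    rw [Pi.add_apply, Pi.add_apply, hF.S_smul, hG.S_smul]; ring⟩

lemma sub (hF : IsLevelOne k P F) (hG : IsLevelOne k Q G) : IsLevelOne k (P - Q) (F - G) :=
  ⟨hF.hasQExp.sub hG.hasQExp, fun τ ↦ by
    rw [Pi.sub_apply, Pi.sub_apply, hF.S_smul, hG.S_smul]; ring⟩

lemma const_mul (hF : IsLevelOne k P F) (c : ℂ) :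
    IsLevelOne k (PowerSeries.C c * P) (fun τ ↦ c * F τ) :=
  ⟨hF.hasQExp.const_mul c, fun τ ↦ by rw [hF.S_smul]; ring⟩

lemma one : IsLevelOne 0 1 1 := ⟨HasQExp.one, fun τ ↦ by simp⟩

lemma pow (hF : IsLevelOne k P F) (n : ℕ) : IsLevelOne (k * n) (P ^ n) (F ^ n) := by
  induction n with
  | zero => simpa using one
  | succ n ih =>
    rw [pow_succ, pow_succ, Nat.cast_succ, mul_add, mul_one]
    exact ih.mul hF

lemma slash_S (hF : IsLevelOne k P F) : F ∣[k] ModularGroup.S = F := by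
  ext τ
  rw [SL_slash_apply, hF.S_smul, ModularGroup.denom_S]
  rw [mul_right_comm, ← zpow_add₀ (UpperHalfPlane.ne_zero τ)]
  simp

lemma slash_T (hF : IsLevelOne k P F) : F ∣[k] ModularGroup.T = F := by
  ext τ
  rw [SL_slash_apply, hF.hasQExp.T_smul]
  have : denom (ModularGroup.T : GL (Fin 2) ℝ) τ = 1 := by
    rw [ModularGroup.denom_apply]; simp [ModularGroup.T]
  rw [this]; simp

lemma slash (hF : IsLevelOne k P F) (γ : SL(2, ℤ)) : F ∣[k] γ = F :=
  SlashInvariantForm.slash_action_generators_SL2Z hF.slash_S hF.slash_T γ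

lemma SL_smul (hF : IsLevelOne k P F) (γ : SL(2, ℤ)) (τ : ℍ) :
    F (γ • τ) = denom γ τ ^ k * F τ := by
  have h1 := congrFun (hF.slash γ) τ
  rw [SL_slash_apply] at h1
  rw [← h1, mul_comm, mul_assoc, ← zpow_add₀ (denom_ne_zero _ _)]
  simp

/-- The bundled modular form. -/
def toModularForm (hF : IsLevelOne k P F) : ModularForm 𝒮ℒ k where
  toFun := F
  slash_action_eq' := fun _ ⟨γ, hγ⟩ ↦ hγ ▸ hF.slash γ
  holo' := hF.hasQExp.mdifferentiable one_pos
  bdd_at_cusps' {c} hc := by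
    rw [Subgroup.IsArithmetic.isCusp_iff_isCusp_SL2Z] at hc
    rw [OnePoint.isBoundedAt_iff_forall_SL2Z hc]
    intro γ _
    rw [hF.slash γ]
    exact hF.hasQExp.isBoundedAtImInfty one_pos

lemma of_modularForm {f : ModularForm 𝒮ℒ k} : IsLevelOne k (qExpansion 1 f) f := by
  refine ⟨fun τ ↦ ModularForm.hasSum_qExpansion f one_pos one_mem_strictPeriods_SL τ,
    fun τ ↦ ?_⟩
  have h1 := congrFun (SlashInvariantForm.slash_action_eqn f _
    (MonoidHom.mem_range.mpr ⟨ModularGroup.S, rfl⟩)) τ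
  have h2 : ((f : ℍ → ℂ) ∣[k] ModularGroup.S) τ = f τ := h1
  rw [SL_slash_apply, ModularGroup.denom_S] at h2
  rw [← h2, mul_comm, mul_assoc, ← zpow_add₀ (UpperHalfPlane.ne_zero τ)]
  simp

lemma qExpansion_eq (hF : IsLevelOne k P F) : qExpansion 1 F = P :=
  HasQExp.unique one_pos (of_modularForm (f := hF.toModularForm)).hasQExp hF.hasQExp

lemma eq_const (hF : IsLevelOne 0 P F) : ∃ c : ℂ, P = PowerSeries.C c ∧ ∀ τ, F τ = c := by
  obtain ⟨c, hc⟩ := ModularFormClass.levelOne_weight_zero_const hF.toModularForm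
  have hc' : ∀ τ, F τ = c := fun τ ↦ congrFun hc τ
  exact ⟨c, hF.hasQExp.unique' one_pos (HasQExp.const c) hc', hc'⟩

lemma discriminant : IsLevelOne 12 (qExpansion 1 ModularForm.discriminant)
    ModularForm.discriminant :=
  of_modularForm (f := (CuspForm.discriminant : ModularForm 𝒮ℒ 12))

lemma exists_eq_discriminant_mul (hF : IsLevelOne (k + 12) P F) (h0 : PowerSeries.coeff 0 P = 0) :
    ∃ Q G, IsLevelOne k Q G ∧ P = qExpansion 1 ModularForm.discriminant * Q ∧
      ∀ τ, F τ = ModularForm.discriminant τ * G τ := by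
  have hc : (qExpansion 1 hF.toModularForm).coeff 0 = 0 := by
    rw [show qExpansion 1 hF.toModularForm = P from hF.qExpansion_eq, h0]
  set G := CuspForm.discriminantEquiv (toCuspForm hF.toModularForm hc)
  have hG : IsLevelOne k (qExpansion 1 G) G := by
    have := of_modularForm (f := G)
    constructor
    · exact this.hasQExp
    · intro τ
      rw [this.S_smul]; simp only [add_sub_cancel_right]
  refine ⟨_, _, hG, ?_, fun τ ↦ ?_⟩
  · rw [← hF.qExpansion_eq]
    exact qExpansion_eq_qExpansion_discriminant_mul hF.toModularForm hc
  · exact (discriminant_mul_discriminantEquiv_apply (toCuspForm hF.toModularForm hc) τ).symm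

end IsLevelOne

end LevelOne

section Structure

open UpperHalfPlane hiding I
open Complex Filter Function ModularForm
open scoped Topology Manifold MatrixGroups CongruenceSubgroup

/-- The `q`-expansion of the normalised Eisenstein series of weight `4`, over any ring. -/
def eisenstein4 (R : Type) [CommRing R] : PowerSeries R :=
  .mk fun n ↦ if n = 0 then 1 else 240 * (ArithmeticFunction.sigma 3 n : R)

/-- The `q`-expansion of the normalised Eisenstein series of weight `6`, over any ring. -/
def eisenstein6 (R : Type) [CommRing R] : PowerSeries R :=
  .mk fun n ↦ if n = 0 then 1 else -504 * (ArithmeticFunction.sigma 5 n : R)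

/-- The `q`-expansion of the discriminant, over a ring in which `u` is the inverse of `1728`. -/
def discSeries {R : Type} [CommRing R] (u : R) : PowerSeries R :=
  PowerSeries.C u * (eisenstein4 R ^ 3 - eisenstein6 R ^ 2)

section Ring

variable {R S : Type} [CommRing R] [CommRing S]

lemma map_eisenstein4 (φ : R →+* S) : (eisenstein4 R).map φ = eisenstein4 S := by
  ext n
  rw [PowerSeries.coeff_map, eisenstein4, eisenstein4, PowerSeries.coeff_mk, PowerSeries.coeff_mk]
  split_ifs <;> simp [_root_.map_ofNat φ]

lemma map_eisenstein6 (φ : R →+* S) : (eisenstein6 R).map φ = eisenstein6 S := by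
  ext n
  rw [PowerSeries.coeff_map, eisenstein6, eisenstein6, PowerSeries.coeff_mk, PowerSeries.coeff_mk]
  split_ifs <;> simp [_root_.map_ofNat φ]

lemma map_discSeries (φ : R →+* S) (u : R) : (discSeries u).map φ = discSeries (φ u) := by
  simp [discSeries, map_eisenstein4, map_eisenstein6]

lemma coeff_zero_eisenstein4 : PowerSeries.coeff 0 (eisenstein4 R) = 1 := by
  simp [eisenstein4]

lemma coeff_zero_eisenstein6 : PowerSeries.coeff 0 (eisenstein6 R) = 1 := by
  simp [eisenstein6]

lemma exists_discSeries_eq {u : R} (hu : 1728 * u = 1) :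
    ∃ U : PowerSeries R, IsUnit U ∧ discSeries u = PowerSeries.X * U := by
  have h4 : ∃ V, eisenstein4 R = 1 + PowerSeries.X * V ∧ PowerSeries.constantCoeff V = 240 := by
    obtain ⟨V, hV⟩ := PowerSeries.X_dvd_iff.mpr (show PowerSeries.constantCoeff
      (eisenstein4 R - 1) = 0 by
        rw [map_sub, ← PowerSeries.coeff_zero_eq_constantCoeff_apply, coeff_zero_eisenstein4]; simp)
    refine ⟨V, by rw [← hV]; ring, ?_⟩
    have := congrArg (PowerSeries.coeff 1) hV
    rw [show (1 : ℕ) = 0 + 1 from rfl, PowerSeries.coeff_succ_X_mul] at this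
    rw [← PowerSeries.coeff_zero_eq_constantCoeff_apply, ← this]
    simp [eisenstein4, PowerSeries.coeff_one]
  have h6 : ∃ V, eisenstein6 R = 1 + PowerSeries.X * V ∧ PowerSeries.constantCoeff V = -504 := by
    obtain ⟨V, hV⟩ := PowerSeries.X_dvd_iff.mpr (show PowerSeries.constantCoeff
      (eisenstein6 R - 1) = 0 by
        rw [map_sub, ← PowerSeries.coeff_zero_eq_constantCoeff_apply, coeff_zero_eisenstein6]; simp)
    refine ⟨V, by rw [← hV]; ring, ?_⟩
    have := congrArg (PowerSeries.coeff 1) hV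
    rw [show (1 : ℕ) = 0 + 1 from rfl, PowerSeries.coeff_succ_X_mul] at this
    rw [← PowerSeries.coeff_zero_eq_constantCoeff_apply, ← this]
    simp [eisenstein6, PowerSeries.coeff_one]
  obtain ⟨V, hV, hV0⟩ := h4
  obtain ⟨W, hW, hW0⟩ := h6
  refine ⟨PowerSeries.C u * (3 * V + 3 * PowerSeries.X * V ^ 2 + PowerSeries.X ^ 2 * V ^ 3
    - (2 * W + PowerSeries.X * W ^ 2)), ?_, ?_⟩
  · rw [PowerSeries.isUnit_iff_constantCoeff]
    simp only [map_mul, map_sub, map_add, map_pow, PowerSeries.constantCoeff_X, hV0, hW0,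
      PowerSeries.constantCoeff_C, map_ofNat]
    convert! isUnit_one (M := R)
    rw [← hu]; ring
  · rw [discSeries, hV, hW]; ring

lemma discSeries_ne_zero [Nontrivial R] {u : R} (hu : 1728 * u = 1) : discSeries u ≠ 0 := by
  obtain ⟨U, hU, h⟩ := exists_discSeries_eq hu
  rw [h]
  intro h0
  have : (PowerSeries.X : PowerSeries R) = 0 := by
    obtain ⟨U, rfl⟩ := hU
    exact (Units.mul_left_eq_zero U).mp h0
  exact PowerSeries.X_ne_zero this

/-- The degree `m` homogenisation of `A`, evaluated at `(Q, D)`. -/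
def homogEval (φ : R →+* S) (m : ℕ) (A : R[X]) (Q D : S) : S :=
  ∑ i ∈ range (m + 1), φ (A.coeff i) * Q ^ i * D ^ (m - i)

lemma homogEval_eq {K : Type} [Field K] (φ : R →+* K) {m : ℕ} {A : R[X]} (hA : A.natDegree ≤ m)
    (Q : K) {D : K} (hD : D ≠ 0) : homogEval φ m A Q D = D ^ m * A.eval₂ φ (Q / D) := by
  rw [Polynomial.eval₂_eq_sum_range' φ (Nat.lt_succ_of_le hA), Finset.mul_sum, homogEval]
  refine Finset.sum_congr rfl fun i hi ↦ ?_
  have hi' : i ≤ m := Nat.lt_succ_iff.mp (Finset.mem_range.mp hi)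
  rw [div_pow, ← Nat.sub_add_cancel hi', pow_add, Nat.add_sub_cancel]
  field_simp

lemma map_homogEval {T : Type} [CommRing T] (φ : R →+* S) (ψ : S →+* T) (m : ℕ) (A : R[X])
    (Q D : S) : ψ (homogEval φ m A Q D) = homogEval (ψ.comp φ) m A (ψ Q) (ψ D) := by
  simp [homogEval]

lemma homogEval_map {T : Type} [CommRing T] (φ : R →+* S) (ψ : S →+* T) (m : ℕ) (A : R[X])
    (Q D : T) : homogEval ψ m (A.map φ) Q D = homogEval (ψ.comp φ) m A Q D := by
  simp [homogEval]

/-- The `j`-invariant series is transcendental. -/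
lemma eq_zero_of_eval₂_jSeries {k : Type} [Field k] {u : k} (hu : 1728 * u = 1) {A : k[X]}
    (hA : A.eval₂ ((algebraMap (PowerSeries k) (FractionRing (PowerSeries k))).comp PowerSeries.C)
      (algebraMap (PowerSeries k) (FractionRing (PowerSeries k)) (eisenstein4 k ^ 3) /
        algebraMap (PowerSeries k) (FractionRing (PowerSeries k)) (discSeries u)) = 0) : A = 0 := by
  set ι := algebraMap (PowerSeries k) (FractionRing (PowerSeries k))
  have hι : Function.Injective ι := IsFractionRing.injective _ _
  have hD : ι (discSeries u) ≠ 0 := by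
    rw [Ne, map_eq_zero_iff _ hι]; exact discSeries_ne_zero hu
  have h1 := homogEval_eq (ι.comp PowerSeries.C) (le_refl A.natDegree) (ι (eisenstein4 k ^ 3)) hD
  rw [hA, mul_zero, ← map_homogEval, map_eq_zero_iff _ hι, homogEval,
    Finset.sum_range_succ] at h1
  have h2 := congrArg PowerSeries.constantCoeff h1
  obtain ⟨U, -, hU⟩ := exists_discSeries_eq hu
  have hc : PowerSeries.constantCoeff (discSeries u) = 0 := by rw [hU]; simp
  rw [map_add, map_sum, Finset.sum_eq_zero] at h2
  · rw [← Polynomial.leadingCoeff_eq_zero, Polynomial.leadingCoeff]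
    have h4 : PowerSeries.constantCoeff (eisenstein4 k) = 1 := by
      rw [← PowerSeries.coeff_zero_eq_constantCoeff_apply, coeff_zero_eisenstein4]
    simpa [h4] using h2
  · intro i hi
    rw [map_mul, map_pow, hc, zero_pow, mul_zero]
    have := Finset.mem_range.mp hi
    omega

end Ring

lemma qExpansion_E₄ : qExpansion 1 E₄ = eisenstein4 ℂ := by
  ext n
  rw [EisensteinSeries.E_qExpansion_coeff _ ⟨2, rfl⟩, eisenstein4, PowerSeries.coeff_mk]
  norm_num [show _root_.bernoulli 4 = -1 / 30 by decide +kernel]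

lemma qExpansion_E₆ : qExpansion 1 E₆ = eisenstein6 ℂ := by
  ext n
  rw [EisensteinSeries.E_qExpansion_coeff _ ⟨3, rfl⟩, eisenstein6, PowerSeries.coeff_mk]
  norm_num [show _root_.bernoulli 6 = 1 / 42 by decide +kernel]

lemma isLevelOne_E₄ : IsLevelOne 4 (eisenstein4 ℂ) E₄ :=
  qExpansion_E₄ ▸ IsLevelOne.of_modularForm

lemma isLevelOne_E₆ : IsLevelOne 6 (eisenstein6 ℂ) E₆ :=
  qExpansion_E₆ ▸ IsLevelOne.of_modularForm

lemma qExpansion_discriminant {u : ℂ} (hu : 1728 * u = 1) :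
    qExpansion 1 ModularForm.discriminant = discSeries u := by
  refine IsLevelOne.discriminant.hasQExp.unique' one_pos
    (((isLevelOne_E₄.hasQExp.pow 3).sub (isLevelOne_E₆.hasQExp.pow 2)).const_mul u) fun τ ↦ ?_
  have hu' : u = 1 / 1728 := by
    rw [eq_div_iff (by norm_num)]; linear_combination hu
  rw [discriminant_eq_E₄_cube_sub_E₆_sq, hu', Pi.sub_apply, Pi.pow_apply, Pi.pow_apply]
  ring

lemma isLevelOne_discriminant {u : ℂ} (hu : 1728 * u = 1) :
    IsLevelOne 12 (discSeries u) ModularForm.discriminant :=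
  qExpansion_discriminant hu ▸ IsLevelOne.discriminant

/-- The modular `j`-invariant. -/
def modularJ (τ : ℍ) : ℂ := E₄ τ ^ 3 / ModularForm.discriminant τ

lemma modularJ_SL_smul (γ : SL(2, ℤ)) (τ : ℍ) : modularJ (γ • τ) = modularJ τ := by
  have h1 := isLevelOne_E₄.SL_smul γ τ
  have h2 := (isLevelOne_discriminant (u := 1 / 1728) (by norm_num)).SL_smul γ τ
  rw [modularJ, modularJ, h1, h2, mul_pow, ← zpow_natCast, ← zpow_mul]
  exact mul_div_mul_left _ _ (zpow_ne_zero _ (denom_ne_zero _ _))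

variable {R : Type} [CommRing R]

/-- A modular form of level one and weight `12m` with coefficients in `R` is a homogeneous
polynomial of degree `m` with coefficients in `R` in `E₄³` and the discriminant. -/
lemma IsLevelOne.exists_homogEval {φ : R →+* ℂ} (hφ : Function.Injective φ) {u : R}
    (hu : 1728 * u = 1) (m : ℕ) : ∀ (P : PowerSeries R) (F : ℍ → ℂ),
      IsLevelOne (12 * m) (P.map φ) F → ∃ A : R[X], A.natDegree ≤ m ∧
        P = homogEval PowerSeries.C m A (eisenstein4 R ^ 3) (discSeries u) := by
  have hφu : 1728 * φ u = 1 := by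
    rw [← map_one φ, ← hu, map_mul, _root_.map_ofNat φ]
  have hmap : Function.Injective (PowerSeries.map φ) := by
    intro P Q h
    ext n
    apply hφ
    rw [← PowerSeries.coeff_map, ← PowerSeries.coeff_map, h]
  induction m with
  | zero =>
    intro P F hF
    rw [Nat.cast_zero, mul_zero] at hF
    obtain ⟨c, hc, -⟩ := hF.eq_const
    refine ⟨Polynomial.C (PowerSeries.coeff 0 P), by simp, ?_⟩
    have : P = PowerSeries.C (PowerSeries.coeff 0 P) := by
      apply hmap
      rw [PowerSeries.map_C, ← PowerSeries.coeff_map, hc, PowerSeries.coeff_zero_C]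
    simpa [homogEval] using this
  | succ m ih =>
    intro P F hF
    set c := PowerSeries.coeff 0 P
    have h0 : PowerSeries.constantCoeff (P - PowerSeries.C c * (eisenstein4 R ^ 3) ^ (m + 1)) =
        0 := by
      have h4 : PowerSeries.constantCoeff (eisenstein4 R) = 1 := by
        rw [← PowerSeries.coeff_zero_eq_constantCoeff_apply, coeff_zero_eisenstein4]
      simp [h4, c]
    obtain ⟨P', hP'⟩ := PowerSeries.X_dvd_iff.mpr h0
    obtain ⟨U, hU, hUD⟩ := exists_discSeries_eq hu
    obtain ⟨U, rfl⟩ := hU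
    set P₁ : PowerSeries R := ↑U⁻¹ * P'
    have hP₁ : P - PowerSeries.C c * (eisenstein4 R ^ 3) ^ (m + 1) = discSeries u * P₁ := by
      rw [hP', hUD, mul_assoc, Units.mul_inv_cancel_left]
    have h4 : IsLevelOne (12 * (m : ℤ) + 12)
        (((eisenstein4 R ^ 3) ^ (m + 1)).map φ) ((⇑E₄ ^ 3) ^ (m + 1)) := by
      have := (isLevelOne_E₄.pow 3).pow (m + 1)
      rw [map_pow, map_pow, map_eisenstein4]
      convert! this using 1
    rw [Nat.cast_succ, mul_add, mul_one] at hF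
    have hG := hF.sub (h4.const_mul (φ c))
    have hser : P.map φ - PowerSeries.C (φ c) * ((eisenstein4 R ^ 3) ^ (m + 1)).map φ =
        (discSeries u * P₁).map φ := by
      rw [← hP₁, map_sub, map_mul, PowerSeries.map_C]
    rw [hser] at hG
    obtain ⟨Q, G, hQ, hPQ, -⟩ := hG.exists_eq_discriminant_mul (by
      rw [← hP₁, PowerSeries.coeff_map, PowerSeries.coeff_zero_eq_constantCoeff_apply, h0,
          map_zero])
    rw [qExpansion_discriminant hφu, map_mul, map_discSeries] at hPQ
    have hQ1 : Q = P₁.map φ := (mul_left_cancel₀ (discSeries_ne_zero hφu) hPQ).symm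
    rw [hQ1] at hQ
    obtain ⟨A, hA, hPA⟩ := ih P₁ G hQ
    refine ⟨A + Polynomial.C c * Polynomial.X ^ (m + 1), ?_, ?_⟩
    · refine (Polynomial.natDegree_add_le _ _).trans (max_le (by omega) ?_)
      exact Polynomial.natDegree_C_mul_X_pow_le _ _
    · have h1 : P = discSeries u * P₁ + PowerSeries.C c * (eisenstein4 R ^ 3) ^ (m + 1) := by
        rw [← hP₁]; ring
      rw [h1, hPA, homogEval, homogEval, Finset.sum_range_succ _ (m + 1), Finset.mul_sum]
      congr 1
      · refine Finset.sum_congr rfl fun i hi ↦ ?_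
        have hi' : i < m + 1 := Finset.mem_range.mp hi
        rw [Polynomial.coeff_add, Polynomial.coeff_C_mul, Polynomial.coeff_X_pow,
          if_neg (by omega), mul_zero, add_zero, show m + 1 - i = (m - i) + 1 by omega, pow_succ]
        ring
      · rw [Polynomial.coeff_add, Polynomial.coeff_C_mul, Polynomial.coeff_X_pow, if_pos rfl,
          Polynomial.coeff_eq_zero_of_natDegree_lt (by omega)]
        simp

/-- The polynomial in `j` attached to a modular form of weight `12m`. -/
lemma IsLevelOne.apply_eq_eval {φ : R →+* ℂ} {u : R} (hu : 1728 * u = 1) {m : ℕ}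
    {F : ℍ → ℂ} {A : R[X]} (hA : A.natDegree ≤ m)
    (hF : HasQExp 1 ((homogEval PowerSeries.C m A (eisenstein4 R ^ 3) (discSeries u)).map φ) F)
    (τ : ℍ) : F τ = ModularForm.discriminant τ ^ m * A.eval₂ φ (modularJ τ) := by
  have hφu : 1728 * φ u = 1 := by
    rw [← map_one φ, ← hu, map_mul, _root_.map_ofNat φ]
  rw [modularJ, ← homogEval_eq φ hA _ (discriminant_ne_zero τ), homogEval]
  refine hF.apply_eq (g := fun τ ↦ ∑ i ∈ range (m + 1),
    φ (A.coeff i) * (E₄ τ ^ 3) ^ i * ModularForm.discriminant τ ^ (m - i)) ?_ τ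
  rw [map_homogEval, homogEval]
  refine HasQExp.sum fun i _ ↦ ?_
  have h1 := ((((isLevelOne_E₄.hasQExp.pow 3).pow i).mul
    ((isLevelOne_discriminant hφu).hasQExp.pow (m - i))).const_mul (φ (A.coeff i)))
  have h2 : ((PowerSeries.map φ).comp PowerSeries.C) (A.coeff i) *
      (PowerSeries.map φ (eisenstein4 R ^ 3)) ^ i * (PowerSeries.map φ (discSeries u)) ^ (m - i) =
      PowerSeries.C (φ (A.coeff i)) * ((eisenstein4 ℂ ^ 3) ^ i * discSeries (φ u) ^ (m - i)) := by
    rw [map_pow, map_eisenstein4, map_discSeries, RingHom.comp_apply, PowerSeries.map_C, mul_assoc]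
  rw [h2]
  exact h1.congr fun τ ↦ by
    simp only [Pi.mul_apply, Pi.pow_apply]; ring

end Structure

section JSurjective

open UpperHalfPlane hiding I
open Complex Filter Function ModularForm
open scoped Topology Manifold MatrixGroups CongruenceSubgroup

lemma eq_const_of_SL_invariant {F : ℍ → ℂ} (hF : ∀ (γ : SL(2, ℤ)) (τ : ℍ), F (γ • τ) = F τ)
    (hol : MDiff F) (hb : IsBoundedAtImInfty F) : ∃ c : ℂ, ∀ τ, F τ = c := by
  have hs : ∀ γ : SL(2, ℤ), F ∣[(0 : ℤ)] γ = F := by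
    intro γ; ext τ; rw [SL_slash_apply, hF]; simp
  let f : ModularForm 𝒮ℒ 0 :=
    { toFun := F
      slash_action_eq' := fun _ ⟨γ, hγ⟩ ↦ hγ ▸ hs γ
      holo' := hol
      bdd_at_cusps' := fun {c} hc ↦ by
        rw [Subgroup.IsArithmetic.isCusp_iff_isCusp_SL2Z] at hc
        rw [OnePoint.isBoundedAt_iff_forall_SL2Z hc]
        intro γ _
        rw [hs γ]
        exact hb }
  obtain ⟨c, hc⟩ := ModularFormClass.levelOne_weight_zero_const f
  exact ⟨c, fun τ ↦ congrFun hc τ⟩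

lemma exists_modularJ_eq (j : ℂ) : ∃ τ : ℍ, τ ∈ ModularGroup.fd ∧ modularJ τ = j := by
  suffices h : ∃ τ : ℍ, modularJ τ = j by
    obtain ⟨τ, hτ⟩ := h
    obtain ⟨γ, hγ⟩ := ModularGroup.exists_smul_mem_fd τ
    exact ⟨γ • τ, hγ, by rw [modularJ_SL_smul, hτ]⟩
  by_contra! H
  have hD := isLevelOne_discriminant (u := 1 / 1728) (by norm_num)
  have hF := ((isLevelOne_E₄.pow 3).sub (hD.const_mul j))
  set F : ℍ → ℂ := ⇑E₄ ^ 3 - fun τ ↦ j * ModularForm.discriminant τ with hFdef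
  have hF0 : ∀ τ, F τ ≠ 0 := by
    intro τ h0
    apply H τ
    rw [modularJ, div_eq_iff (discriminant_ne_zero τ)]
    exact sub_eq_zero.mp h0
  have hc0 : PowerSeries.coeff 0 (discSeries (1 / 1728 : ℂ)) = 0 := by
    obtain ⟨U, -, hU⟩ := exists_discSeries_eq (u := (1 / 1728 : ℂ)) (by norm_num)
    rw [hU]; simp
  have hlim : Tendsto (fun τ ↦ ModularForm.discriminant τ / F τ) atImInfty (𝓝 0) := by
    have h1 := hD.hasQExp.tendsto one_pos
    have h2 := hF.hasQExp.tendsto one_pos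
    have hc1 : PowerSeries.coeff 0 (eisenstein4 ℂ ^ 3 -
        PowerSeries.C j * discSeries (1 / 1728 : ℂ)) = 1 := by
      rw [map_sub, PowerSeries.coeff_C_mul, hc0, PowerSeries.coeff_zero_eq_constantCoeff_apply,
        map_pow, ← PowerSeries.coeff_zero_eq_constantCoeff_apply, coeff_zero_eisenstein4]
      simp
    rw [hc0] at h1
    rw [hc1] at h2
    have h3 := h1.div h2 one_ne_zero
    rw [zero_div] at h3
    exact h3
  obtain ⟨c, hc⟩ := eq_const_of_SL_invariant (F := fun τ ↦ ModularForm.discriminant τ / F τ)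
    (fun γ τ ↦ by
      have h1 := hF.SL_smul γ τ
      rw [hD.SL_smul γ τ, h1]
      exact mul_div_mul_left _ _ (zpow_ne_zero _ (denom_ne_zero _ _)))
    ((hD.hasQExp.mdifferentiable one_pos).div (hF.hasQExp.mdifferentiable one_pos) hF0)
    (hlim.isBigO_one ℝ)
  have hc' : c = 0 := by
    have h3 : Tendsto (fun τ : ℍ ↦ ModularForm.discriminant τ / F τ) atImInfty (𝓝 c) :=
      tendsto_const_nhds.congr fun τ ↦ (hc τ).symm
    exact tendsto_nhds_unique h3 hlim
  have h4 := hc UpperHalfPlane.I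
  rw [hc'] at h4
  exact div_ne_zero (discriminant_ne_zero _) (hF0 _) h4

end JSurjective

section

open PowerSeries

/-- The Weierstrass differential equation satisfied by `x = z² ℘(z)`, as an identity of formal power
series in `z`. -/
structure IsWeierstrass {A : Type*} [CommRing A] (a b : A) (x : PowerSeries A) : Prop where
  coeff_zero : PowerSeries.coeff 0 x = 1
  ode : (2 * x - PowerSeries.X * derivative A x) ^ 2 =
    4 * (x ^ 3 + PowerSeries.C a * PowerSeries.X ^ 4 * x + PowerSeries.C b * PowerSeries.X ^ 6)

lemma coeff_X_mul_derivative {A : Type*} [CommRing A] (x : PowerSeries A) (n : ℕ) :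
    PowerSeries.coeff n (PowerSeries.X * derivative A x) = n * PowerSeries.coeff n x := by
  cases n with
  | zero => simp
  | succ n => rw [PowerSeries.coeff_succ_X_mul, PowerSeries.coeff_derivative]; push_cast; ring

lemma map_derivative {A B : Type*} [CommRing A] [CommRing B] (φ : A →+* B) (x : PowerSeries A) :
    PowerSeries.map φ (derivative A x) = derivative B (PowerSeries.map φ x) := by
  ext n
  simp [PowerSeries.coeff_derivative]

lemma IsWeierstrass.map {A B : Type*} [CommRing A] [CommRing B] (φ : A →+* B) {a b : A}
    {x : PowerSeries A} (h : IsWeierstrass a b x) :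
    IsWeierstrass (φ a) (φ b) (PowerSeries.map φ x) := by
  refine ⟨by rw [PowerSeries.coeff_map, h.coeff_zero, map_one], ?_⟩
  have := congrArg (PowerSeries.map φ) h.ode
  rw [← _root_.map_ofNat (PowerSeries.map φ) 2, ← _root_.map_ofNat (PowerSeries.map φ) 4]
  simpa only [map_derivative, map_pow, map_sub, map_mul, map_add, PowerSeries.map_X,
    PowerSeries.map_C] using this

lemma coeff_two_sub {A : Type*} [CommRing A] (x : PowerSeries A) (n : ℕ) :
    PowerSeries.coeff n (2 * x - PowerSeries.X * derivative A x) =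
      (2 - n) * PowerSeries.coeff n x := by
  rw [map_sub, coeff_X_mul_derivative, two_mul, map_add]; ring

lemma coeff_mul_mem {A : Type*} [CommRing A] (S : Subring A) {F G : PowerSeries A} {n : ℕ}
    (hF : ∀ i ≤ n, PowerSeries.coeff i F ∈ S) (hG : ∀ i ≤ n, PowerSeries.coeff i G ∈ S) :
    PowerSeries.coeff n (F * G) ∈ S := by
  rw [PowerSeries.coeff_mul]
  refine sum_mem fun ij hij ↦ ?_
  have := Finset.HasAntidiagonal.mem_antidiagonal.1 hij
  exact mul_mem (hF _ (by omega)) (hG _ (by omega))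

lemma coeff_mul_sub_mem {A : Type*} [CommRing A] (S : Subring A) {F G : PowerSeries A} {n : ℕ}
    (hn : 0 < n) (hF : ∀ i < n, PowerSeries.coeff i F ∈ S)
    (hG : ∀ i < n, PowerSeries.coeff i G ∈ S) :
    PowerSeries.coeff n (F * G) - (PowerSeries.coeff 0 F * PowerSeries.coeff n G +
      PowerSeries.coeff n F * PowerSeries.coeff 0 G) ∈ S := by
  obtain ⟨n, rfl⟩ : ∃ k, n = k + 1 := ⟨n - 1, by omega⟩
  rw [PowerSeries.coeff_mul, Finset.Nat.sum_antidiagonal_succ]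
  cases n with
  | zero => simp
  | succ n =>
    rw [Finset.Nat.sum_antidiagonal_succ']
    have : ∑ ij ∈ Finset.HasAntidiagonal.antidiagonal n,
        PowerSeries.coeff (ij.1 + 1) F * PowerSeries.coeff (ij.2 + 1) G ∈ S := by
      refine sum_mem fun ij hij ↦ ?_
      have := Finset.HasAntidiagonal.mem_antidiagonal.1 hij
      exact mul_mem (hF _ (by omega)) (hG _ (by omega))
    convert! this using 1
    ring

lemma coeff_pow_mem {A : Type*} [CommRing A] (S : Subring A) {F : PowerSeries A} {n : ℕ}
    (hF : ∀ i ≤ n, PowerSeries.coeff i F ∈ S) (k : ℕ) : PowerSeries.coeff n (F ^ k) ∈ S := by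
  induction k generalizing n with
  | zero => rw [pow_zero, PowerSeries.coeff_one]; split_ifs <;> simp
  | succ k ih =>
    rw [pow_succ]
    exact coeff_mul_mem S (fun i hi ↦ ih fun j hj ↦ hF j (hj.trans hi)) hF

lemma coeff_pow_sub_mem {A : Type*} [CommRing A] (S : Subring A) {F : PowerSeries A} {n : ℕ}
    (hn : 0 < n) (h0 : PowerSeries.coeff 0 F = 1) (hF : ∀ i < n, PowerSeries.coeff i F ∈ S)
    (k : ℕ) : PowerSeries.coeff n (F ^ k) - k * PowerSeries.coeff n F ∈ S := by
  induction k with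
  | zero => simp [PowerSeries.coeff_one, hn.ne']
  | succ k ih =>
    have h1 := coeff_mul_sub_mem S hn
      (fun i hi ↦ coeff_pow_mem S (fun j hj ↦ hF j (hj.trans_lt hi)) k) hF
    have h2 : PowerSeries.coeff 0 (F ^ k) = 1 := by
      rw [PowerSeries.coeff_zero_eq_constantCoeff_apply, map_pow,
        ← PowerSeries.coeff_zero_eq_constantCoeff_apply, h0, one_pow]
    rw [h0, h2, ← pow_succ] at h1
    convert! add_mem h1 ih using 1
    push_cast
    ring

lemma C_mul_X_pow_mul_coeff_mem {A : Type*} [CommRing A] (S : Subring A) {a : A} (ha : a ∈ S)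
    {F : PowerSeries A} {n m : ℕ} (hm : 0 < m) (hF : ∀ i < n, PowerSeries.coeff i F ∈ S) :
    PowerSeries.coeff n (PowerSeries.C a * PowerSeries.X ^ m * F) ∈ S := by
  rw [mul_assoc, PowerSeries.coeff_C_mul, PowerSeries.coeff_X_pow_mul']
  split_ifs with h
  · exact mul_mem ha (hF _ (by omega))
  · simp

lemma IsWeierstrass.succ_mul_coeff_mem {A : Type*} [CommRing A] {a b : A} {x : PowerSeries A}
    (h : IsWeierstrass a b x) (S : Subring A) (ha : a ∈ S) (hb : b ∈ S) {n : ℕ} (hn : 0 < n)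
    (hx : ∀ i < n, PowerSeries.coeff i x ∈ S) : 4 * ((n + 1) * PowerSeries.coeff n x) ∈ S := by
  have hy : ∀ i < n, PowerSeries.coeff i (2 * x - PowerSeries.X * derivative A x) ∈ S := by
    intro i hi
    rw [coeff_two_sub]
    exact mul_mem (sub_mem (ofNat_mem _ 2) (natCast_mem _ i)) (hx i hi)
  have h1 := coeff_mul_sub_mem S hn hy hy
  rw [← sq, h.ode, coeff_two_sub, coeff_two_sub, h.coeff_zero] at h1
  have h2 := coeff_pow_sub_mem S hn h.coeff_zero hx 3
  have h3 := C_mul_X_pow_mul_coeff_mem S ha (m := 4) (by norm_num) hx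
  have h4 : PowerSeries.coeff n (PowerSeries.C b * PowerSeries.X ^ 6) ∈ S := by
    rw [← mul_one (PowerSeries.X ^ 6), ← mul_assoc]
    refine C_mul_X_pow_mul_coeff_mem S hb (m := 6) (by norm_num) fun i _ ↦ ?_
    rw [PowerSeries.coeff_one]
    split_ifs <;> simp
  have h5 : PowerSeries.coeff n (4 * (x ^ 3 + PowerSeries.C a * PowerSeries.X ^ 4 * x +
      PowerSeries.C b * PowerSeries.X ^ 6)) = 4 * (PowerSeries.coeff n (x ^ 3) +
        PowerSeries.coeff n (PowerSeries.C a * PowerSeries.X ^ 4 * x) +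
        PowerSeries.coeff n (PowerSeries.C b * PowerSeries.X ^ 6)) := by
    rw [← _root_.map_ofNat PowerSeries.C 4, PowerSeries.coeff_C_mul, map_add, map_add]
  rw [h5] at h1
  convert! sub_mem h1 (mul_mem (ofNat_mem S 4) (add_mem (add_mem h2 h3) h4)) using 1
  push_cast
  ring

/-- The coefficients of a solution of the Weierstrass differential equation lie in any subring
containing the parameters in which the necessary divisions can be carried out. -/
lemma IsWeierstrass.coeff_mem {A : Type*} [CommRing A] {a b : A} {x : PowerSeries A}
    (h : IsWeierstrass a b x) (S : Subring A) (ha : a ∈ S) (hb : b ∈ S)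
    (h4 : ∀ c : A, 4 * c ∈ S → c ∈ S) {m : ℕ}
    (hS : ∀ i ≤ m, ∀ c : A, (i + 1) * c ∈ S → c ∈ S) :
    ∀ n ≤ m, PowerSeries.coeff n x ∈ S := by
  intro n
  induction n using Nat.strong_induction_on with
  | _ n ih =>
    intro hn
    rcases Nat.eq_zero_or_pos n with rfl | h0
    · rw [h.coeff_zero]; exact one_mem S
    · exact hS n hn _ (h4 _ (h.succ_mul_coeff_mem S ha hb h0 fun i hi ↦ ih i hi (by omega)))

lemma IsWeierstrass.unique {A : Type*} [CommRing A] [IsDomain A] [CharZero A] {a b : A}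
    {x y : PowerSeries A} (hx : IsWeierstrass a b x) (hy : IsWeierstrass a b y) : x = y := by
  set w : PowerSeries (A × A) :=
    PowerSeries.mk fun n ↦ (PowerSeries.coeff n x, PowerSeries.coeff n y) with hw
  have hwx : PowerSeries.map (RingHom.fst A A) w = x := by ext n; simp [hw]
  have hwy : PowerSeries.map (RingHom.snd A A) w = y := by ext n; simp [hw]
  have hext : ∀ u v : PowerSeries (A × A), PowerSeries.map (RingHom.fst A A) u =
      PowerSeries.map (RingHom.fst A A) v → PowerSeries.map (RingHom.snd A A) u =
      PowerSeries.map (RingHom.snd A A) v → u = v := by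
    intro u v h1 h2
    ext n
    · simpa using congrArg (PowerSeries.coeff n) h1
    · simpa using congrArg (PowerSeries.coeff n) h2
  have hww : IsWeierstrass (a, a) (b, b) w := by
    refine ⟨by ext <;> simp [hw, -PowerSeries.coeff_zero_eq_constantCoeff, hx.coeff_zero,
      hy.coeff_zero], hext _ _ ?_ ?_⟩
    · rw [← _root_.map_ofNat PowerSeries.C 2, ← _root_.map_ofNat PowerSeries.C 4]
      simp only [map_derivative, map_pow, map_sub, map_mul, map_add, PowerSeries.map_X,
        PowerSeries.map_C, hwx, _root_.map_ofNat]
      exact hx.ode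
    · rw [← _root_.map_ofNat PowerSeries.C 2, ← _root_.map_ofNat PowerSeries.C 4]
      simp only [map_derivative, map_pow, map_sub, map_mul, map_add, PowerSeries.map_X,
        PowerSeries.map_C, hwy, _root_.map_ofNat]
      exact hy.ode
  set S : Subring (A × A) := (RingHom.fst A A).eqLocus (RingHom.snd A A) with hS
  have hmem : ∀ c : A × A, c ∈ S ↔ c.1 = c.2 := fun c ↦ Iff.rfl
  ext n
  have := hww.coeff_mem S (by simp [hmem]) (by simp [hmem]) (fun c hc ↦ by
    rw [hmem] at hc ⊢
    have : (4 : A) * c.1 = 4 * c.2 := hc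
    exact mul_left_cancel₀ (by norm_num) this) (m := n) (fun i _ c hc ↦ by
    rw [hmem] at hc ⊢
    have : ((i : A) + 1) * c.1 = (i + 1) * c.2 := by simpa using hc
    exact mul_left_cancel₀ (Nat.cast_add_one_ne_zero i) this) n le_rfl
  simpa [hmem, hw] using this

end

section

open PowerSeries

/-- The logarithmic derivative `z x' / x` has coefficients in `S` wherever `x` does. -/
lemma coeff_logDeriv_mem {A : Type*} [CommRing A] (S : Subring A) {x l : PowerSeries A}
    (h0 : PowerSeries.coeff 0 x = 1) (hl : x * l = PowerSeries.X * derivative A x) {n : ℕ}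
    (hx : ∀ i < n, PowerSeries.coeff i x ∈ S) :
    (∀ i < n, PowerSeries.coeff i l ∈ S) ∧
      PowerSeries.coeff n l - n * PowerSeries.coeff n x ∈ S := by
  have hl0 : PowerSeries.coeff 0 l = 0 := by
    have := congrArg (PowerSeries.coeff 0) hl
    rw [PowerSeries.coeff_mul] at this
    simpa only [Finset.Nat.antidiagonal_zero, sum_singleton, h0, one_mul,
      PowerSeries.coeff_zero_X_mul] using this
  have key : ∀ i ≤ n, (∀ j < i, PowerSeries.coeff j l ∈ S) →
      PowerSeries.coeff i l - i * PowerSeries.coeff i x ∈ S := by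
    intro i hi hj
    rcases Nat.eq_zero_or_pos i with rfl | hi0
    · simp [-PowerSeries.coeff_zero_eq_constantCoeff, hl0]
    have := coeff_mul_sub_mem S hi0 (fun j hj' ↦ hx j (by omega)) hj
    rw [hl, coeff_X_mul_derivative, h0, hl0] at this
    convert! neg_mem this using 1
    ring
  have all : ∀ i < n, PowerSeries.coeff i l ∈ S := by
    intro i
    induction i using Nat.strong_induction_on with
    | _ i ih =>
      intro hi
      have := key i hi.le fun j hj ↦ ih j hj (by omega)
      simpa using add_mem this (mul_mem (natCast_mem S i) (hx i hi))
  exact ⟨all, key n le_rfl all⟩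

lemma coeff_pow_mul_two_sub_eq_zero {A : Type*} [CommRing A] [IsDomain A] [CharZero A]
    (x : PowerSeries A) {s : ℕ} :
    PowerSeries.coeff (2 * (s + 1))
      (x ^ s * (2 * x - PowerSeries.X * derivative A x)) = 0 := by
  have h1 : ((s + 1 : ℕ) : PowerSeries A) * (x ^ s * (2 * x - PowerSeries.X * derivative A x)) =
      ((2 * (s + 1) : ℕ) : PowerSeries A) * x ^ (s + 1) - PowerSeries.X *
          derivative A (x ^ (s + 1)) := by
    rw [Derivation.leibniz_pow]
    simp only [add_tsub_cancel_right, smul_eq_mul, nsmul_eq_mul]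
    push_cast
    ring
  have h2 := congrArg (PowerSeries.coeff (2 * (s + 1))) h1
  rw [map_sub, coeff_X_mul_derivative, ← _root_.map_natCast PowerSeries.C,
    ← _root_.map_natCast PowerSeries.C, PowerSeries.coeff_C_mul, PowerSeries.coeff_C_mul,
    sub_self] at h2
  exact (mul_eq_zero.1 h2).resolve_left (Nat.cast_ne_zero.2 (by omega))

lemma coeff_pow_of_derivative {A : Type*} [CommRing A] (z : PowerSeries A) (n : ℕ) :
    (n : A) * PowerSeries.coeff n (z ^ (n + 1)) =
      (n + 1) * PowerSeries.coeff n (z ^ n * (PowerSeries.X * derivative A z)) := by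
  rw [← coeff_X_mul_derivative, Derivation.leibniz_pow]
  have : PowerSeries.X * ((n + 1) • z ^ (n + 1 - 1) • (derivative A) z) =
      PowerSeries.C ((n : A) + 1) * (z ^ n * (PowerSeries.X * derivative A z)) := by
    simp only [add_tsub_cancel_right, smul_eq_mul, nsmul_eq_mul]
    push_cast [map_add]
    simp only [_root_.map_natCast, map_one]
    ring
  rw [this, PowerSeries.coeff_C_mul]

/-- The Hasse coefficient as a coefficient of `(℘'/℘)^p`. -/
lemma IsWeierstrass.coeff_pow_eq {A : Type} [CommRing A] [IsDomain A] [CharZero A] (p : ℕ)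
    [Fact p.Prime] (hp5 : 5 ≤ p) {a b : A} {x v l : PowerSeries A} (h : IsWeierstrass a b x)
    (hv : x * v = 1) (hl : x * l = PowerSeries.X * derivative A x) :
    PowerSeries.coeff (p - 1) ((2 - l) ^ p) = 2 ^ p * hasseCoeff p a b := by
  obtain ⟨m, hm⟩ : ∃ m, p = 2 * m + 1 :=
    (Fact.out : p.Prime).odd_of_ne_two (by omega)
  set y := 2 * x - PowerSeries.X * derivative A x with hy
  set W : Polynomial A := Polynomial.X ^ 3 + Polynomial.C a * Polynomial.X + Polynomial.C b with hW
  have hWdeg : (W ^ m).natDegree ≤ 3 * m := by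
    refine (natDegree_pow_le_of_le m (?_ : W.natDegree ≤ 3)).trans (by omega)
    rw [hW]; compute_degree
  have hm' : (p - 1) / 2 = m := by omega
  have h1 : y ^ (p - 1) = 2 ^ (p - 1) * ∑ n ∈ range (3 * m + 1),
      PowerSeries.C ((W ^ m).coeff n) * x ^ n * PowerSeries.X ^ (2 * (3 * m - n)) := by
    have e0 : y ^ (p - 1) = 2 ^ (p - 1) * (x ^ 3 + PowerSeries.C a * PowerSeries.X ^ 4 * x +
        PowerSeries.C b * PowerSeries.X ^ 6) ^ m := by
      rw [show p - 1 = 2 * m by omega, pow_mul, h.ode, mul_pow, pow_mul]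
      norm_num
    have hX : algebraMap (PowerSeries A) (FractionRing (PowerSeries A)) (PowerSeries.X ^ 2) ≠ 0 :=
      fun h0 ↦ pow_ne_zero 2 PowerSeries.X_ne_zero ((IsFractionRing.to_map_eq_zero_iff).1 h0)
    have e1 := homogEval_eq ((algebraMap (PowerSeries A) (FractionRing (PowerSeries A))).comp
      PowerSeries.C) hWdeg (algebraMap _ _ x) hX
    have e2 : homogEval PowerSeries.C (3 * m) (W ^ m) x (PowerSeries.X ^ 2) =
        (x ^ 3 + PowerSeries.C a * PowerSeries.X ^ 4 * x +
          PowerSeries.C b * PowerSeries.X ^ 6) ^ m := by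
      apply IsFractionRing.injective (PowerSeries A) (FractionRing (PowerSeries A))
      rw [map_homogEval, e1, eval₂_pow, pow_mul, ← mul_pow, map_pow]
      rw [hW]
      simp only [eval₂_add, eval₂_mul, eval₂_pow, Polynomial.eval₂_X, Polynomial.eval₂_C,
          RingHom.comp_apply]
      generalize algebraMap (PowerSeries A) (FractionRing (PowerSeries A)) = ι at hX ⊢
      rw [map_pow, pow_ne_zero_iff two_ne_zero] at hX
      simp only [map_add, map_mul, map_pow]
      field_simp
    rw [e0, ← e2, homogEval]
    simp only [← pow_mul]
  have h2 : (2 - l) ^ p = 2 ^ (p - 1) * ∑ n ∈ range (3 * m + 1),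
      PowerSeries.C ((W ^ m).coeff n) * (v ^ p * x ^ n * y) *
        PowerSeries.X ^ (2 * (3 * m - n)) := by
    have e1 : (2 - l) = v * y := by
      have : v * (x * (2 - l)) = v * y := by rw [mul_sub, hl, hy]; ring
      rw [← this]; linear_combination -(2 - l) * hv
    obtain ⟨k, hk⟩ : ∃ k, p = k + 1 := ⟨p - 1, by omega⟩
    rw [e1, mul_pow, hk, pow_succ y, show y ^ k = y ^ (p - 1) by rw [hk]; rfl, h1, hk]
    simp only [add_tsub_cancel_right, mul_sum, sum_mul]
    exact sum_congr rfl fun n _ ↦ by ring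
  rw [h2, show (2 : PowerSeries A) ^ (p - 1) = PowerSeries.C (2 ^ (p - 1)) by simp [map_ofNat],
    PowerSeries.coeff_C_mul, map_sum, sum_eq_single (p - 1)]
  · rw [PowerSeries.coeff_mul_X_pow', if_pos (by omega),
      show p - 1 - 2 * (3 * m - (p - 1)) = 0 by omega, PowerSeries.coeff_C_mul, hasseCoeff, hm',
      ← hW]
    have e1 : v ^ p * x ^ (p - 1) * y = v * y := by
      obtain ⟨k, hk⟩ : ∃ k, p = k + 1 := ⟨p - 1, by omega⟩
      have : x ^ k * v ^ k = 1 := by rw [← mul_pow, hv, one_pow]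
      rw [hk, add_tsub_cancel_right, pow_succ]
      linear_combination v * y * this
    have e2 : PowerSeries.coeff 0 v = 1 := by
      have := congrArg (PowerSeries.coeff 0) hv
      rw [PowerSeries.coeff_mul] at this
      simpa only [Finset.Nat.antidiagonal_zero, sum_singleton, h.coeff_zero, one_mul,
        PowerSeries.coeff_zero_one] using this
    have e3 : PowerSeries.coeff 0 (v * y) = 2 := by
      rw [PowerSeries.coeff_mul, Finset.Nat.antidiagonal_zero, sum_singleton, e2, hy, coeff_two_sub,
        h.coeff_zero]
      simp
    rw [e1, e3]
    obtain ⟨k, hk⟩ : ∃ k, p = k + 1 := ⟨p - 1, by omega⟩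
    rw [hk, add_tsub_cancel_right, pow_succ]
    ring
  · intro n hn hne
    rw [PowerSeries.coeff_mul_X_pow']
    split_ifs with hle
    · obtain ⟨s, hs⟩ : ∃ s, n = p + s := ⟨n - p, by have := Finset.mem_range.1 hn; omega⟩
      have e1 : v ^ p * x ^ n * y = x ^ s * y := by
        have : x ^ p * v ^ p = 1 := by rw [← mul_pow, hv, one_pow]
        rw [hs, pow_add]
        linear_combination x ^ s * y * this
      rw [PowerSeries.coeff_C_mul, e1,
        show p - 1 - 2 * (3 * m - n) = 2 * (s + 1) by have := Finset.mem_range.1 hn; omega,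
        hy, coeff_pow_mul_two_sub_eq_zero, mul_zero]
    · rfl
  · intro hn
    exact absurd (Finset.mem_range.2 (by omega)) hn

/-- The Hasse coefficient is, up to elements of `p S`, the coefficient of index `p - 1` of the
solution of the Weierstrass differential equation. -/
lemma IsWeierstrass.exists_hasseCoeff_eq {A : Type} [CommRing A] [IsDomain A] [CharZero A] (p : ℕ)
    [Fact p.Prime] (hp5 : 5 ≤ p) {a b : A} {x : PowerSeries A} (h : IsWeierstrass a b x)
    (S : Subring A) (ha : a ∈ S) (hb : b ∈ S)
    (hS : ∀ i : ℕ, 0 < i → i < p → ∃ u ∈ S, (i : A) * u = 1) :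
    ∃ s ∈ S, 2 * hasseCoeff p a b =
      p * s - (p - 1) * (p * PowerSeries.coeff (p - 1) x) := by
  have hdiv : ∀ i : ℕ, 0 < i → i < p → ∀ c : A, i * c ∈ S → c ∈ S := by
    intro i h0 hi c hc
    obtain ⟨u, hu, hiu⟩ := hS i h0 hi
    have : c = u * (i * c) := by linear_combination -c * hiu
    rw [this]
    exact mul_mem hu hc
  have hxS := h.coeff_mem S ha hb (fun c hc ↦ hdiv 4 (by norm_num) (by omega) c (by simpa using hc))
    (m := p - 2) (fun i hi c hc ↦ hdiv (i + 1) (by omega) (by omega) c (by simpa using hc))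
  set v := PowerSeries.invOfUnit x 1 with hv'
  have hv : x * v = 1 := PowerSeries.mul_invOfUnit x 1 (by
    rw [← PowerSeries.coeff_zero_eq_constantCoeff_apply, h.coeff_zero, Units.val_one])
  set l := v * (PowerSeries.X * derivative A x) with hl'
  have hl : x * l = PowerSeries.X * derivative A x := by
    rw [hl', ← mul_assoc, hv, one_mul]
  obtain ⟨hl1, hl2⟩ := coeff_logDeriv_mem S h.coeff_zero hl (n := p - 1)
    fun i hi ↦ hxS i (by omega)
  have h1 := h.coeff_pow_eq p hp5 hv hl
  obtain ⟨n, hn⟩ : ∃ n, p = n + 1 := ⟨p - 1, by omega⟩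
  have hn' : p - 1 = n := by omega
  rw [hn'] at hl1 hl2 h1 ⊢
  have h2 := coeff_pow_of_derivative (2 - l) n
  rw [← hn, h1] at h2
  have hz : ∀ i < n, PowerSeries.coeff i (2 - l) ∈ S := by
    intro i hi
    rw [← _root_.map_ofNat PowerSeries.C 2, map_sub, PowerSeries.coeff_C]
    refine sub_mem ?_ (hl1 i hi)
    split_ifs
    · exact ofNat_mem S 2
    · exact zero_mem S
  have h3 := coeff_mul_sub_mem S (n := n) (F := (2 - l) ^ n)
    (G := PowerSeries.X * derivative A (2 - l)) (by omega)
    (fun i hi ↦ coeff_pow_mem S (fun j hj ↦ hz j (by omega)) n) (fun i hi ↦ by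
      rw [coeff_X_mul_derivative]
      exact mul_mem (natCast_mem S i) (hz i hi))
  have hl0 : PowerSeries.coeff 0 l = 0 := by
    have := congrArg (PowerSeries.coeff 0) hl
    rw [PowerSeries.coeff_mul] at this
    simpa only [Finset.Nat.antidiagonal_zero, sum_singleton, h.coeff_zero, one_mul,
      PowerSeries.coeff_zero_X_mul] using this
  have h4 : PowerSeries.coeff 0 ((2 - l) ^ n) = 2 ^ n := by
    rw [PowerSeries.coeff_zero_eq_constantCoeff_apply, map_pow, map_sub,
      ← PowerSeries.coeff_zero_eq_constantCoeff_apply l, hl0, _root_.map_ofNat, sub_zero]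
  have h5 : PowerSeries.coeff n (2 - l) = - PowerSeries.coeff n l := by
    rw [← _root_.map_ofNat PowerSeries.C 2, map_sub, PowerSeries.coeff_C, if_neg (by omega),
      zero_sub]
  rw [coeff_X_mul_derivative, coeff_X_mul_derivative, h4, h5, Nat.cast_zero, zero_mul, mul_zero,
    add_zero] at h3
  obtain ⟨s₁, hs₁, e₁⟩ : ∃ s₁ ∈ S, s₁ = _ := ⟨_, h3, rfl⟩
  obtain ⟨s₂, hs₂, e₂⟩ : ∃ s₂ ∈ S, s₂ = _ := ⟨_, hl2, rfl⟩
  obtain ⟨u, hu, hnu⟩ := hS n (by omega) (by omega)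
  obtain ⟨w, hw, h2w⟩ := hS 2 (by norm_num) (by omega)
  refine ⟨w ^ n * u * s₁ - s₂, sub_mem (mul_mem (mul_mem (pow_mem hw n) hu) hs₁) hs₂, ?_⟩
  have hp0 : (p : A) = n + 1 := by rw [hn]; push_cast; ring
  have h2n : (2 : A) ^ n * w ^ n = 1 := by rw [← mul_pow]; norm_num at h2w; rw [h2w, one_pow]
  have hne : (n : A) * 2 ^ n ≠ 0 :=
    mul_ne_zero (Nat.cast_ne_zero.2 (by omega)) (pow_ne_zero _ two_ne_zero)
  refine mul_left_cancel₀ hne ?_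
  rw [hp0]
  rw [hn, pow_succ, ← hn] at h2
  generalize PowerSeries.coeff n ((2 - l) ^ n * (PowerSeries.X * derivative A (2 - l))) = c at *
  generalize PowerSeries.coeff n l = d at *
  generalize PowerSeries.coeff n x = t at *
  have e3 : (n : A) * 2 ^ n * (w ^ n * u * s₁) = s₁ := by
    linear_combination s₁ * (2 ^ n * w ^ n * hnu + h2n)
  linear_combination h2 - (n + 1) * e3 - (n + 1) * e₁ + (n + 1) * n * 2 ^ n * e₂

end

section

open UpperHalfPlane hiding I
open Complex Filter Function
open scoped Topology

lemma exists_hasQExp_of_hasFPowerSeriesAt {c : ℕ → ℂ} {f : ℂ → ℂ}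
    (hf : HasFPowerSeriesAt f (.ofScalars ℂ c) 0) : ∃ r : ℝ, 0 < r ∧ ∀ s : ℝ, 0 < s → s < r →
      HasQExp 1 (PowerSeries.rescale (s : ℂ) (PowerSeries.mk c))
        (fun τ ↦ f (s * Periodic.qParam 1 τ)) := by
  obtain ⟨r, hr, h⟩ := Metric.eventually_nhds_iff.1 hf.eventually_hasSum
  refine ⟨r, hr, fun s hs hsr τ ↦ ?_⟩
  have hq : ‖(s : ℂ) * Periodic.qParam 1 τ‖ < r := by
    rw [norm_mul, norm_real, Real.norm_of_nonneg hs.le]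
    have : ‖Periodic.qParam 1 (τ : ℂ)‖ < 1 := Periodic.norm_qParam_lt_one one_pos τ.2
    nlinarith [norm_nonneg (Periodic.qParam 1 (τ : ℂ))]
  have := h (y := s * Periodic.qParam 1 τ) (by simpa using hq)
  rw [zero_add] at this
  convert! this using 2 with n
  rw [FormalMultilinearSeries.ofScalars_apply_eq, PowerSeries.coeff_rescale, PowerSeries.coeff_mk,
    smul_eq_mul]
  ring

lemma hasQExp_X : HasQExp 1 PowerSeries.X (fun τ ↦ Periodic.qParam 1 τ) := by
  intro τ
  convert! hasSum_ite_eq 1 (Periodic.qParam 1 (τ : ℂ)) using 2 with n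
  rw [PowerSeries.coeff_X]
  split_ifs with hn <;> simp [hn]

lemma rescale_C {R : Type*} [CommRing R] (s a : R) :
    PowerSeries.rescale s (PowerSeries.C a) = PowerSeries.C a := by
  ext n
  rw [PowerSeries.coeff_rescale, PowerSeries.coeff_C]
  split_ifs with h <;> simp [h]

namespace PeriodPair

/-- The Laurent expansion at `0` of `z² ℘(z)`. -/
def weierstrassSeries (L : PeriodPair) : PowerSeries ℂ :=
  1 + PowerSeries.X ^ 2 * PowerSeries.mk fun i ↦ if i = 0 then 0 else (i + 1) * L.G (i + 2)

lemma two_mul_weierstrassSeries_sub (L : PeriodPair) :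
    2 * L.weierstrassSeries - PowerSeries.X * PowerSeries.derivative ℂ L.weierstrassSeries =
      2 - PowerSeries.X ^ 3 * PowerSeries.mk fun i : ℕ ↦ (i + 1) * (i + 2) * L.G (i + 3) := by
  ext n
  rw [coeff_two_sub, weierstrassSeries, map_add, PowerSeries.coeff_X_pow_mul',
    ← _root_.map_ofNat PowerSeries.C 2, map_sub, PowerSeries.coeff_X_pow_mul', PowerSeries.coeff_C,
    PowerSeries.coeff_one]
  simp only [PowerSeries.coeff_mk]
  obtain rfl | rfl | rfl | ⟨k, rfl⟩ : n = 0 ∨ n = 1 ∨ n = 2 ∨ ∃ k, n = k + 3 := by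
    rcases n with _ | _ | _ | k
    · simp
    · simp
    · simp
    · exact Or.inr (Or.inr (Or.inr ⟨k, rfl⟩))
  · simp
  · simp
  · simp
  · simp only [if_pos (show 2 ≤ k + 3 by omega), if_pos (show 3 ≤ k + 3 by omega),
      if_neg (show k + 3 ≠ 0 by omega), if_neg (show k + 3 - 2 ≠ 0 by omega)]
    rw [show k + 3 - 2 = k + 1 by omega, show k + 3 - 3 = k by omega]
    push_cast
    ring

lemma isWeierstrass (L : PeriodPair) :
    IsWeierstrass (-L.g₂ / 4) (-L.g₃ / 4) L.weierstrassSeries := by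
  refine ⟨by simp [weierstrassSeries], ?_⟩
  obtain ⟨r₁, hr₁, h₁⟩ := exists_hasQExp_of_hasFPowerSeriesAt
    (L.hasFPowerSeriesAt_weierstrassPExcept 0)
  obtain ⟨r₂, hr₂, h₂⟩ := exists_hasQExp_of_hasFPowerSeriesAt
    (L.hasFPowerSeriesAt_derivWeierstrassPExcept 0)
  obtain ⟨r₃, hr₃, h₃⟩ := Metric.mem_nhds_iff.1 (L.compl_lattice_sdiff_singleton_mem_nhds 0)
  obtain ⟨s, hs, hs'⟩ := exists_between (lt_min (lt_min hr₁ hr₂) hr₃)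
  have e₁ := h₁ s hs (hs'.trans_le ((min_le_left _ _).trans (min_le_left _ _)))
  have e₂ := h₂ s hs (hs'.trans_le ((min_le_left _ _).trans (min_le_right _ _)))
  simp only [weierstrassPExcept_zero, sumInvPow_zero] at e₁ e₂
  have hX : HasQExp 1 (PowerSeries.rescale (s : ℂ) PowerSeries.X)
      (fun τ ↦ s * Periodic.qParam 1 τ) := by
    rw [PowerSeries.rescale_X]
    exact hasQExp_X.const_mul _
  have hx : HasQExp 1 (PowerSeries.rescale (s : ℂ) L.weierstrassSeries) (fun τ ↦
      1 + (s * Periodic.qParam 1 τ) ^ 2 * L.weierstrassPExcept 0 (s * Periodic.qParam 1 τ)) := by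
    rw [weierstrassSeries, map_add, map_mul, map_pow, map_one]
    exact HasQExp.one.add ((hX.pow 2).mul e₁)
  have hy : HasQExp 1 (PowerSeries.rescale (s : ℂ) (2 * L.weierstrassSeries -
      PowerSeries.X * PowerSeries.derivative ℂ L.weierstrassSeries)) (fun τ ↦
      2 - (s * Periodic.qParam 1 τ) ^ 3 * L.derivWeierstrassPExcept 0 (s * Periodic.qParam 1 τ)) :=
          by
    rw [two_mul_weierstrassSeries_sub, ← _root_.map_ofNat PowerSeries.C 2, map_sub, map_mul,
      map_pow, rescale_C]
    exact (HasQExp.const 2).sub ((hX.pow 3).mul e₂)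
  have hinj : Function.Injective (PowerSeries.rescale (s : ℂ)) := by
    intro P Q hPQ
    ext n
    have := congrArg (PowerSeries.coeff n) hPQ
    rw [PowerSeries.coeff_rescale, PowerSeries.coeff_rescale] at this
    exact mul_left_cancel₀ (pow_ne_zero n (ofReal_ne_zero.2 hs.ne')) this
  apply hinj
  rw [map_pow]
  have key := (((hx.pow 3).add (((hX.pow 4).const_mul (-L.g₂ / 4)).mul hx)).add
    ((hX.pow 6).const_mul (-L.g₃ / 4))).const_mul 4
  rw [← _root_.map_ofNat PowerSeries.C 4]
  simp only [map_add, map_mul, map_pow, rescale_C]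
  refine (hy.pow 2).unique' one_pos key fun τ ↦ ?_
  have hw0 : (s : ℂ) * Periodic.qParam 1 τ ≠ 0 :=
    mul_ne_zero (ofReal_ne_zero.2 hs.ne') (Periodic.qParam_ne_zero _)
  have hw : (s : ℂ) * Periodic.qParam 1 τ ∉ L.lattice := by
    have : (s : ℂ) * Periodic.qParam 1 τ ∈ Metric.ball 0 r₃ := by
      rw [mem_ball_zero_iff, norm_mul, norm_real, Real.norm_of_nonneg hs.le]
      have : ‖Periodic.qParam 1 (τ : ℂ)‖ < 1 := Periodic.norm_qParam_lt_one one_pos τ.2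
      have := hs'.trans_le (min_le_right _ _)
      nlinarith [norm_nonneg (Periodic.qParam 1 (τ : ℂ))]
    have := h₃ this
    intro h
    exact this ⟨h, hw0⟩
  have d1 := L.derivWeierstrassP_sq _ hw
  have d2 := L.weierstrassPExcept_def 0 ((s : ℂ) * Periodic.qParam 1 τ)
  have d3 := L.derivWeierstrassPExcept_def 0 ((s : ℂ) * Periodic.qParam 1 τ)
  simp only [ZeroMemClass.coe_zero] at d2 d3
  simp only [Pi.pow_apply, Pi.add_apply, Pi.mul_apply]
  generalize (s : ℂ) * Periodic.qParam 1 τ = w at *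
  have d4 : 1 + w ^ 2 * L.weierstrassPExcept 0 w = w ^ 2 * L.weierstrassP w := by
    rw [d2]; field_simp; ring
  have d5 : 2 - w ^ 3 * L.derivWeierstrassPExcept 0 w = -(w ^ 3 * L.derivWeierstrassP w) := by
    rw [d3]; field_simp; ring
  rw [d4, d5]
  linear_combination w ^ 6 * d1

end PeriodPair
end

section
open UpperHalfPlane hiding I
open Complex Filter Function ModularForm EisensteinSeries
open scoped Topology Manifold MatrixGroups CongruenceSubgroup ArithmeticFunction.sigma Real Nat

/-- The periods `c τ, c`. -/
def PeriodPair.ofUpperHalfPlane (c : ℂ) (hc : c ≠ 0) (τ : ℍ) : PeriodPair where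
  ω₁ := c * τ
  ω₂ := c
  indep := by
    rw [LinearIndependent.pair_iff]
    intro s t h
    rw [real_smul, real_smul] at h
    have h' : (s : ℂ) * τ + t = 0 := by
      apply mul_left_cancel₀ hc
      linear_combination h
    have hs : s = 0 := by
      have := congrArg Complex.im h'
      simpa [τ.im_ne_zero] using this
    subst hs
    simpa using h'

lemma PeriodPair.G_ofUpperHalfPlane (c : ℂ) (hc : c ≠ 0) (τ : ℍ) (n : ℕ) :
    (PeriodPair.ofUpperHalfPlane c hc τ).G n =
      (c ^ n)⁻¹ * ∑' v : Fin 2 → ℤ, eisSummand n v τ := by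
  rw [PeriodPair.G, ← tsum_mul_left,
    ← ((PeriodPair.ofUpperHalfPlane c hc τ).latticeEquivProd.symm.toEquiv).tsum_eq,
    ← (finTwoArrowEquiv ℤ).tsum_eq]
  refine tsum_congr fun v ↦ ?_
  rw [LinearEquiv.coe_toEquiv, PeriodPair.latticeEquiv_symm_apply]
  simp only [eisSummand, PeriodPair.ofUpperHalfPlane, zpow_neg, zpow_natCast]
  rw [← mul_inv, ← mul_pow]
  change ((v 0 * (c * (τ : ℂ)) + v 1 * c) ^ n)⁻¹ = _
  ring

/-- The `q`-expansion of the lattice sums of weight `n` for the lattice `2πi (ℤτ + ℤ)`. -/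
def latticeSumSeries (n : ℕ) : PowerSeries ℂ :=
  PowerSeries.mk fun i ↦ if i = 0 then 2 * riemannZeta n / (2 * π * I) ^ n else
    2 * σ (n - 1) i / (n - 1)!

lemma hasQExp_latticeSumSeries {n : ℕ} (hn : 3 ≤ n) (hn2 : Even n) :
    HasQExp 1 (latticeSumSeries n) (fun τ ↦
      (PeriodPair.ofUpperHalfPlane (2 * π * I) two_pi_I_ne_zero τ).G n) := by
  intro τ
  have hS : Summable fun m : ℕ ↦ (σ (n - 1) (m + 1) : ℂ) * cexp (2 * π * I * τ) ^ (m + 1) :=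
    (summable_nat_add_iff 1).mpr (summable_sigma_mul_cexp_pow (by omega) τ)
  rw [← hasSum_nat_add_iff' 1]
  have hc : (2 * π * I : ℂ) ^ n ≠ 0 := pow_ne_zero _ two_pi_I_ne_zero
  convert! (hS.mul_left (2 / (n - 1)! : ℂ)).hasSum using 1
  · funext m
    simp only [latticeSumSeries, PowerSeries.coeff_mk, Nat.add_eq_zero_iff, one_ne_zero, and_false,
      ↓reduceIte, Periodic.qParam, ofReal_one, div_one]
    ring
  · beta_reduce
    rw [tsum_mul_left, PeriodPair.G_ofUpperHalfPlane,
      tsum_eisSummand_eq_tsum_sigma_mul_cexp_pow hn hn2,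
      tsum_pnat_eq_tsum_succ (f := fun m ↦ (σ (n - 1) m : ℂ) * cexp (2 * π * I * τ) ^ m),
      show (-2 * π * I : ℂ) ^ n = (2 * π * I) ^ n by rw [← hn2.neg_pow]; ring]
    simp only [Finset.range_one, Finset.sum_singleton, latticeSumSeries, PowerSeries.coeff_mk,
      ↓reduceIte, pow_zero]
    field_simp
    ring

lemma PeriodPair.G_four_ofUpperHalfPlane (τ : ℍ) :
    (PeriodPair.ofUpperHalfPlane (2 * π * I) two_pi_I_ne_zero τ).G 4 = E₄ τ / 720 := by
  have hE : E₄ τ = 1 / 2 * eisensteinSeries (N := 1) 0 (4 : ℕ) τ := rfl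
  rw [PeriodPair.G_ofUpperHalfPlane, tsum_eisSummand_eq_riemannZeta_mul_eisensteinSeries
    (by norm_num), hE]
  push_cast
  rw [riemannZeta_four]
  have : (π : ℂ) ≠ 0 := by exact_mod_cast Real.pi_ne_zero
  rw [mul_pow, mul_pow, I_pow_four]
  field_simp
  ring

lemma PeriodPair.G_six_ofUpperHalfPlane (τ : ℍ) :
    (PeriodPair.ofUpperHalfPlane (2 * π * I) two_pi_I_ne_zero τ).G 6 = -E₆ τ / 30240 := by
  have hE : E₆ τ = 1 / 2 * eisensteinSeries (N := 1) 0 (6 : ℕ) τ := rfl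
  rw [PeriodPair.G_ofUpperHalfPlane, tsum_eisSummand_eq_riemannZeta_mul_eisensteinSeries
    (by norm_num), hE]
  have h6 := riemannZeta_two_mul_nat (k := 3) (by norm_num)
  norm_num [show _root_.bernoulli 6 = 1 / 42 by decide +kernel, Nat.factorial] at h6
  have : (π : ℂ) ≠ 0 := by exact_mod_cast Real.pi_ne_zero
  have hI : I ^ 6 = -1 := by rw [show I ^ 6 = (I ^ 2) ^ 3 by ring, I_sq]; norm_num
  push_cast
  rw [h6, mul_pow, mul_pow, hI]
  field_simp
  ring

end

section
open UpperHalfPlane hiding I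
open Complex Filter Function ModularForm EisensteinSeries
open scoped Topology Manifold MatrixGroups CongruenceSubgroup ArithmeticFunction.sigma Real Nat

/-- `F` is a family of power series whose coefficients have the coefficients of `P` as
`q`-expansions. -/
def HasCoeffQExp (P : PowerSeries (PowerSeries ℂ)) (F : ℍ → PowerSeries ℂ) : Prop :=
  ∀ n, HasQExp 1 (PowerSeries.coeff n P) (fun τ ↦ PowerSeries.coeff n (F τ))

namespace HasCoeffQExp

variable {P Q : PowerSeries (PowerSeries ℂ)} {F G : ℍ → PowerSeries ℂ}

lemma add (hP : HasCoeffQExp P F) (hQ : HasCoeffQExp Q G) : HasCoeffQExp (P + Q) (F + G) := by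
  intro n
  rw [map_add]
  exact ((hP n).add (hQ n)).congr fun τ ↦ by simp

lemma mul (hP : HasCoeffQExp P F) (hQ : HasCoeffQExp Q G) : HasCoeffQExp (P * Q) (F * G) := by
  intro n
  simp only [PowerSeries.coeff_mul, Pi.mul_apply]
  exact HasQExp.sum fun i _ ↦ (hP i.1).mul (hQ i.2)

lemma const {p : PowerSeries ℂ} {f : ℍ → ℂ} (h : HasQExp 1 p f) :
    HasCoeffQExp (PowerSeries.C p) (fun τ ↦ PowerSeries.C (f τ)) := by
  intro n
  simp only [PowerSeries.coeff_C]
  split_ifs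
  · exact h
  · exact HasQExp.zero

lemma one : HasCoeffQExp 1 1 := by
  simpa using! const HasQExp.one

lemma X : HasCoeffQExp PowerSeries.X (fun _ ↦ PowerSeries.X) := by
  intro n
  simp only [PowerSeries.coeff_X]
  split_ifs
  · exact HasQExp.one
  · exact HasQExp.zero

lemma pow (hP : HasCoeffQExp P F) (k : ℕ) : HasCoeffQExp (P ^ k) (F ^ k) := by
  induction k with
  | zero => simpa using one
  | succ k ih => rw [pow_succ, pow_succ]; exact ih.mul hP

lemma two_sub (hP : HasCoeffQExp P F) :
    HasCoeffQExp (2 * P - PowerSeries.X * PowerSeries.derivative _ P)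
      (fun τ ↦ 2 * F τ - PowerSeries.X * PowerSeries.derivative _ (F τ)) := by
  intro n
  simp only [coeff_two_sub]
  have h := (hP n).const_mul (2 - n)
  rwa [map_sub, _root_.map_ofNat, _root_.map_natCast] at h

lemma unique (hP : HasCoeffQExp P F) (hQ : HasCoeffQExp Q G) (h : ∀ τ, F τ = G τ) : P = Q := by
  ext1 n
  exact (hP n).unique' one_pos (hQ n) fun τ ↦ by rw [h]

end HasCoeffQExp

/-- The expansion in `z` and `q` of `z² ℘(z)` for the lattice `2πi (ℤτ + ℤ)`. -/
def qWeierstrassSeries : PowerSeries (PowerSeries ℂ) :=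
  PowerSeries.mk fun n ↦ if n = 0 then 1 else if n < 3 ∨ Odd n then 0 else
    PowerSeries.C (n - 1 : ℂ) * latticeSumSeries n

lemma PeriodPair.coeff_weierstrassSeries (L : PeriodPair) (n : ℕ) :
    PowerSeries.coeff n L.weierstrassSeries =
      if n = 0 then 1 else if n < 3 ∨ Odd n then 0 else (n - 1) * L.G n := by
  rw [weierstrassSeries, map_add, PowerSeries.coeff_X_pow_mul', PowerSeries.coeff_one]
  simp only [PowerSeries.coeff_mk]
  rcases n with _ | _ | _ | k
  · simp
  · simp
  · simp
  · rw [if_neg (by omega), if_pos (by omega), if_neg (by omega), if_neg (by omega),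
      show k + 1 + 1 + 1 - 2 + 2 = k + 3 by omega, show k + 1 + 1 + 1 - 2 = k + 1 by omega,
          zero_add]
    split_ifs with h
    · rw [L.G_eq_zero_of_odd _ (h.resolve_left (by omega)), mul_zero]
    · push_cast; ring

lemma hasCoeffQExp_qWeierstrassSeries : HasCoeffQExp qWeierstrassSeries
    (fun τ ↦ (PeriodPair.ofUpperHalfPlane (2 * π * I) two_pi_I_ne_zero τ).weierstrassSeries) := by
  intro n
  simp only [PeriodPair.coeff_weierstrassSeries, qWeierstrassSeries, PowerSeries.coeff_mk]
  split_ifs with h1 h2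
  · exact HasQExp.one
  · exact HasQExp.zero
  · push Not at h2
    exact (hasQExp_latticeSumSeries h2.1 (Nat.not_odd_iff_even.1 h2.2)).const_mul _

lemma PeriodPair.isWeierstrass_ofUpperHalfPlane (τ : ℍ) :
    IsWeierstrass (-1 / 48 * E₄ τ) (1 / 864 * E₆ τ)
      (PeriodPair.ofUpperHalfPlane (2 * π * I) two_pi_I_ne_zero τ).weierstrassSeries := by
  convert! PeriodPair.isWeierstrass _ using 1
  · rw [PeriodPair.g₂, PeriodPair.G_four_ofUpperHalfPlane]; ring
  · rw [PeriodPair.g₃, PeriodPair.G_six_ofUpperHalfPlane]; ring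

lemma isWeierstrass_qWeierstrassSeries :
    IsWeierstrass (PowerSeries.C (-1 / 48) * eisenstein4 ℂ) (PowerSeries.C (1 / 864) *
        eisenstein6 ℂ)
      qWeierstrassSeries := by
  refine ⟨by simp [qWeierstrassSeries, -PowerSeries.coeff_zero_eq_constantCoeff], ?_⟩
  have h := hasCoeffQExp_qWeierstrassSeries
  have h4 := HasCoeffQExp.const (isLevelOne_E₄.hasQExp.const_mul (-1 / 48))
  have h6 := HasCoeffQExp.const (isLevelOne_E₆.hasQExp.const_mul (1 / 864))
  have key := (HasCoeffQExp.const (HasQExp.const 4)).mul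
    (((h.pow 3).add ((h4.mul (HasCoeffQExp.X.pow 4)).mul h)).add (h6.mul (HasCoeffQExp.X.pow 6)))
  rw [_root_.map_ofNat, _root_.map_ofNat] at key
  refine (h.two_sub.pow 2).unique key fun τ ↦ ?_
  have := (PeriodPair.isWeierstrass_ofUpperHalfPlane τ).ode
  rw [← _root_.map_ofNat PowerSeries.C 4] at this
  exact this

end

section

open IsLocalRing

lemma ValuationSubring.isUnit_natCast {O : ValuationSubring ℂ} {p : ℕ} (hp : p.Prime)
    (h : (p : O) ∈ maximalIdeal O) {n : ℕ} (hn : ¬ p ∣ n) : IsUnit (n : O) := by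
  have := ValuationSubring.charP_residueField hp h
  rw [← residue_ne_zero_iff_isUnit, _root_.map_natCast, Ne, CharP.cast_eq_zero_iff _ p]
  exact hn

lemma ValuationSubring.exists_natCast_mul_eq_one {O : ValuationSubring ℂ} {p : ℕ} (hp : p.Prime)
    (h : (p : O) ∈ maximalIdeal O) {n : ℕ} (hn : ¬ p ∣ n) : ∃ u : O, (n : O) * u = 1 :=
  (ValuationSubring.isUnit_natCast hp h hn).exists_right_inv

lemma not_dvd_48 {p : ℕ} (hp : p.Prime) (hp5 : 5 ≤ p) : ¬ p ∣ 48 := by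
  intro h
  rw [show 48 = 2 ^ 4 * 3 by norm_num, hp.dvd_mul] at h
  rcases h with h | h
  · have := Nat.le_of_dvd (by norm_num) (hp.dvd_of_dvd_pow h); omega
  · have := Nat.le_of_dvd (by norm_num) h; omega

lemma not_dvd_864 {p : ℕ} (hp : p.Prime) (hp5 : 5 ≤ p) : ¬ p ∣ 864 := by
  intro h
  rw [show 864 = 2 ^ 5 * 3 ^ 3 by norm_num, hp.dvd_mul] at h
  rcases h with h | h
  · have := Nat.le_of_dvd (by norm_num) (hp.dvd_of_dvd_pow h); omega
  · have := Nat.le_of_dvd (by norm_num) (hp.dvd_of_dvd_pow h); omega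

lemma not_dvd_1728 {p : ℕ} (hp : p.Prime) (hp5 : 5 ≤ p) : ¬ p ∣ 1728 := by
  intro h
  rw [show 1728 = 2 * 864 by norm_num, hp.dvd_mul] at h
  rcases h with h | h
  · have := Nat.le_of_dvd (by norm_num) h; omega
  · exact not_dvd_864 hp hp5 h

lemma residue_eq_zero_of_coe_eq {O : ValuationSubring ℂ} {p : ℕ}
    (h : (p : O) ∈ maximalIdeal O) {x y : O} (hx : (x : ℂ) = p * y) : residue O x = 0 := by
  have hx' : x = p * y := Subtype.ext (by simpa using! hx)
  rw [hx', map_mul, (residue_eq_zero_iff _).2 h, zero_mul]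

/-- The Hasse invariant of the Tate curve is `1`. -/
lemma hasseCoeff_eisenstein {O : ValuationSubring ℂ} {p : ℕ} [Fact p.Prime] (hp5 : 5 ≤ p)
    (h : (p : O) ∈ maximalIdeal O) :
    hasseCoeff p (PowerSeries.C (-(48 : ResidueField O)⁻¹) * eisenstein4 (ResidueField O))
      (PowerSeries.C (864 : ResidueField O)⁻¹ * eisenstein6 (ResidueField O)) = 1 := by
  have hp : p.Prime := Fact.out
  have hch := ValuationSubring.charP_residueField hp h
  obtain ⟨v, hv⟩ := ValuationSubring.exists_natCast_mul_eq_one hp h (not_dvd_48 hp hp5)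
  obtain ⟨w, hw⟩ := ValuationSubring.exists_natCast_mul_eq_one hp h (not_dvd_864 hp hp5)
  set a₀ : PowerSeries O := PowerSeries.C (-v) * eisenstein4 O
  set b₀ : PowerSeries O := PowerSeries.C w * eisenstein6 O
  have hvk : residue O v = (48 : ResidueField O)⁻¹ := by
    have := congrArg (residue O) hv
    rw [map_mul, _root_.map_natCast, map_one] at this
    exact eq_inv_of_mul_eq_one_right this
  have hwk : residue O w = (864 : ResidueField O)⁻¹ := by
    have := congrArg (residue O) hw
    rw [map_mul, _root_.map_natCast, map_one] at this
    exact eq_inv_of_mul_eq_one_right this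
  have hvc : (v : ℂ) = 1 / 48 := by
    have := congrArg (Subtype.val) hv
    push_cast at this
    rw [eq_div_iff (by norm_num), mul_comm]; exact this
  have hwc : (w : ℂ) = 1 / 864 := by
    have := congrArg (Subtype.val) hw
    push_cast at this
    rw [eq_div_iff (by norm_num), mul_comm]; exact this
  have ha : PowerSeries.map O.subtype a₀ = PowerSeries.C (-1 / 48) * eisenstein4 ℂ := by
    rw [map_mul, PowerSeries.map_C, map_eisenstein4, map_neg, show O.subtype v = v from rfl, hvc]
    norm_num
  have hb : PowerSeries.map O.subtype b₀ = PowerSeries.C (1 / 864) * eisenstein6 ℂ := by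
    rw [map_mul, PowerSeries.map_C, map_eisenstein6, show O.subtype w = w from rfl, hwc]
  have ha' : PowerSeries.map (residue O) a₀ =
      PowerSeries.C (-(48 : ResidueField O)⁻¹) * eisenstein4 (ResidueField O) := by
    rw [map_mul, PowerSeries.map_C, map_eisenstein4, map_neg, hvk]
  have hb' : PowerSeries.map (residue O) b₀ =
      PowerSeries.C (864 : ResidueField O)⁻¹ * eisenstein6 (ResidueField O) := by
    rw [map_mul, PowerSeries.map_C, map_eisenstein6, hwk]
  have : CharZero (PowerSeries ℂ) :=
    charZero_of_injective_ringHom (f := PowerSeries.C) PowerSeries.C_injective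
  obtain ⟨s, ⟨s₀, rfl⟩, hs⟩ := isWeierstrass_qWeierstrassSeries.exists_hasseCoeff_eq p hp5
    (PowerSeries.map O.subtype).range ⟨a₀, ha⟩ ⟨b₀, hb⟩ (by
      intro i hi0 hip
      obtain ⟨u, hu⟩ := ValuationSubring.exists_natCast_mul_eq_one hp h
        (Nat.not_dvd_of_pos_of_lt hi0 hip)
      refine ⟨_, ⟨PowerSeries.C u, rfl⟩, ?_⟩
      rw [PowerSeries.map_C, ← _root_.map_natCast PowerSeries.C, ← map_mul]
      have := congrArg (Subtype.val) hu
      push_cast at this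
      rw [show (i : ℂ) * O.subtype u = 1 from this, map_one])
  rw [← ha, ← hb, ← map_hasseCoeff] at hs
  rw [← ha', ← hb', ← map_hasseCoeff]
  have hpe : ¬ (p - 1 < 3 ∨ Odd (p - 1)) := by
    rcases hp.eq_two_or_odd with h | h
    · omega
    · rw [Nat.odd_iff]; omega
  have h2 : (2 : ResidueField O) ≠ 0 := by
    have : ((2 : ℕ) : ResidueField O) ≠ 0 := by
      rw [Ne, CharP.cast_eq_zero_iff _ p]; intro h; have := Nat.le_of_dvd (by norm_num) h; omega
    exact_mod_cast this
  ext i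
  rcases Nat.eq_zero_or_pos i with rfl | hi
  · have := hasseCoeff_cusp p hp5
    have h3 := congrArg (ZMod.castHom (dvd_refl p) (ResidueField O)) this
    rw [map_hasseCoeff, map_neg, map_inv₀, map_inv₀, _root_.map_ofNat, _root_.map_ofNat] at h3
    rw [PowerSeries.coeff_zero_eq_constantCoeff, map_hasseCoeff, map_hasseCoeff, ha', hb', map_one]
    rw [map_one] at h3
    rw [← h3]
    congr 1
    · simp [← PowerSeries.coeff_zero_eq_constantCoeff, coeff_zero_eisenstein4]
    · simp [← PowerSeries.coeff_zero_eq_constantCoeff, coeff_zero_eisenstein6]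
  · rw [PowerSeries.coeff_one, if_neg hi.ne', PowerSeries.coeff_map]
    have h4 := congrArg (PowerSeries.coeff i) hs
    obtain ⟨u, hu⟩ := ValuationSubring.exists_natCast_mul_eq_one hp h (n := (p - 1 - 1).factorial)
      (by rw [hp.dvd_factorial]; omega)
    have huc : (u : ℂ) = 1 / ((p - 1 - 1).factorial : ℂ) := by
      have h5 := congrArg (Subtype.val) hu
      push_cast at h5
      rw [eq_div_iff (by exact_mod_cast Nat.factorial_ne_zero _), mul_comm]; exact h5
    rw [← _root_.map_ofNat PowerSeries.C 2, ← _root_.map_natCast PowerSeries.C,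
        ← map_one PowerSeries.C,
      ← map_sub PowerSeries.C, map_sub (PowerSeries.coeff i), PowerSeries.coeff_C_mul,
      PowerSeries.coeff_C_mul, PowerSeries.coeff_C_mul, PowerSeries.coeff_C_mul, qWeierstrassSeries,
      PowerSeries.coeff_mk, if_neg (by omega), if_neg hpe, PowerSeries.coeff_C_mul,
          latticeSumSeries,
      PowerSeries.coeff_mk, if_neg hi.ne', PowerSeries.coeff_map, PowerSeries.coeff_map] at h4
    have h6 := residue_eq_zero_of_coe_eq h (x := 2 * PowerSeries.coeff i (hasseCoeff p a₀ b₀))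
      (y := PowerSeries.coeff i s₀ - (p - 1) * (((p - 1 : ℕ) - 1) *
        (2 * ArithmeticFunction.sigma (p - 1 - 1) i * u))) (by
          push_cast
          rw [huc]
          refine Eq.trans h4 ?_
          change (p : ℂ) * (PowerSeries.coeff i s₀ : O) - _ = _
          rw [show ((2 : O) : ℂ) = 2 from rfl]
          ring)
    rw [map_mul, _root_.map_ofNat] at h6
    exact (mul_eq_zero.1 h6).resolve_left h2

end

section

open IsLocalRing

lemma exists_hasse_poly_residueField {O : ValuationSubring ℂ} {p : ℕ} [Fact p.Prime] (hp5 : 5 ≤ p)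
    (h : (p : O) ∈ maximalIdeal O) (φ : ZMod p →+* ResidueField O) :
    ∃ H : (ZMod p)[X],
      (∀ a b : ZMod p, 4 * a ^ 3 + 27 * b ^ 2 ≠ 0 →
        (frobTrace p a b : ZMod p) ^ 12 = H.eval (6912 * a ^ 3 / (4 * a ^ 3 + 27 * b ^ 2))) ∧
      ∀ u : ResidueField O, 1728 * u = 1 →
        algebraMap _ (FractionRing (PowerSeries (ResidueField O))) (discSeries u) ^ (p - 1) *
          (H.map φ).eval₂ ((algebraMap _ (FractionRing (PowerSeries (ResidueField O)))).comp
            PowerSeries.C)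
            (algebraMap _ (FractionRing (PowerSeries (ResidueField O)))
                (eisenstein4 (ResidueField O) ^ 3) /
              algebraMap _ (FractionRing (PowerSeries (ResidueField O))) (discSeries u)) = 1 := by
  have hp : p.Prime := Fact.out
  have hch := ValuationSubring.charP_residueField hp h
  obtain ⟨H, hH⟩ := exists_hasse_poly p hp5
  refine ⟨H, fun a b hab ↦ ?_, fun u hu ↦ ?_⟩
  · rw [frobTrace_eq_hasseCoeff p hp5, hH (ZMod p) a b hab, ZMod.pow_card_sub_one_eq_one hab,
        one_mul,
      Polynomial.coe_aeval_eq_eval]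
  set ι := algebraMap (PowerSeries (ResidueField O)) (FractionRing (PowerSeries (ResidueField O)))
  have hι : Function.Injective ι := IsFractionRing.injective _ _
  let _ : Algebra (ZMod p) (FractionRing (PowerSeries (ResidueField O))) :=
    ((ι.comp PowerSeries.C).comp φ).toAlgebra
  have nz : ∀ n : ℕ, ¬ p ∣ n → (n : ResidueField O) ≠ 0 := by
    intro n hn
    rwa [Ne, CharP.cast_eq_zero_iff _ p]
  have h48 := nz 48 (not_dvd_48 hp hp5)
  have h864 := nz 864 (not_dvd_864 hp hp5)
  have h4 := nz 4 fun hd ↦ by have := Nat.le_of_dvd (by norm_num) hd; omega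
  push_cast at h48 h864 h4
  have h16 : (16 : ResidueField O) ≠ 0 := by
    rw [show (16 : ResidueField O) = 4 ^ 2 by norm_num]; exact pow_ne_zero _ h4
  have hΔ : ι (discSeries u) ≠ 0 := (map_ne_zero_iff ι hι).2 (discSeries_ne_zero hu)
  have key : 4 * (PowerSeries.C (-(48 : ResidueField O)⁻¹) * eisenstein4 (ResidueField O)) ^ 3 +
      27 * (PowerSeries.C (864 : ResidueField O)⁻¹ * eisenstein6 (ResidueField O)) ^ 2 =
      PowerSeries.C (-(16 : ResidueField O)⁻¹) * discSeries u := by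
    have hu' : u = 1728⁻¹ := eq_inv_of_mul_eq_one_right hu
    have h1728 : (1728 : ResidueField O) ≠ 0 := left_ne_zero_of_mul_eq_one hu
    have e1 : 4 * (-(48 : ResidueField O)⁻¹) ^ 3 = -(16 : ResidueField O)⁻¹ * u := by
      rw [hu']; field_simp; norm_num
    have e2 : 27 * ((864 : ResidueField O)⁻¹) ^ 2 = (16 : ResidueField O)⁻¹ * u := by
      rw [hu']; field_simp; norm_num
    have e1' := congrArg PowerSeries.C e1
    have e2' := congrArg PowerSeries.C e2
    rw [map_mul, map_mul, _root_.map_ofNat, map_pow, map_neg, map_neg] at e1'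
    rw [map_mul, map_mul, _root_.map_ofNat, map_pow] at e2'
    rw [discSeries, map_neg, map_neg]
    linear_combination eisenstein4 (ResidueField O) ^ 3 * e1' +
      eisenstein6 (ResidueField O) ^ 2 * e2'
  have key2 : 6912 * (PowerSeries.C (-(48 : ResidueField O)⁻¹) * eisenstein4 (ResidueField O)) ^ 3 =
      PowerSeries.C (-(16 : ResidueField O)⁻¹) * eisenstein4 (ResidueField O) ^ 3 := by
    have e1 : 6912 * (-(48 : ResidueField O)⁻¹) ^ 3 = -(16 : ResidueField O)⁻¹ := by
      field_simp; norm_num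
    have e1' := congrArg PowerSeries.C e1
    rw [map_mul, _root_.map_ofNat, map_pow] at e1'
    linear_combination eisenstein4 (ResidueField O) ^ 3 * e1'
  have hC : ι (PowerSeries.C (-(16 : ResidueField O)⁻¹)) ≠ 0 := by
    rw [map_ne_zero_iff ι hι, map_ne_zero_iff _ PowerSeries.C_injective]
    exact neg_ne_zero.2 (inv_ne_zero h16)
  have hHasse := congrArg (fun x ↦ ι x ^ 12) (hasseCoeff_eisenstein hp5 h)
  have key' := congrArg ι key
  have key2' := congrArg ι key2
  simp only [map_add, map_mul ι, map_pow ι, _root_.map_ofNat ι] at key' key2'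
  have hfin := hH (FractionRing (PowerSeries (ResidueField O)))
    (ι (PowerSeries.C (-(48 : ResidueField O)⁻¹) * eisenstein4 (ResidueField O)))
    (ι (PowerSeries.C (864 : ResidueField O)⁻¹ * eisenstein6 (ResidueField O))) (by
      rw [map_mul ι, map_mul ι, key']
      exact mul_ne_zero hC hΔ)
  rw [← map_hasseCoeff, hHasse, map_mul ι, map_mul ι, key', key2', map_one, one_pow,
    mul_div_mul_left _ _ hC, mul_pow, Polynomial.aeval_def] at hfin
  have h16p : ι (PowerSeries.C (-(16 : ResidueField O)⁻¹)) ^ (p - 1) = 1 := by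
    have : φ (-(16 : ZMod p)⁻¹) = -(16 : ResidueField O)⁻¹ := by
      rw [map_neg, map_inv₀, _root_.map_ofNat]
    rw [← map_pow, ← map_pow, ← this, ← map_pow, ZMod.pow_card_sub_one_eq_one, map_one, map_one,
      map_one]
    intro h0
    rw [h0, map_zero] at this
    exact neg_ne_zero.2 (inv_ne_zero h16) this.symm
  rw [h16p, one_mul] at hfin
  rw [Polynomial.eval₂_map, map_pow]
  exact hfin.symm

end

section
open UpperHalfPlane hiding I
open Complex Filter Function ModularForm EisensteinSeries
open scoped Topology Manifold MatrixGroups CongruenceSubgroup Real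

namespace PeriodPair

lemma lattice_le_of_G_eq {L L' : PeriodPair} (h : ∀ n, 3 ≤ n → L.G n = L'.G n) :
    L.lattice ≤ L'.lattice := by
  have h1 : ∀ᶠ z in 𝓝 (0 : ℂ), L.weierstrassPExcept 0 z = L'.weierstrassPExcept 0 z := by
    have e1 := (L.hasFPowerSeriesAt_weierstrassPExcept 0).eventually_hasSum
    have e2 := (L'.hasFPowerSeriesAt_weierstrassPExcept 0).eventually_hasSum
    simp only [weierstrassPExcept_zero, sumInvPow_zero] at e1 e2
    filter_upwards [e1, e2] with z h1 h2
    rw [zero_add] at h1 h2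
    refine h1.unique ?_
    convert! h2 using 4 with n
    · ext n
      split_ifs with hn
      · rfl
      · rw [h _ (by omega)]
  have h2 : ∀ᶠ z in 𝓝[≠] (0 : ℂ), (L.weierstrassP - L'.weierstrassP) z = 0 := by
    filter_upwards [h1.filter_mono nhdsWithin_le_nhds] with z hz
    have d1 := L.weierstrassPExcept_def 0 z
    have d2 := L'.weierstrassPExcept_def 0 z
    simp only [ZeroMemClass.coe_zero] at d1 d2
    rw [Pi.sub_apply]
    linear_combination hz - d1 + d2
  have hm : Meromorphic (L.weierstrassP - L'.weierstrassP) :=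
    L.meromorphic_weierstrassP.sub L'.meromorphic_weierstrassP
  have h3 : ∀ z, meromorphicOrderAt (L.weierstrassP - L'.weierstrassP) z = ⊤ := by
    intro z
    by_contra hz
    exact hm.exists_meromorphicOrderAt_ne_top_iff_forall.1 ⟨z, hz⟩ 0
      (meromorphicOrderAt_eq_top_iff.2 h2)
  intro l hl
  by_contra hl'
  have h4 : L.weierstrassP =ᶠ[𝓝[≠] l] L'.weierstrassP := by
    filter_upwards [meromorphicOrderAt_eq_top_iff.1 (h3 l)] with z hz
    exact sub_eq_zero.1 hz
  have h5 := meromorphicOrderAt_congr h4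
  rw [L.order_weierstrassP l hl] at h5
  have h6 := (L'.analyticOnNhd_weierstrassP l hl').meromorphicOrderAt_nonneg
  rw [← h5] at h6
  exact absurd h6 (by decide)

lemma lattice_eq_of_g_eq {L L' : PeriodPair} (h₂ : L.g₂ = L'.g₂) (h₃ : L.g₃ = L'.g₃) :
    L.lattice = L'.lattice := by
  have h := L.isWeierstrass
  rw [h₂, h₃] at h
  have key : ∀ n, 3 ≤ n → L.G n = L'.G n := by
    intro n hn
    have := congrArg (PowerSeries.coeff n) (h.unique L'.isWeierstrass)
    rw [coeff_weierstrassSeries, coeff_weierstrassSeries, if_neg (by omega : ¬ n = 0),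
        if_neg (by omega : ¬ n = 0)] at this
    by_cases ho : Odd n
    · rw [G_eq_zero_of_odd _ _ ho, G_eq_zero_of_odd _ _ ho]
    · have hno : ¬ (n < 3 ∨ Odd n) := not_or.2 ⟨by omega, ho⟩
      rw [if_neg hno, if_neg hno] at this
      refine mul_left_cancel₀ ?_ this
      have : (n : ℂ) ≠ 1 := by norm_cast; omega
      exact sub_ne_zero.2 this
  exact le_antisymm (lattice_le_of_G_eq key) (lattice_le_of_G_eq fun n hn ↦ (key n hn).symm)

end PeriodPair

lemma exists_scaling_of_modularJ_eq {τ τ' : ℍ} (h : modularJ τ = modularJ τ') :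
    ∃ l : ℂ, l ≠ 0 ∧ E₄ τ' = l ^ 4 * E₄ τ ∧ E₆ τ' = l ^ 6 * E₆ τ := by
  have hD : ∀ τ : ℍ, ModularForm.discriminant τ = 1 / 1728 * (E₄ τ ^ 3 - E₆ τ ^ 2) := fun τ ↦
    (isLevelOne_discriminant (u := 1 / 1728) (by norm_num)).hasQExp.apply_eq
      (((isLevelOne_E₄.hasQExp.pow 3).sub (isLevelOne_E₆.hasQExp.pow 2)).const_mul (1 / 1728)) τ
  have h0 := ModularForm.discriminant_ne_zero τ
  have h0' := ModularForm.discriminant_ne_zero τ'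
  obtain ⟨l, hl⟩ := IsAlgClosed.exists_pow_nat_eq
    (ModularForm.discriminant τ' / ModularForm.discriminant τ) (n := 12) (by norm_num)
  have hl0 : l ≠ 0 := by
    rintro rfl
    rw [zero_pow (by norm_num)] at hl
    exact div_ne_zero h0' h0 hl.symm
  have hl' : ModularForm.discriminant τ' = l ^ 12 * ModularForm.discriminant τ := by
    rw [hl]; field_simp
  have h43 : E₄ τ' ^ 3 = (l ^ 4 * E₄ τ) ^ 3 := by
    rw [modularJ, modularJ, div_eq_div_iff h0 h0', hl'] at h
    apply mul_right_cancel₀ h0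
    linear_combination -h
  obtain ⟨m, hm0, hm12, hm4⟩ : ∃ m : ℂ, m ≠ 0 ∧ m ^ 12 = l ^ 12 ∧ E₄ τ' = m ^ 4 * E₄ τ := by
    rcases eq_or_ne (E₄ τ) 0 with h4 | h4
    · refine ⟨l, hl0, rfl, ?_⟩
      rw [h4, mul_zero] at h43 ⊢
      simpa using h43
    · set z := E₄ τ' / (l ^ 4 * E₄ τ) with hz
      have hne : l ^ 4 * E₄ τ ≠ 0 := mul_ne_zero (pow_ne_zero _ hl0) h4
      have hz3 : z ^ 3 = 1 := by rw [hz, div_pow, h43, div_self (pow_ne_zero _ hne)]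
      refine ⟨l * z, mul_ne_zero hl0 ?_, ?_, ?_⟩
      · intro h; rw [h] at hz3; norm_num at hz3
      · rw [mul_pow, show z ^ 12 = (z ^ 3) ^ 4 by ring, hz3]; ring
      · rw [mul_pow, show z ^ 4 = z ^ 3 * z by ring, hz3, hz]
        field_simp
  have h62 : E₆ τ' ^ 2 = (m ^ 6 * E₆ τ) ^ 2 := by
    rw [← hm12, hD, hD, hm4] at hl'
    linear_combination -1728 * hl'
  rcases sq_eq_sq_iff_eq_or_eq_neg.1 h62 with h6 | h6
  · exact ⟨m, hm0, hm4, h6⟩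
  · refine ⟨m * I, mul_ne_zero hm0 I_ne_zero, ?_, ?_⟩
    · rw [mul_pow, I_pow_four, mul_one, hm4]
    · rw [mul_pow, show I ^ 6 = -1 by rw [show I ^ 6 = (I ^ 2) ^ 3 by ring, I_sq]; norm_num, h6]
      ring

lemma int_eq_of_mul_coe_add_eq {τ : ℍ} {a b c d : ℤ}
    (h : (a : ℂ) * τ + b = c * τ + d) : a = c ∧ b = d := by
  have h1 : a = c := by
    have := congrArg Complex.im h
    simp only [add_im, mul_im, intCast_re, intCast_im, zero_mul, add_zero] at this
    exact_mod_cast mul_right_cancel₀ τ.im_ne_zero this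
  subst h1
  exact ⟨rfl, by exact_mod_cast add_left_cancel h⟩

lemma exists_smul_eq_of_modularJ_eq {τ τ' : ℍ} (h : modularJ τ = modularJ τ') :
    ∃ γ : SL(2, ℤ), γ • τ = τ' := by
  obtain ⟨l, hl0, h4, h6⟩ := exists_scaling_of_modularJ_eq h
  have hc : (2 * π * I : ℂ) ≠ 0 := two_pi_I_ne_zero
  have hc' : (2 * π * I * l : ℂ) ≠ 0 := mul_ne_zero hc hl0
  have hG : ∀ n, (PeriodPair.ofUpperHalfPlane _ hc' τ').G n =
      (l ^ n)⁻¹ * (PeriodPair.ofUpperHalfPlane _ hc τ').G n := by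
    intro n
    rw [PeriodPair.G_ofUpperHalfPlane, PeriodPair.G_ofUpperHalfPlane, mul_pow, mul_inv]
    ring
  have hlat := PeriodPair.lattice_eq_of_g_eq (L := PeriodPair.ofUpperHalfPlane _ hc τ)
    (L' := PeriodPair.ofUpperHalfPlane _ hc' τ')
    (by
      rw [PeriodPair.g₂, PeriodPair.g₂, hG, PeriodPair.G_four_ofUpperHalfPlane,
        PeriodPair.G_four_ofUpperHalfPlane, h4]
      field_simp)
    (by
      rw [PeriodPair.g₃, PeriodPair.g₃, hG, PeriodPair.G_six_ofUpperHalfPlane,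
        PeriodPair.G_six_ofUpperHalfPlane, h6]
      field_simp)
  have m1 : ∀ a b : ℤ, ∃ m n : ℤ, (a * τ + b : ℂ) = l * (m * τ' + n) := by
    intro a b
    have : 2 * π * I * (a * τ + b : ℂ) ∈ (PeriodPair.ofUpperHalfPlane _ hc τ).lattice :=
      PeriodPair.mem_lattice.2 ⟨a, b, by simp only [PeriodPair.ofUpperHalfPlane]; ring⟩
    rw [hlat, PeriodPair.mem_lattice] at this
    obtain ⟨m, n, hmn⟩ := this
    refine ⟨m, n, mul_left_cancel₀ hc ?_⟩
    rw [← hmn]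
    simp only [PeriodPair.ofUpperHalfPlane]
    ring
  have m2 : ∀ a b : ℤ, ∃ m n : ℤ, l * (a * τ' + b : ℂ) = m * τ + n := by
    intro a b
    have : 2 * π * I * (l * (a * τ' + b : ℂ)) ∈ (PeriodPair.ofUpperHalfPlane _ hc' τ').lattice :=
      PeriodPair.mem_lattice.2 ⟨a, b, by simp only [PeriodPair.ofUpperHalfPlane]; ring⟩
    rw [← hlat, PeriodPair.mem_lattice] at this
    obtain ⟨m, n, hmn⟩ := this
    refine ⟨m, n, mul_left_cancel₀ hc ?_⟩
    rw [← hmn]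
    simp only [PeriodPair.ofUpperHalfPlane]
    ring
  obtain ⟨a, b, hab⟩ := m2 1 0
  obtain ⟨c, d, hcd⟩ := m2 0 1
  obtain ⟨a', b', hab'⟩ := m1 1 0
  obtain ⟨c', d', hcd'⟩ := m1 0 1
  push_cast at hab hcd hab' hcd'
  have e1 := int_eq_of_mul_coe_add_eq (τ := τ) (a := 1) (b := 0) (c := a' * a + b' * c)
    (d := a' * b + b' * d) (by push_cast; linear_combination hab' + a' * hab + b' * hcd)
  have e2 := int_eq_of_mul_coe_add_eq (τ := τ) (a := 0) (b := 1) (c := c' * a + d' * c)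
    (d := c' * b + d' * d) (by push_cast; linear_combination hcd' + c' * hab + d' * hcd)
  have hdet : (a' * d' - b' * c') * (a * d - b * c) = 1 := by
    linear_combination -(c' * b + d' * d) * e1.1 - e2.2 + (c' * a + d' * c) * e1.2
  have hcd0 : (c * τ + d : ℂ) ≠ 0 := by
    rw [← hcd, zero_mul, zero_add, mul_one]; exact hl0
  have hτ' : (τ' : ℂ) = (a * τ + b) / (c * τ + d) := by
    rw [eq_div_iff hcd0, ← hab, ← hcd]; ring
  have hpos : 0 < a * d - b * c := by
    have him : (τ' : ℂ).im * normSq (c * τ + d) = (a * d - b * c : ℤ) * (τ : ℂ).im := by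
      rw [hτ', div_im]
      have : normSq (c * τ + d : ℂ) ≠ 0 := normSq_eq_zero.not.2 hcd0
      rw [sub_mul, div_mul_cancel₀ _ this, div_mul_cancel₀ _ this]
      simp
      ring
    have h1 : 0 < (τ' : ℂ).im * normSq (c * τ + d) := mul_pos τ'.2 (normSq_pos.2 hcd0)
    rw [him] at h1
    exact_mod_cast (pos_iff_pos_of_mul_pos h1).2 τ.2
  have hdet1 : a * d - b * c = 1 := by
    rcases Int.isUnit_iff.1 (IsUnit.of_mul_eq_one_right _ hdet) with h | h <;> omega
  let γ : SL(2, ℤ) := ⟨!![a, b; c, d], by rw [Matrix.det_fin_two_of]; exact hdet1⟩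
  refine ⟨γ, UpperHalfPlane.ext ?_⟩
  rw [hτ', UpperHalfPlane.coe_specialLinearGroup_apply]
  simp [γ]

end

section HeckePoints

open UpperHalfPlane hiding I
open Complex Filter Function ModularForm
open scoped Topology Manifold MatrixGroups CongruenceSubgroup Real

namespace HasQExp

variable {h h' : ℝ} {P : PowerSeries ℂ} {f : ℍ → ℂ}

lemma comp_expand (hf : HasQExp h P f) {m : ℕ} (hm : m ≠ 0) {g : ℍ → ℍ}
    (hg : ∀ τ, Periodic.qParam h (g τ) = Periodic.qParam h' τ ^ m) :
    HasQExp h' (P.expand m hm) (fun τ ↦ f (g τ)) := by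
  intro τ
  rw [← (mul_right_injective₀ hm).hasSum_iff]
  · convert! hf (g τ) using 2 with n
    rw [Function.comp_apply, PowerSeries.coeff_expand_mul, hg, pow_mul]
  · intro n hn
    rw [PowerSeries.coeff_expand_of_not_dvd, zero_mul]
    rintro ⟨l, rfl⟩
    exact hn ⟨l, rfl⟩

lemma comp_rescale (hf : HasQExp h P f) {c : ℂ} {g : ℍ → ℍ}
    (hg : ∀ τ, Periodic.qParam h (g τ) = c * Periodic.qParam h' τ) :
    HasQExp h' (PowerSeries.rescale c P) (fun τ ↦ f (g τ)) := by
  intro τ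
  convert! hf (g τ) using 2 with n
  rw [PowerSeries.coeff_rescale, hg, mul_pow]
  ring

lemma of_expand {m : ℕ} (hm : m ≠ 0) (hf : HasQExp h' (P.expand m hm) f)
    (hg : ∀ τ : ℍ, Periodic.qParam h τ = Periodic.qParam h' τ ^ m) : HasQExp h P f := by
  intro τ
  have := hf τ
  rw [← (mul_right_injective₀ hm).hasSum_iff] at this
  · convert! this using 2 with n
    rw [Function.comp_apply, PowerSeries.coeff_expand_mul, hg, pow_mul]
  · intro n hn
    rw [PowerSeries.coeff_expand_of_not_dvd, zero_mul]
    rintro ⟨l, rfl⟩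
    exact hn ⟨l, rfl⟩

end HasQExp

lemma qParam_one_eq_pow {p : ℕ} (hp : p ≠ 0) (z : ℂ) :
    Periodic.qParam 1 z = Periodic.qParam p z ^ p := by
  have : (p : ℂ) ≠ 0 := Nat.cast_ne_zero.2 hp
  rw [Periodic.qParam, Periodic.qParam, ← Complex.exp_nat_mul]
  congr 1
  push_cast
  field_simp

lemma qParam_add {p : ℕ} (hp : p ≠ 0) (z : ℂ) (n : ℕ) :
    Periodic.qParam p (z + n) = exp (2 * π * I / p) ^ n * Periodic.qParam p z := by
  have : (p : ℂ) ≠ 0 := Nat.cast_ne_zero.2 hp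
  rw [Periodic.qParam, Periodic.qParam, ← Complex.exp_nat_mul, ← Complex.exp_add]
  congr 1
  push_cast
  field_simp
  ring

/-- A function on the upper half plane with a `q`-expansion of level `p` which is invariant
under `T` has a `q`-expansion of level one. -/
lemma HasQExp.exists_expand {R : Type} [CommRing R] {φ : R →+* ℂ} (hφ : Injective φ)
    {p : ℕ} (hp : p ≠ 0) {P : PowerSeries R} {F : ℍ → ℂ} (hF : HasQExp p (P.map φ) F)
    (hT : ∀ τ, F (ModularGroup.T • τ) = F τ) :
    ∃ P' : PowerSeries R, P = P'.expand p hp ∧ HasQExp 1 (P'.map φ) F := by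
  have hp' : (0 : ℝ) < p := by positivity
  have hζ := Complex.isPrimitiveRoot_exp p hp
  have h1 : HasQExp p (PowerSeries.rescale (exp (2 * π * I / p)) (P.map φ)) F := by
    refine HasQExp.congr (hF.comp_rescale (g := fun τ ↦ ModularGroup.T • τ) fun τ ↦ ?_) hT
    rw [UpperHalfPlane.coe_T_smul]
    simpa using qParam_add hp τ 1
  have h2 := h1.unique hp' hF
  have h3 : P = (PowerSeries.mk fun n ↦ PowerSeries.coeff (p * n) P).expand p hp := by
    ext n
    by_cases hn : p ∣ n
    · obtain ⟨l, rfl⟩ := hn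
      rw [PowerSeries.coeff_expand_mul, PowerSeries.coeff_mk]
    · rw [PowerSeries.coeff_expand_of_not_dvd _ _ _ hn]
      have h4 := congrArg (PowerSeries.coeff n) h2
      rw [PowerSeries.coeff_rescale, PowerSeries.coeff_map] at h4
      apply hφ
      rw [_root_.map_zero]
      by_contra h0
      exact hn (hζ.dvd_of_pow_eq_one n (mul_right_cancel₀ h0 (by rw [h4, one_mul])))
  refine ⟨_, h3, HasQExp.of_expand hp ?_ fun τ ↦ qParam_one_eq_pow hp τ⟩
  rw [← PowerSeries.map_expand, ← h3]
  exact hF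

lemma IsLevelOne.apply_of_eq {k : ℤ} {P : PowerSeries ℂ} {F : ℍ → ℂ} (hF : IsLevelOne k P F)
    {a b c d : ℤ} (hdet : a * d - b * c = 1) {τ τ' : ℍ}
    (h : (τ' : ℂ) * (c * τ + d) = a * τ + b) : F τ' = (c * τ + d : ℂ) ^ k * F τ := by
  let γ : SL(2, ℤ) := ⟨!![a, b; c, d], by rw [Matrix.det_fin_two_of]; exact hdet⟩
  have hd : denom γ τ = c * τ + d := by rw [ModularGroup.denom_apply]; simp [γ]
  have hτ : γ • τ = τ' := by
    refine UpperHalfPlane.ext ?_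
    have hne : (c * τ + d : ℂ) ≠ 0 := by rw [← hd]; exact denom_ne_zero _ _
    rw [UpperHalfPlane.coe_specialLinearGroup_apply]
    simpa [γ, div_eq_iff hne] using h.symm
  rw [← hτ, hF.SL_smul, hd]

/-- The images of `τ` under representatives of the integral matrices of determinant `p` modulo
`SL(2, ℤ)`. -/
def heckePoint (p : ℕ) [Fact p.Prime] : Option (ZMod p) → ℍ → ℍ
  | none, τ => ⟨p * τ, by
      simpa using mul_pos (Nat.cast_pos.2 (NeZero.pos p)) τ.im_pos⟩
  | some b, τ => ⟨(τ + b.val) / p, by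
      rw [show ((τ + b.val) / p : ℂ) = ((p : ℝ)⁻¹ : ℝ) * (τ + (b.val : ℝ)) by
        push_cast; rw [div_eq_inv_mul]]
      rw [Complex.im_ofReal_mul]
      exact mul_pos (inv_pos.2 (Nat.cast_pos.2 (NeZero.pos p))) (by simpa using τ.im_pos)⟩

section HeckePoint

variable {p : ℕ} [Fact p.Prime]

lemma coe_heckePoint_none (τ : ℍ) : (heckePoint p none τ : ℂ) = p * τ := rfl

lemma coe_heckePoint_some (b : ZMod p) (τ : ℍ) :
    (heckePoint p (some b) τ : ℂ) = (τ + b.val) / p := rfl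

lemma qParam_heckePoint_none (τ : ℍ) :
    Periodic.qParam 1 (heckePoint p none τ) = Periodic.qParam p τ ^ (p * p) := by
  have : (p : ℂ) ≠ 0 := Nat.cast_ne_zero.2 (NeZero.ne p)
  rw [coe_heckePoint_none, Periodic.qParam, Periodic.qParam, ← Complex.exp_nat_mul]
  congr 1
  push_cast
  field_simp

lemma qParam_heckePoint_some (b : ZMod p) (τ : ℍ) :
    Periodic.qParam 1 (heckePoint p (some b) τ) =
      exp (2 * π * I / p) ^ b.val * Periodic.qParam p τ := by
  rw [← qParam_add (NeZero.ne p), coe_heckePoint_some, Periodic.qParam, Periodic.qParam]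
  congr 1
  push_cast
  field_simp

/-- The permutation of the representatives of determinant `p` induced by `τ ↦ τ + 1`. -/
def heckeT (p : ℕ) : Equiv.Perm (Option (ZMod p)) := Equiv.optionCongr (Equiv.addRight 1)

/-- The permutation of the representatives of determinant `p` induced by `τ ↦ -1/τ`. -/
def heckeS (p : ℕ) [Fact p.Prime] : Equiv.Perm (Option (ZMod p)) :=
  Function.Involutive.toPerm
    (fun i ↦ i.elim (some 0) fun b ↦ if b = 0 then none else some (-b⁻¹)) <| by
      rintro (_ | b)
      · simp
      · by_cases hb : b = 0
        · simp [hb]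
        · simp [hb, inv_neg]

lemma heckeS_none : heckeS p none = some 0 := rfl

lemma heckeS_zero : heckeS p (some 0) = none := if_pos rfl

lemma heckeS_some {b : ZMod p} (hb : b ≠ 0) :
    heckeS p (some b) = some (-b⁻¹) := if_neg hb

/-- The automorphy factor at the representatives of determinant `p`. -/
def heckeFactor (p w : ℕ) : Option (ZMod p) → ℕ
  | none => p ^ w
  | some _ => 1

variable {w : ℕ} {P : PowerSeries ℂ} {F : ℍ → ℂ}

lemma IsLevelOne.heckePoint_S_smul (hF : IsLevelOne w P F) (i : Option (ZMod p))
    (τ : ℍ) : heckeFactor p w i * F (heckePoint p i (ModularGroup.S • τ)) =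
      (τ : ℂ) ^ w * (heckeFactor p w (heckeS p i) * F (heckePoint p (heckeS p i) τ)) := by
  have hp0 : (p : ℂ) ≠ 0 := Nat.cast_ne_zero.2 (NeZero.ne p)
  have hτ := UpperHalfPlane.ne_zero τ
  rcases i with _ | b
  · rw [heckeS_none, hF.apply_of_eq (a := 0) (b := -1) (c := 1) (d := 0) (by norm_num)
      (τ := heckePoint p (some 0) τ)]
    · simp only [heckeFactor, coe_heckePoint_some, zpow_natCast, ZMod.val_zero]
      push_cast
      rw [← mul_assoc, ← mul_pow, one_mul (F _)]
      congr 2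
      field_simp
      ring
    · simp only [coe_heckePoint_some, coe_heckePoint_none, UpperHalfPlane.coe_S_smul, ZMod.val_zero]
      push_cast
      field_simp
      ring
  by_cases hb : b = 0
  · subst hb
    rw [heckeS_zero, hF.apply_of_eq (a := 0) (b := -1) (c := 1) (d := 0) (by norm_num)
      (τ := heckePoint p none τ)]
    · simp only [heckeFactor, coe_heckePoint_none, zpow_natCast]
      rw [Nat.cast_one, one_mul, Nat.cast_pow, ← mul_assoc ((τ : ℂ) ^ w), ← mul_pow]
      push_cast
      congr 2
      ring
    · simp only [coe_heckePoint_some, coe_heckePoint_none, UpperHalfPlane.coe_S_smul, ZMod.val_zero]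
      push_cast
      field_simp
      ring
  · rw [heckeS_some hb]
    obtain ⟨m, hm⟩ : (p : ℤ) ∣ -1 - b.val * (-b⁻¹).val := by
      rw [← ZMod.intCast_zmod_eq_zero_iff_dvd]
      push_cast
      rw [ZMod.natCast_zmod_val, ZMod.natCast_zmod_val, mul_neg, mul_inv_cancel₀ hb]
      ring
    have hm' : (-1 - b.val * (-b⁻¹).val : ℂ) = p * m := by exact_mod_cast hm
    have hb' := coe_heckePoint_some (-b⁻¹) τ
    generalize (-b⁻¹).val = b' at *
    rw [hF.apply_of_eq (a := b.val) (b := m) (c := p) (d := -b')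
      (by linear_combination hm) (τ := heckePoint p (some (-b⁻¹)) τ)]
    · simp only [heckeFactor, hb', zpow_natCast]
      push_cast
      rw [one_mul, one_mul]
      congr 2
      field_simp
      ring
    · simp only [hb', coe_heckePoint_some, UpperHalfPlane.coe_S_smul]
      push_cast
      field_simp
      linear_combination τ * hm'

lemma IsLevelOne.heckePoint_T_smul (hF : IsLevelOne w P F) (i : Option (ZMod p)) (τ : ℍ) :
    heckeFactor p w i * F (heckePoint p i (ModularGroup.T • τ)) =
      heckeFactor p w (heckeT p i) * F (heckePoint p (heckeT p i) τ) := by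
  have hp0 : (p : ℂ) ≠ 0 := Nat.cast_ne_zero.2 (NeZero.ne p)
  rcases i with _ | b
  · change heckeFactor p w none * _ = heckeFactor p w none * F (heckePoint p none τ)
    rw [hF.apply_of_eq (a := 1) (b := p) (c := 0) (d := 1) (by norm_num)
      (τ := heckePoint p none τ)]
    · simp
    · simp only [coe_heckePoint_none, UpperHalfPlane.coe_T_smul]
      push_cast
      ring
  · change heckeFactor p w (some b) * _ =
      heckeFactor p w (some (b + 1)) * F (heckePoint p (some (b + 1)) τ)
    obtain ⟨m, hm⟩ : (p : ℤ) ∣ 1 + b.val - (b + 1).val := by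
      rw [← ZMod.intCast_zmod_eq_zero_iff_dvd]
      push_cast
      rw [ZMod.natCast_zmod_val, ZMod.natCast_zmod_val]
      ring
    have hm' : (1 + b.val - (b + 1).val : ℂ) = p * m := by exact_mod_cast hm
    rw [hF.apply_of_eq (a := 1) (b := m) (c := 0) (d := 1) (by norm_num)
      (τ := heckePoint p (some (b + 1)) τ)]
    · simp [heckeFactor]
    · simp only [coe_heckePoint_some, UpperHalfPlane.coe_T_smul]
      push_cast
      field_simp
      linear_combination p * hm'

/-- A family of functions indexed by the representatives of determinant `p` which is permuted by
`SL(2, ℤ)` with automorphy factor of weight `w`. -/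
structure IsHeckeFamily (p : ℕ) [Fact p.Prime] (w : ℕ) (Φ : Option (ZMod p) → ℍ → ℂ) : Prop where
  S_smul : ∀ i τ, Φ i (ModularGroup.S • τ) = (τ : ℂ) ^ w * Φ (heckeS p i) τ
  T_smul : ∀ i τ, Φ i (ModularGroup.T • τ) = Φ (heckeT p i) τ

namespace IsHeckeFamily

variable {v : ℕ} {Φ Ψ : Option (ZMod p) → ℍ → ℂ}

lemma of_isLevelOne (hF : IsLevelOne w P F) :
    IsHeckeFamily p w fun i τ ↦ heckeFactor p w i * F (heckePoint p i τ) :=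
  ⟨hF.heckePoint_S_smul, hF.heckePoint_T_smul⟩

lemma const (hF : IsLevelOne w P F) : IsHeckeFamily p w fun _ τ ↦ F τ :=
  ⟨fun _ τ ↦ by rw [hF.S_smul, zpow_natCast], fun _ τ ↦ hF.hasQExp.T_smul τ⟩

lemma mul (hΦ : IsHeckeFamily p w Φ) (hΨ : IsHeckeFamily p v Ψ) :
    IsHeckeFamily p (w + v) fun i τ ↦ Φ i τ * Ψ i τ :=
  ⟨fun i τ ↦ by rw [hΦ.S_smul, hΨ.S_smul, pow_add]; ring, fun i τ ↦ by rw [hΦ.T_smul, hΨ.T_smul]⟩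

lemma sub (hΦ : IsHeckeFamily p w Φ) (hΨ : IsHeckeFamily p w Ψ) :
    IsHeckeFamily p w fun i τ ↦ Φ i τ - Ψ i τ :=
  ⟨fun i τ ↦ by rw [hΦ.S_smul, hΨ.S_smul]; ring, fun i τ ↦ by rw [hΦ.T_smul, hΨ.T_smul]⟩

lemma prod_S_smul (hΦ : IsHeckeFamily p w Φ) (τ : ℍ) :
    ∏ i, Φ i (ModularGroup.S • τ) = (τ : ℂ) ^ (w * (p + 1)) * ∏ i, Φ i τ := by
  simp_rw [hΦ.S_smul]
  rw [Finset.prod_mul_distrib, Finset.prod_const, Finset.card_univ, Fintype.card_option,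
    ZMod.card, pow_mul, Equiv.prod_comp (heckeS p) fun i ↦ Φ i τ]

lemma prod_T_smul (hΦ : IsHeckeFamily p w Φ) (τ : ℍ) :
    ∏ i, Φ i (ModularGroup.T • τ) = ∏ i, Φ i τ := by
  simp_rw [hΦ.T_smul]
  exact Equiv.prod_comp (heckeT p) fun i ↦ Φ i τ

/-- The product of the members of an equivariant family with a `q`-expansion over `R`. -/
lemma exists_isLevelOne {R : Type} [CommRing R] {φ : R →+* ℂ} (hφ : Injective φ)
    (hΦ : IsHeckeFamily p w Φ) {c : ℂ} (hc : c ≠ 0) {P : PowerSeries R} {F : ℍ → ℂ}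
    (hF : HasQExp p (P.map φ) F) (h : ∀ τ, ∏ i, Φ i τ = c * F τ) :
    ∃ P' : PowerSeries R, P = P'.expand p (NeZero.ne p) ∧
      IsLevelOne (w * (p + 1) : ℕ) (P'.map φ) F := by
  obtain ⟨P', h1, h2⟩ := hF.exists_expand hφ (NeZero.ne p) fun τ ↦
    mul_left_cancel₀ hc (by rw [← h, ← h, hΦ.prod_T_smul])
  refine ⟨P', h1, h2, fun τ ↦ mul_left_cancel₀ hc ?_⟩
  rw [← h, hΦ.prod_S_smul, h, zpow_natCast]
  ring

end IsHeckeFamily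

end HeckePoint

end HeckePoints

section HeckePolynomials

open UpperHalfPlane hiding I
open Complex Filter Function ModularForm
open scoped Topology Manifold MatrixGroups CongruenceSubgroup Real

variable {R k : Type} [CommRing R] [Field k] {p : ℕ} [Fact p.Prime]

/-- The `q`-expansions of the translates of a level one form by the representatives of
determinant `p`. -/
def heckeSeries (p : ℕ) [Fact p.Prime] (ζ : R) (P : PowerSeries R) : Option (ZMod p) → PowerSeries R
  | none => P.expand (p * p) (mul_ne_zero (NeZero.ne p) (NeZero.ne p))
  | some b => PowerSeries.rescale (ζ ^ b.val) P

lemma HasQExp.heckePoint {φ : R →+* ℂ} {ζ : R} (hζ : φ ζ = exp (2 * π * I / p))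
    {P : PowerSeries R} {F : ℍ → ℂ} (hF : HasQExp 1 (P.map φ) F) (i : Option (ZMod p)) :
    HasQExp p ((heckeSeries p ζ P i).map φ) (fun τ ↦ F (_root_.heckePoint p i τ)) := by
  rcases i with _ | b
  · rw [heckeSeries, PowerSeries.map_expand]
    exact hF.comp_expand _ qParam_heckePoint_none
  · rw [heckeSeries, ← PowerSeries.rescale_map, map_pow, hζ]
    exact hF.comp_rescale (qParam_heckePoint_some b)

lemma HasQExp.expand_self {φ : R →+* ℂ} {P : PowerSeries R} {F : ℍ → ℂ}
    (hF : HasQExp 1 (P.map φ) F) : HasQExp p ((P.expand p (NeZero.ne p)).map φ) F := by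
  rw [PowerSeries.map_expand]
  exact hF.comp_expand (g := id) _ fun τ ↦ qParam_one_eq_pow (NeZero.ne p) τ

lemma PowerSeries.expand_injective {p : ℕ} (hp : p ≠ 0) :
    Function.Injective (PowerSeries.expand p hp : PowerSeries R → PowerSeries R) := by
  intro P Q h
  ext n
  rw [← PowerSeries.coeff_expand_mul p hp, h, PowerSeries.coeff_expand_mul]

lemma eisenstein4_expand [CharP k p] :
    (eisenstein4 k).expand p (NeZero.ne p) = eisenstein4 k ^ p := by
  conv_lhs => rw [← map_eisenstein4 (frobenius k p)]
  rw [← PowerSeries.map_expand]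
  exact MvPowerSeries.map_frobenius_expand p _

lemma discSeries_expand [CharP k p] {u : k} (hu : 1728 * u = 1) :
    (discSeries u).expand p (NeZero.ne p) = discSeries u ^ p := by
  have hf : frobenius k p u = u := by
    have h0 : (1728 : k) ≠ 0 := left_ne_zero_of_mul_eq_one hu
    have h1 := congrArg (frobenius k p) hu
    rw [map_mul, _root_.map_ofNat, map_one, ← hu] at h1
    exact mul_left_cancel₀ h0 h1
  conv_lhs => rw [← hf, ← map_discSeries]
  rw [← PowerSeries.map_expand]
  exact MvPowerSeries.map_frobenius_expand p _

lemma IsHeckeFamily.exists_polynomial {φ : R →+* ℂ} (hφ : Injective φ) (ψ : R →+* k) {u : R}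
    (hu : 1728 * u = 1) {n : ℕ} {Φ : Option (ZMod p) → ℍ → ℂ} (hΦ : IsHeckeFamily p (12 * n) Φ)
    {c : ℂ} (hc : c ≠ 0) {P : PowerSeries R} {F : ℍ → ℂ} (hF : HasQExp p (P.map φ) F)
    (h : ∀ τ, ∏ i, Φ i τ = c * F τ) {Q : PowerSeries k}
    (hQ : P.map ψ = Q.expand p (NeZero.ne p)) :
    ∃ A : R[X], (∀ τ, F τ = ModularForm.discriminant τ ^ (n * (p + 1)) * A.eval₂ φ (modularJ τ)) ∧
      algebraMap _ (FractionRing (PowerSeries k)) (discSeries (ψ u)) ^ (n * (p + 1)) *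
        (A.map ψ).eval₂ ((algebraMap _ (FractionRing (PowerSeries k))).comp PowerSeries.C)
          (algebraMap _ (FractionRing (PowerSeries k)) (eisenstein4 k ^ 3) /
            algebraMap _ (FractionRing (PowerSeries k)) (discSeries (ψ u))) =
        algebraMap _ (FractionRing (PowerSeries k)) Q := by
  obtain ⟨P', hP', hF'⟩ := hΦ.exists_isLevelOne hφ hc hF h
  have hw : (((12 * n * (p + 1) : ℕ) : ℤ)) = 12 * ((n * (p + 1) : ℕ) : ℤ) := by push_cast; ring
  rw [hw] at hF'
  obtain ⟨A, hA, hPA⟩ := IsLevelOne.exists_homogEval hφ hu _ _ _ hF'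
  refine ⟨A, fun τ ↦ ?_, ?_⟩
  · rw [hPA] at hF'
    exact IsLevelOne.apply_eq_eval hu hA hF'.hasQExp τ
  · have hψu : 1728 * ψ u = 1 := by rw [← map_one ψ, ← hu, map_mul, _root_.map_ofNat ψ]
    set ι := algebraMap (PowerSeries k) (FractionRing (PowerSeries k))
    have hι : Function.Injective ι := IsFractionRing.injective _ _
    have hD : ι (discSeries (ψ u)) ≠ 0 := by
      rw [Ne, map_eq_zero_iff _ hι]; exact discSeries_ne_zero hψu
    have hPQ : P'.map ψ = Q := by
      apply PowerSeries.expand_injective (NeZero.ne p)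
      rw [← hQ, hP', PowerSeries.map_expand]
    rw [← homogEval_eq (ι.comp PowerSeries.C) (natDegree_map_le.trans hA) _ hD, homogEval_map,
      ← hPQ, hPA, map_homogEval, map_homogEval, map_pow (PowerSeries.map ψ), map_eisenstein4,
          map_discSeries]
    congr 1
    ext x
    simp

lemma map_heckeSeries_none {ψ : R →+* k} {ζ : R} {P : PowerSeries R} {Q : PowerSeries k}
    (h : P.map ψ = Q) (hQ : Q.expand p (NeZero.ne p) = Q ^ p) :
    (heckeSeries p ζ P none).map ψ = (Q ^ p) ^ p := by
  rw [heckeSeries, PowerSeries.map_expand, h,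
    PowerSeries.expand_mul p (NeZero.ne p) p (NeZero.ne p), hQ, map_pow, hQ]

lemma map_heckeSeries_some {ψ : R →+* k} {ζ : R} (hζ : ψ ζ = 1) (P : PowerSeries R) (b : ZMod p) :
    (heckeSeries p ζ P (some b)).map ψ = P.map ψ := by
  rw [heckeSeries, ← PowerSeries.rescale_map, map_pow, hζ, one_pow, PowerSeries.rescale_one]
  rfl

lemma map_expand_eq_pow {ψ : R →+* k} {P : PowerSeries R} {Q : PowerSeries k}
    (h : P.map ψ = Q) (hQ : Q.expand p (NeZero.ne p) = Q ^ p) :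
    (P.expand p (NeZero.ne p)).map ψ = Q ^ p := by
  rw [PowerSeries.map_expand, h, hQ]

variable [CharP k p] {φ : R →+* ℂ} {ψ : R →+* k} {u ζ : R}

lemma exists_discriminant_polynomial (hφ : Injective φ) (hu : 1728 * u = 1)
    (hζφ : φ ζ = exp (2 * π * I / p)) (hζ : ψ ζ = 1)
    (x : R) {H : k[X]}
    (hH : algebraMap _ (FractionRing (PowerSeries k)) (discSeries (ψ u)) ^ (p - 1) *
      H.eval₂ ((algebraMap _ (FractionRing (PowerSeries k))).comp PowerSeries.C)
        (algebraMap _ (FractionRing (PowerSeries k)) (eisenstein4 k ^ 3) /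
          algebraMap _ (FractionRing (PowerSeries k)) (discSeries (ψ u))) = 1) :
    ∃ A : R[X], (∀ τ, ∏ i, (φ x * ModularForm.discriminant τ -
        heckeFactor p 12 i * ModularForm.discriminant (heckePoint p i τ)) =
        ModularForm.discriminant τ ^ (p + 1) * A.eval₂ φ (modularJ τ)) ∧
      A.map ψ = C (ψ x) ^ (p + 1) - C (ψ x) * H := by
  have hp : p.Prime := Fact.out
  have hφu : 1728 * φ u = 1 := by rw [← map_one φ, ← hu, map_mul, _root_.map_ofNat φ]
  have hψu : 1728 * ψ u = 1 := by rw [← map_one ψ, ← hu, map_mul, _root_.map_ofNat ψ]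
  have hΔ := isLevelOne_discriminant hφu
  have hΔ' : HasQExp 1 ((discSeries u).map φ) ModularForm.discriminant := by
    rw [map_discSeries]; exact hΔ.hasQExp
  have hΦ : IsHeckeFamily p (12 * 1) _ :=
    (IsHeckeFamily.const (w := 12) (hΔ.const_mul (φ x))).sub (IsHeckeFamily.of_isLevelOne hΔ)
  have hE := discSeries_expand (p := p) hψu
  have : CharP (PowerSeries k) p := charP_of_injective_ringHom (PowerSeries.C_injective) p
  obtain ⟨A, hA, hAψ⟩ := hΦ.exists_polynomial hφ ψ hu one_ne_zero
    (P := ∏ i, (PowerSeries.C x * (discSeries u).expand p (NeZero.ne p) -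
      PowerSeries.C (heckeFactor p 12 i : R) * heckeSeries p ζ (discSeries u) i))
    (F := fun τ ↦ ∏ i, (φ x * ModularForm.discriminant τ -
        heckeFactor p 12 i * ModularForm.discriminant (heckePoint p i τ)))
    (Q := PowerSeries.C (ψ x) * discSeries (ψ u) *
      (PowerSeries.C (ψ x) ^ p * discSeries (ψ u) ^ p - discSeries (ψ u)))
    (by
      rw [map_prod]
      refine HasQExp.prod fun i _ ↦ ?_
      rw [map_sub, map_mul, map_mul, PowerSeries.map_C, PowerSeries.map_C, _root_.map_natCast]
      exact (hΔ'.expand_self.const_mul _).sub ((hΔ'.heckePoint hζφ i).const_mul _))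
    (fun τ ↦ (one_mul _).symm)
    (by
      rw [map_prod, Fintype.prod_option]
      have hc0 : ψ (heckeFactor p 12 none : R) = 0 := by
        rw [_root_.map_natCast, heckeFactor, Nat.cast_pow, CharP.cast_eq_zero,
            zero_pow (by norm_num)]
      have hc1 : ∀ b : ZMod p, ψ (heckeFactor p 12 (some b) : R) = 1 := by
        intro b; rw [_root_.map_natCast, heckeFactor, Nat.cast_one]
      simp only [map_sub, map_mul, map_pow, PowerSeries.map_C, hc0, hc1, map_one, map_zero,
        map_heckeSeries_some hζ, map_discSeries, map_expand_eq_pow (map_discSeries ψ u) hE,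
        PowerSeries.expand_C, hE, Finset.prod_const, Finset.card_univ, ZMod.card, zero_mul, one_mul,
        sub_zero, sub_pow_char, mul_pow])
  refine ⟨A, fun τ ↦ by rw [hA, one_mul], ?_⟩
  rw [← sub_eq_zero]
  refine eq_zero_of_eval₂_jSeries hψu ?_
  set ι := algebraMap (PowerSeries k) (FractionRing (PowerSeries k))
  have hι : Function.Injective ι := IsFractionRing.injective _ _
  have hD : ι (discSeries (ψ u)) ≠ 0 := by
    rw [Ne, map_eq_zero_iff _ hι]; exact discSeries_ne_zero hψu
  rw [eval₂_sub, eval₂_sub, eval₂_mul, eval₂_pow, Polynomial.eval₂_C, RingHom.comp_apply]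
  set a := (A.map ψ).eval₂ (ι.comp PowerSeries.C) (ι (eisenstein4 k ^ 3) / ι (discSeries (ψ u)))
  set b := H.eval₂ (ι.comp PowerSeries.C) (ι (eisenstein4 k ^ 3) / ι (discSeries (ψ u)))
  refine (mul_eq_zero.1 (?_ : ι (discSeries (ψ u)) ^ (p + 1) * _ = 0)).resolve_left
    (pow_ne_zero _ hD)
  simp only [map_mul, map_sub, map_pow, one_mul] at hAψ
  have hpow : ι (discSeries (ψ u)) ^ (p + 1) =
      ι (discSeries (ψ u)) ^ (p - 1) * ι (discSeries (ψ u)) ^ 2 := by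
    rw [← pow_add]; congr 1; have := hp.two_le; omega
  rw [mul_sub, hAψ]
  have : ι (discSeries (ψ u)) ^ (p + 1) * (ι (PowerSeries.C (ψ x)) * b) =
      ι (PowerSeries.C (ψ x)) * ι (discSeries (ψ u)) ^ 2 := by
    rw [hpow]
    linear_combination ι (PowerSeries.C (ψ x)) * ι (discSeries (ψ u)) ^ 2 * hH
  linear_combination this

lemma exists_modular_polynomial (hφ : Injective φ) (hu : 1728 * u = 1)
    (hζφ : φ ζ = exp (2 * π * I / p)) (hζ : ψ ζ = 1) :
    ∃ A : R[X], (∀ τ, ∏ i, (E₄ τ ^ 3 * ModularForm.discriminant (heckePoint p i τ) -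
        ModularForm.discriminant τ * E₄ (heckePoint p i τ) ^ 3) =
        ModularForm.discriminant τ ^ (2 * (p + 1)) * A.eval₂ φ (modularJ τ)) ∧
      A.map ψ = -(X ^ p - X) ^ 2 := by
  have hp : p.Prime := Fact.out
  have hφu : 1728 * φ u = 1 := by rw [← map_one φ, ← hu, map_mul, _root_.map_ofNat φ]
  have hψu : 1728 * ψ u = 1 := by rw [← map_one ψ, ← hu, map_mul, _root_.map_ofNat ψ]
  have hΔ := isLevelOne_discriminant hφu
  have hΔ' : HasQExp 1 ((discSeries u).map φ) ModularForm.discriminant := by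
    rw [map_discSeries]; exact hΔ.hasQExp
  have hQ : IsLevelOne (12 : ℕ) (eisenstein4 ℂ ^ 3) (E₄ ^ 3) := isLevelOne_E₄.pow 3
  have hQ' : HasQExp 1 ((eisenstein4 R ^ 3).map φ) (E₄ ^ 3) := by
    rw [map_pow, map_eisenstein4]; exact hQ.hasQExp
  have hΦ : IsHeckeFamily p (12 * 2) _ :=
    ((IsHeckeFamily.const hQ).mul (IsHeckeFamily.of_isLevelOne (w := 12) hΔ)).sub
      ((IsHeckeFamily.const (w := 12) hΔ).mul (IsHeckeFamily.of_isLevelOne hQ))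
  have hD := discSeries_expand (p := p) hψu
  have hE : (eisenstein4 k ^ 3).expand p (NeZero.ne p) = (eisenstein4 k ^ 3) ^ p := by
    rw [map_pow, eisenstein4_expand]; ring
  have hE' : (eisenstein4 R ^ 3).map ψ = eisenstein4 k ^ 3 := by rw [map_pow, map_eisenstein4]
  have : CharP (PowerSeries k) p := charP_of_injective_ringHom (PowerSeries.C_injective) p
  obtain ⟨A, hA, hAψ⟩ := hΦ.exists_polynomial hφ ψ hu (c := (p : ℂ) ^ 12)
    (pow_ne_zero _ (Nat.cast_ne_zero.2 hp.ne_zero))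
    (P := ∏ i, ((eisenstein4 R ^ 3).expand p (NeZero.ne p) * heckeSeries p ζ (discSeries u) i -
      (discSeries u).expand p (NeZero.ne p) * heckeSeries p ζ (eisenstein4 R ^ 3) i))
    (F := fun τ ↦ ∏ i, (E₄ τ ^ 3 * ModularForm.discriminant (heckePoint p i τ) -
        ModularForm.discriminant τ * E₄ (heckePoint p i τ) ^ 3))
    (Q := ((eisenstein4 k ^ 3) * discSeries (ψ u) ^ p - discSeries (ψ u) *
        (eisenstein4 k ^ 3) ^ p) *
      ((eisenstein4 k ^ 3) ^ p * discSeries (ψ u) - discSeries (ψ u) ^ p * (eisenstein4 k ^ 3)))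
    (by
      rw [map_prod]
      refine HasQExp.prod fun i _ ↦ ?_
      rw [map_sub, map_mul, map_mul]
      exact (hQ'.expand_self.mul (hΔ'.heckePoint hζφ i)).sub
        (hΔ'.expand_self.mul (hQ'.heckePoint hζφ i)))
    (fun τ ↦ by
      simp only [Pi.pow_apply, Fintype.prod_option, heckeFactor, Nat.cast_pow, Nat.cast_one,
          one_mul]
      ring)
    (by
      rw [map_prod, Fintype.prod_option]
      simp only [map_sub, map_mul, map_heckeSeries_some hζ, map_heckeSeries_none hE' hE,
        map_heckeSeries_none (map_discSeries ψ u) hD, map_discSeries, hE',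
        map_expand_eq_pow (map_discSeries ψ u) hD, map_expand_eq_pow hE' hE, hD, hE,
        Finset.prod_const, Finset.card_univ, ZMod.card, sub_pow_char, mul_pow,
        map_pow _ (discSeries (ψ u)) p, map_pow _ (eisenstein4 k ^ 3) p])
  refine ⟨A, hA, ?_⟩
  rw [← sub_eq_zero]
  refine eq_zero_of_eval₂_jSeries hψu ?_
  set ι := algebraMap (PowerSeries k) (FractionRing (PowerSeries k))
  have hι : Function.Injective ι := IsFractionRing.injective _ _
  have hD0 : ι (discSeries (ψ u)) ≠ 0 := by
    rw [Ne, map_eq_zero_iff _ hι]; exact discSeries_ne_zero hψu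
  rw [eval₂_sub, eval₂_neg, eval₂_pow, eval₂_sub, eval₂_pow, Polynomial.eval₂_X]
  set a := (A.map ψ).eval₂ (ι.comp PowerSeries.C) (ι (eisenstein4 k ^ 3) / ι (discSeries (ψ u)))
  refine (mul_eq_zero.1 (?_ : ι (discSeries (ψ u)) ^ (2 * (p + 1)) * _ = 0)).resolve_left
    (pow_ne_zero _ hD0)
  rw [map_mul, map_sub, map_sub, map_mul, map_mul, map_mul, map_mul, map_pow _ (discSeries (ψ u)) p,
    map_pow _ (eisenstein4 k ^ 3) p] at hAψ
  rw [mul_sub, hAψ, div_pow]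
  generalize ι (discSeries (ψ u)) = D at *
  generalize ι (eisenstein4 k ^ 3) = E at *
  field_simp
  ring

end HeckePolynomials

section ComplexMultiplication

open UpperHalfPlane hiding I
open Complex Filter Function ModularForm IsLocalRing
open scoped Topology Manifold MatrixGroups CongruenceSubgroup Real

variable {p : ℕ} [Fact p.Prime] {α β γ δ : ℤ} {τ : ℍ}

lemma exists_discriminant_heckePoint_eq (hdet : α * δ - β * γ = p)
    (hτ : (τ : ℂ) * (γ * τ + δ) = α * τ + β) :
    ∃ i, (p : ℂ) ^ 12 * ModularForm.discriminant τ = (γ * τ + δ : ℂ) ^ 12 *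
      (heckeFactor p 12 i * ModularForm.discriminant (heckePoint p i τ)) := by
  have hp0 : (p : ℂ) ≠ 0 := Nat.cast_ne_zero.2 (NeZero.ne p)
  have hp0' : (p : ℤ) ≠ 0 := Nat.cast_ne_zero.2 (NeZero.ne p)
  have hΔ := IsLevelOne.discriminant
  by_cases hαγ : (α : ZMod p) = 0 ∧ (γ : ZMod p) = 0
  · rw [ZMod.intCast_zmod_eq_zero_iff_dvd, ZMod.intCast_zmod_eq_zero_iff_dvd] at hαγ
    obtain ⟨⟨a, rfl⟩, ⟨c, rfl⟩⟩ := hαγ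
    refine ⟨none, ?_⟩
    rw [hΔ.apply_of_eq (a := a) (b := β) (c := c) (d := δ) (τ := heckePoint p none τ) (τ' := τ)]
    · rw [coe_heckePoint_none, heckeFactor, show (12 : ℤ) = ((12 : ℕ) : ℤ) from rfl, zpow_natCast]
      push_cast
      ring
    · exact mul_left_cancel₀ hp0' (by linear_combination hdet)
    · rw [coe_heckePoint_none]
      push_cast at hτ
      linear_combination hτ
  · obtain ⟨b, hb1, hb2⟩ : ∃ b : ZMod p, α * b = β ∧ γ * b = δ := by
      have h0 : (α * δ - β * γ : ZMod p) = 0 := by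
        have := congrArg (Int.cast : ℤ → ZMod p) hdet
        push_cast at this
        rw [this, CharP.cast_eq_zero]
      by_cases hα : (α : ZMod p) = 0
      · have hγ : (γ : ZMod p) ≠ 0 := fun h ↦ hαγ ⟨hα, h⟩
        refine ⟨δ / γ, ?_, mul_div_cancel₀ _ hγ⟩
        field_simp
        linear_combination h0
      · refine ⟨β / α, mul_div_cancel₀ _ hα, ?_⟩
        field_simp
        linear_combination -h0
    obtain ⟨m, hm⟩ : (p : ℤ) ∣ β - α * b.val := by
      rw [← ZMod.intCast_zmod_eq_zero_iff_dvd]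
      push_cast
      rw [ZMod.natCast_zmod_val, hb1, sub_self]
    obtain ⟨n, hn⟩ : (p : ℤ) ∣ δ - γ * b.val := by
      rw [← ZMod.intCast_zmod_eq_zero_iff_dvd]
      push_cast
      rw [ZMod.natCast_zmod_val, hb2, sub_self]
    have hm' : (β - α * b.val : ℂ) = p * m := by exact_mod_cast hm
    have hn' : (δ - γ * b.val : ℂ) = p * n := by exact_mod_cast hn
    refine ⟨some b, ?_⟩
    have hd : (γ * heckePoint p (some b) τ + n : ℂ) = (γ * τ + δ) / p := by
      rw [coe_heckePoint_some]
      field_simp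
      linear_combination -hn'
    rw [hΔ.apply_of_eq (a := α) (b := m) (c := γ) (d := n) (τ := heckePoint p (some b) τ)
      (τ' := τ), hd]
    · rw [heckeFactor, ← zpow_natCast (_ : ℂ) 12]
      push_cast
      rw [div_zpow]
      field_simp
    · exact mul_left_cancel₀ hp0' (by linear_combination hdet - α * hn + γ * hm)
    · rw [hd, coe_heckePoint_some]
      field_simp
      linear_combination hτ + hm'

lemma exists_fixing_matrix_of_modularJ_heckePoint_eq {i : Option (ZMod p)}
    (h : modularJ (heckePoint p i τ) = modularJ τ) :
    ∃ α β γ δ : ℤ, α * δ - β * γ = p ∧ (τ : ℂ) * (γ * τ + δ) = α * τ + β := by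
  have hp0 : (p : ℂ) ≠ 0 := Nat.cast_ne_zero.2 (NeZero.ne p)
  obtain ⟨g, hg⟩ := exists_smul_eq_of_modularJ_eq h
  have hdet := g.det_coe
  rw [Matrix.det_fin_two] at hdet
  have h1 : (τ : ℂ) * (g 1 0 * heckePoint p i τ + g 1 1) = g 0 0 * heckePoint p i τ + g 0 1 := by
    have h2 := UpperHalfPlane.coe_specialLinearGroup_apply g (heckePoint p i τ)
    have h3 : (g 1 0 * heckePoint p i τ + g 1 1 : ℂ) ≠ 0 := by
      have := denom_ne_zero (g : GL (Fin 2) ℝ) (heckePoint p i τ)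
      rwa [ModularGroup.denom_apply] at this
    rw [hg] at h2
    simpa [eq_div_iff h3] using h2
  rcases i with _ | b
  · refine ⟨g 0 0 * p, g 0 1, g 1 0 * p, g 1 1, by linear_combination (p : ℤ) * hdet, ?_⟩
    rw [coe_heckePoint_none] at h1
    push_cast
    linear_combination h1
  · refine ⟨g 0 0, g 0 0 * b.val + g 0 1 * p, g 1 0, g 1 0 * b.val + g 1 1 * p,
      by linear_combination (p : ℤ) * hdet, ?_⟩
    rw [coe_heckePoint_some] at h1
    push_cast
    field_simp at h1
    linear_combination h1

lemma exists_fixing_matrix_pos (h : ∃ α β γ δ : ℤ, α * δ - β * γ = p ∧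
      (τ : ℂ) * (γ * τ + δ) = α * τ + β) :
    ∃ α β γ δ : ℤ, α * δ - β * γ = p ∧ 0 < γ ∧ (τ : ℂ) * (γ * τ + δ) = α * τ + β := by
  obtain ⟨α, β, γ, δ, hdet, hτ⟩ := h
  rcases lt_trichotomy γ 0 with hγ | rfl | hγ
  · refine ⟨-α, -β, -γ, -δ, by linear_combination hdet, neg_pos.2 hγ, ?_⟩
    push_cast
    linear_combination -hτ
  · obtain ⟨rfl, -⟩ := int_eq_of_mul_coe_add_eq (τ := τ) (a := δ) (b := 0) (c := α) (d := β)
      (by push_cast at hτ ⊢; linear_combination hτ)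
    have hsq : IsSquare (p : ℤ) := ⟨δ, by linear_combination -hdet⟩
    exact absurd hsq (Nat.prime_iff_prime_int.1 Fact.out).irreducible.not_isSquare
  · exact ⟨α, β, γ, δ, hdet, hγ, hτ⟩

lemma trace_sq_lt {p : ℕ} (hdet : α * δ - β * γ = p) (hγ : 0 < γ)
    (hτ : (τ : ℂ) * (γ * τ + δ) = α * τ + β) : (α + δ) ^ 2 < 4 * (p : ℤ) := by
  have h1 : (2 * γ * τ + δ - α : ℂ) ^ 2 = (((α + δ) ^ 2 - 4 * p : ℤ) : ℝ) := by
    have := congrArg (Int.cast : ℤ → ℂ) hdet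
    push_cast at this ⊢
    linear_combination 4 * γ * hτ - 4 * this
  set z : ℂ := 2 * γ * τ + δ - α with hz
  have him : z.im ≠ 0 := by
    have : z.im = 2 * γ * τ.im := by simp [hz]
    rw [this]
    have := τ.im_ne_zero
    have : (γ : ℝ) ≠ 0 := by exact_mod_cast hγ.ne'
    positivity
  have h2 := congrArg Complex.im h1
  have h3 := congrArg Complex.re h1
  rw [Complex.ofReal_im, sq, Complex.mul_im] at h2
  rw [Complex.ofReal_re, sq, Complex.mul_re] at h3
  have hre : z.re = 0 := by
    have : z.re * z.im = 0 := by linarith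
    exact (mul_eq_zero.1 this).resolve_right him
  rw [hre] at h3
  have h4 : 0 < z.im * z.im := mul_self_pos.2 him
  have h5 : (((α + δ) ^ 2 - 4 * p : ℤ) : ℝ) < 0 := by rw [← h3]; linarith
  have h6 : (α + δ) ^ 2 - 4 * (p : ℤ) < 0 := by exact_mod_cast h5
  linarith

lemma mul_eq_of_fixing_matrix {p : ℕ} (hdet : α * δ - β * γ = p)
    (hτ : (τ : ℂ) * (γ * τ + δ) = α * τ + β) : (γ * τ + δ : ℂ) * (α - γ * τ) = p := by
  have := congrArg (Int.cast : ℤ → ℂ) hdet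
  push_cast at this
  linear_combination this - γ * hτ

lemma exists_mul_discriminant_eq (hdet : α * δ - β * γ = p)
    (hτ : (τ : ℂ) * (γ * τ + δ) = α * τ + β) :
    ∃ i, (α - γ * τ : ℂ) ^ 12 * ModularForm.discriminant τ =
      heckeFactor p 12 i * ModularForm.discriminant (heckePoint p i τ) := by
  have hmul := mul_eq_of_fixing_matrix hdet hτ
  have hp0 : (p : ℂ) ≠ 0 := Nat.cast_ne_zero.2 (NeZero.ne p)
  obtain ⟨i, hi⟩ := exists_discriminant_heckePoint_eq hdet hτ
  refine ⟨i, mul_left_cancel₀ (pow_ne_zero 12 (left_ne_zero_of_mul (hmul ▸ hp0))) ?_⟩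
  rw [← hi, ← hmul]
  ring

lemma exists_mul_discriminant_eq' (hdet : α * δ - β * γ = p)
    (hτ : (τ : ℂ) * (γ * τ + δ) = α * τ + β) :
    ∃ i, (γ * τ + δ : ℂ) ^ 12 * ModularForm.discriminant τ =
      heckeFactor p 12 i * ModularForm.discriminant (heckePoint p i τ) := by
  obtain ⟨i, hi⟩ := exists_mul_discriminant_eq (τ := τ) (α := δ) (β := -β) (γ := -γ) (δ := α)
    (by linear_combination hdet) (by push_cast; linear_combination -hτ)
  refine ⟨i, ?_⟩
  rw [← hi]
  push_cast
  ring

variable {O : ValuationSubring ℂ} {u ζ : O}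

lemma residue_pow_eq_of_mul_discriminant_eq [CharP (ResidueField O) p] (hu : 1728 * u = 1)
    (hζφ : (ζ : ℂ) = exp (2 * π * I / p)) (hζ : residue O ζ = 1) {H : (ResidueField O)[X]}
    (hH : algebraMap _ (FractionRing (PowerSeries (ResidueField O)))
        (discSeries (residue O u)) ^ (p - 1) *
      H.eval₂ ((algebraMap _ (FractionRing (PowerSeries (ResidueField O)))).comp PowerSeries.C)
        (algebraMap _ (FractionRing (PowerSeries (ResidueField O)))
            (eisenstein4 (ResidueField O) ^ 3) /
          algebraMap _ (FractionRing (PowerSeries (ResidueField O)))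
            (discSeries (residue O u))) = 1)
    {x y : O} (hy : modularJ τ = y)
    (hx : ∃ i, (x : ℂ) * ModularForm.discriminant τ =
      heckeFactor p 12 i * ModularForm.discriminant (heckePoint p i τ)) :
    residue O x ^ (p + 1) = residue O x * H.eval (residue O y) := by
  obtain ⟨A, hA, hAψ⟩ := exists_discriminant_polynomial (φ := O.subtype) O.subtype_injective
    (ψ := residue O) hu hζφ hζ x hH
  obtain ⟨i, hi⟩ := hx
  have h1 := hA τ
  rw [Finset.prod_eq_zero (Finset.mem_univ i) (sub_eq_zero.2 hi), hy] at h1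
  have h2 : A.eval y = 0 := by
    have := (mul_eq_zero.1 h1.symm).resolve_left (pow_ne_zero _ (discriminant_ne_zero τ))
    apply O.subtype_injective
    rw [← Polynomial.eval₂_at_apply, _root_.map_zero]
    exact this
  have h3 : (A.map (residue O)).eval (residue O y) = 0 := by
    rw [Polynomial.eval_map, Polynomial.eval₂_at_apply, h2, _root_.map_zero]
  rw [hAψ] at h3
  simpa [sub_eq_zero] using h3

lemma exists_modularJ_lift [CharP (ResidueField O) p] (hu : 1728 * u = 1)
    (hζφ : (ζ : ℂ) = exp (2 * π * I / p)) (hζ : residue O ζ = 1) {j₀ : ResidueField O}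
    (hj₀ : j₀ ^ p = j₀) :
    ∃ τ ∈ ModularGroup.fd, ∃ y : O, modularJ τ = y ∧ residue O y = j₀ ∧
      ∃ α β γ δ : ℤ, α * δ - β * γ = p ∧ 0 < γ ∧ (τ : ℂ) * (γ * τ + δ) = α * τ + β := by
  have hp : p.Prime := Fact.out
  obtain ⟨P, hP, hPψ⟩ := exists_modular_polynomial (φ := O.subtype) O.subtype_injective
    (ψ := residue O) hu hζφ hζ
  obtain ⟨y, hy, hPy⟩ := ValuationSubring.exists_root_lift j₀ P.natDegree P le_rfl
    (by
      rw [hPψ, neg_ne_zero]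
      exact pow_ne_zero 2 (FiniteField.X_pow_card_sub_X_ne_zero _ hp.one_lt))
    (by rw [hPψ]; simp [hj₀])
  obtain ⟨τ, hτ, hJ⟩ := exists_modularJ_eq (y : ℂ)
  refine ⟨τ, hτ, y, hJ, hy, exists_fixing_matrix_pos ?_⟩
  have h1 := hP τ
  have h2 : P.eval₂ O.subtype (y : ℂ) = 0 := by
    have := Polynomial.eval₂_at_apply O.subtype y (p := P)
    rw [hPy, _root_.map_zero] at this
    exact this
  rw [hJ, h2, mul_zero, Finset.prod_eq_zero_iff] at h1
  obtain ⟨i, -, hi⟩ := h1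
  refine exists_fixing_matrix_of_modularJ_heckePoint_eq (i := i) ?_
  rw [modularJ, modularJ, div_eq_div_iff (discriminant_ne_zero _) (discriminant_ne_zero _)]
  linear_combination -hi

lemma trace_eq_zero_or_pow_eq [CharP (ResidueField O) p] (hp5 : 5 ≤ p) {a : ZMod p}
    {x y : ResidueField O} (ht : (α + δ) ^ 2 < 4 * (p : ℤ))
    (hadd : x + y = ZMod.castHom (dvd_refl p) (ResidueField O) (α + δ : ℤ)) (hmul : x * y = 0)
    (hx : (x ^ 12) ^ (p + 1) = x ^ 12 * ZMod.castHom (dvd_refl p) (ResidueField O) a)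
    (hy : (y ^ 12) ^ (p + 1) = y ^ 12 * ZMod.castHom (dvd_refl p) (ResidueField O) a) :
    α + δ = 0 ∨ ((α + δ : ℤ) : ZMod p) ^ 12 = a := by
  set φ := ZMod.castHom (dvd_refl p) (ResidueField O)
  set t : ZMod p := ((α + δ : ℤ) : ZMod p) with hdt
  have h1 : (φ t ^ 12) ^ (p + 1) = φ t ^ 12 * φ a := by
    rcases mul_eq_zero.1 hmul with h | h
    · rwa [← hadd, h, zero_add]
    · rwa [← hadd, h, add_zero]
  have h2 : (t ^ 12) ^ (p + 1) = t ^ 12 * a := φ.injective (by simpa only [map_pow,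
      map_mul] using h1)
  rw [pow_succ, ZMod.pow_card] at h2
  by_cases h0 : t = 0
  · left
    rw [hdt, ZMod.intCast_zmod_eq_zero_iff_dvd] at h0
    refine Int.eq_zero_of_abs_lt_dvd h0 (abs_lt_of_sq_lt_sq ?_ (by positivity))
    have : (5 : ℤ) ≤ p := by exact_mod_cast hp5
    nlinarith
  · exact Or.inr (mul_left_cancel₀ (pow_ne_zero 12 h0) h2)

end ComplexMultiplication

section

open UpperHalfPlane hiding I
open Complex ModularForm IsLocalRing
open scoped Real

lemma ValuationSubring.exists_coe_eq_exp {O : ValuationSubring ℂ} {p : ℕ} (hp : p.Prime)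
    (h : (p : O) ∈ maximalIdeal O) :
    ∃ ζ : O, (ζ : ℂ) = exp (2 * π * I / p) ∧ residue O ζ = 1 := by
  have : Fact p.Prime := ⟨hp⟩
  have := ValuationSubring.charP_residueField hp h
  have hpow : exp (2 * π * I / p) ^ p = 1 := (Complex.isPrimitiveRoot_exp p hp.ne_zero).pow_eq_one
  have hmem : exp (2 * π * I / p) ∈ O := by
    refine ValuationSubring.mem_of_eval_monic (P := X ^ p - 1) (monic_X_pow_sub_C 1 hp.ne_zero) ?_
    simp [hpow]
  refine ⟨⟨_, hmem⟩, rfl, ?_⟩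
  have h1 : (⟨_, hmem⟩ : O) ^ p = 1 := Subtype.ext hpow
  rw [← sub_eq_zero]
  refine eq_zero_of_pow_eq_zero (n := p) ?_
  rw [sub_pow_char, ← map_pow, h1, map_one, one_pow, sub_self]

/-- Every `j`-invariant in `jSet p a` lifts to the `j`-invariant of a point of the fundamental
domain having complex multiplication by an element of norm `p` whose trace is determined by `a`
up to finitely many choices. -/
lemma cmLift_of_prime {p : ℕ} (hp : p.Prime) (hp5 : 5 ≤ p) : CMLift p := by
  have : Fact p.Prime := ⟨hp⟩
  obtain ⟨O, h⟩ := exists_valuationSubring_natCast_mem p hp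
  have := ValuationSubring.charP_residueField hp h
  obtain ⟨u, hu⟩ := ValuationSubring.exists_natCast_mul_eq_one hp h (not_dvd_1728 hp hp5)
  obtain ⟨ζ, hζφ, hζ⟩ := ValuationSubring.exists_coe_eq_exp hp h
  set φ := ZMod.castHom (dvd_refl p) (ResidueField O)
  obtain ⟨H, hH, hH'⟩ := exists_hasse_poly_residueField hp5 h φ
  replace hu : 1728 * u = 1 := by exact_mod_cast hu
  have hHu := hH' (residue O u) (by rw [← map_one (residue O), ← hu, map_mul,
    _root_.map_ofNat (residue O)])
  refine ⟨modularJ, fun z x ↦ ∃ y : O, z = y ∧ residue O y = φ x, fun a ↦ (a : ZMod p) ^ 12,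
    ?_, ?_⟩
  · rintro z x x' ⟨y, rfl, hx⟩ ⟨y', hy', hx'⟩
    obtain rfl := Subtype.ext hy'
    exact φ.injective (hx.symm.trans hx')
  · rintro a j₀ ⟨A, B, hAB, hfr, hj₀⟩
    have ha : (a : ZMod p) ^ 12 = H.eval j₀ := by
      rw [← hfr, hH A B hAB, eq_div_of_mul_eq hAB hj₀]
    obtain ⟨τ, hτ, y, hJ, hy, α, β, γ, δ, hdet, hγ, hfix⟩ :=
      exists_modularJ_lift hu hζφ hζ (j₀ := φ j₀) (by rw [← map_pow, ZMod.pow_card])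
    refine ⟨τ, hτ, ⟨y, hJ, hy⟩, α, β, γ, δ, hdet, hγ, by linear_combination hfix, ?_⟩
    have hmul := mul_eq_of_fixing_matrix hdet hfix
    have hmem : ∀ z w : ℂ, z + w = (α + δ : ℤ) → z * w = p → z ∈ O := by
      intro z w hadd hmul
      refine ValuationSubring.mem_of_eval_monic
        (P := X ^ 2 + (-C ((α + δ : ℤ) : O) * X + C (p : O))) ?_ ?_
      · monicity!
      · have h1 : O.subtype ((α + δ : ℤ) : O) = z + w := by rw [_root_.map_intCast, hadd]
        have h2 : O.subtype (p : O) = z * w := by rw [_root_.map_natCast, hmul]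
        rw [eval₂_add, eval₂_add, eval₂_mul, eval₂_neg, Polynomial.eval₂_C, Polynomial.eval₂_C,
            eval₂_pow, Polynomial.eval₂_X,
          h1, h2]
        ring
    have hO := hmem _ _ (by push_cast; ring) hmul
    have hO' := hmem _ _ (by push_cast; ring) ((mul_comm _ _).trans hmul)
    have hev : (H.map φ).eval (residue O y) = φ ((a : ZMod p) ^ 12) := by
      rw [hy, Polynomial.eval_map, Polynomial.eval₂_at_apply, ha]
    have e1 := residue_pow_eq_of_mul_discriminant_eq (x := ⟨_, hO⟩ ^ 12) hu hζφ hζ hHu hJ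
      (exists_mul_discriminant_eq' hdet hfix)
    have e2 := residue_pow_eq_of_mul_discriminant_eq (x := ⟨_, hO'⟩ ^ 12) hu hζφ hζ hHu hJ
      (exists_mul_discriminant_eq hdet hfix)
    rw [hev, map_pow] at e1 e2
    refine trace_eq_zero_or_pow_eq hp5 (trace_sq_lt hdet hγ hfix) ?_ ?_ e1 e2
    · rw [← map_add, _root_.map_intCast, ← _root_.map_intCast (residue O)]
      congr 1
      refine Subtype.ext ?_
      push_cast
      ring
    · rw [← map_mul, residue_eq_zero_iff]
      convert! h using 1
      exact Subtype.ext hmul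

end

/-- Theorem 1.8 (Lang–Trotter on average over sum-sets `U + V`,
`U, V ⊆ I(T) = {1, …, T}`). -/
theorem LT_average_sumsets (f g : Polynomial ℤ) (hfg : Nondeg f g) :
    ∃ C : ℝ, 0 < C ∧ ∀ T : ℕ, 0 < T → ∀ U V : Finset ℕ,
      U.Nonempty → V.Nonempty → U ⊆ Finset.Icc 1 T → V ⊆ Finset.Icc 1 T →
      ∀ x : ℝ, 2 ≤ x → ∀ a : ℕ → ℤ,
        (∑ uv ∈ (U ×ˢ V).filter fun uv => aeval ((uv.1 + uv.2 : ℕ) : ℚ) (Dpoly f g) ≠ 0,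
            (piSeq f g a ((uv.1 + uv.2 : ℕ) : ℚ) x : ℝ)) ≤
          C * ((T : ℝ) * U.card * V.card +
            ((U.card * V.card : ℕ) : ℝ) ^ ((3 : ℝ) / 4) * x ^ ((5 : ℝ) / 4)) := by
  exact average_of_traceBound f g (traceBound_of_jBound hfg
    (jBound_of_cmLift (p₀ := 4) fun _ hp hp5 ↦ cmLift_of_prime hp hp5))
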